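/- Let d ≥ 1, ρ ∈ (0,2), and let W ∈ S_{2,ρ}(ℝ^d) satisfy: there exist constants C, R ∈ (0,∞) with W(x) ≤ -C|x|^{-ρ} for all x ∈ ℝ^d with |x| ≥ R. Let η = η₀ + η̃ be admissible with mean value η₀ > 0. Then N(E; ηW) / N_cl(E; η₀W) → 1 as E ↑ 0, and moreover there exist constants c₁, c₂ ∈ (0,∞) and E₀ < 0 such that c₁|E|^{d(1/2 - 1/ρ)} ≤ N(E; ηW) ≤ c₂|E|^{d(1/2 - 1/ρ)} for all E ∈ (E₀, 0). -/

import Mathlib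

open MeasureTheory Filter Real Set Topology

noncomputable section

abbrev Ed (d : ℕ) := EuclideanSpace ℝ (Fin d)

/-- Glazman variational count of eigenvalues of `-Δ + V` below `E`. -/
noncomputable def schN (d : ℕ) (V : Ed d → ℝ) (E : ℝ) : ℕ∞ :=
  ⨆ F : {F : Submodule ℝ (Ed d → ℝ) //
      (∀ u ∈ F, ContDiff ℝ (⊤ : ℕ∞) u ∧ HasCompactSupport u) ∧
      (∀ u ∈ F, u ≠ 0 →
        (∫ x, (‖gradient u x‖ ^ 2 + V x * u x ^ 2)) < E * ∫ x, u x ^ 2)},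
    (Module.finrank ℝ F.1 : ℕ∞)

/-- Laplacian. -/
noncomputable def lap (d : ℕ) (φ : Ed d → ℝ) (x : Ed d) : ℝ :=
  ∑ i : Fin d, iteratedFDeriv ℝ 2 φ x ![EuclideanSpace.single i 1, EuclideanSpace.single i 1]

/-- The symbol class `S_{m,ρ}`. -/
def SClass (d m : ℕ) (ρ : ℝ) (W : Ed d → ℝ) : Prop :=
  ContDiff ℝ m W ∧ ∃ C : ℝ, 0 < C ∧ ∀ k : ℕ, k ≤ m → ∀ x : Ed d,
    ‖iteratedFDeriv ℝ k W x‖ ≤ C * (1 + ‖x‖) ^ (-ρ - (k : ℝ))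

/-- The cube `(-R/2, R/2)^d`. -/
def cube (d : ℕ) (R : ℝ) : Set (Ed d) := {x | ∀ i, |x i| < R / 2}

/-- Admissibility of `η` with mean value `η₀` witnessed by the solution `φ` of `Δφ = η - η₀`. -/
structure IsAdmissible (d : ℕ) (η : Ed d → ℝ) (η₀ : ℝ) (φ : Ed d → ℝ) : Prop where
  background_ne : ∃ x, η x ≠ η₀
  smooth : ContDiff ℝ 2 φ
  bounded : ∀ k : ℕ, k ≤ 2 → ∃ M : ℝ, ∀ x, ‖iteratedFDeriv ℝ k φ x‖ ≤ M
  poisson : ∀ x, lap d φ x = η x - η₀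
  normalized : Filter.limsup (fun R : ℝ => (∫ x in cube d R, φ x) / R ^ d) Filter.atTop = 0

/-- Volume of the unit ball of `ℝ^d`. -/
noncomputable def tau (d : ℕ) : ℝ := (volume (Metric.ball (0 : Ed d) 1)).toReal

/-- Semiclassical counting function. -/
noncomputable def Ncl (d : ℕ) (V : Ed d → ℝ) (E : ℝ) : ℝ :=
  (tau d / (2 * π) ^ d) * ∫ x, (max (E - V x) 0) ^ ((d : ℝ) / 2)


/-! ### Part 1: trigonometric systems on the unit cube -/

def w1 (n : ℕ) : ℝ := if n = 0 then 1 else 1 / 2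

lemma w1_pos (n : ℕ) : 0 < w1 n := by unfold w1; split_ifs <;> norm_num

lemma int_cos_int (k : ℤ) : ∫ t in (0:ℝ)..1, cos (π * k * t) = if k = 0 then 1 else 0 := by
  split_ifs with h
  · simp [h]
  · have hk : (π * k : ℝ) ≠ 0 := by
      have : (k : ℝ) ≠ 0 := by exact_mod_cast h
      positivity
    rw [intervalIntegral.integral_comp_mul_left (fun x => cos x) hk]
    simp [mul_comm π (k:ℝ), Real.sin_int_mul_pi]

lemma cont_ii {f : ℝ → ℝ} (hf : Continuous f) : IntervalIntegrable f volume 0 1 :=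
  hf.intervalIntegrable _ _

lemma int_cos_cos (n m : ℕ) :
    ∫ t in (0:ℝ)..1, cos (π * n * t) * cos (π * m * t) = if n = m then w1 n else 0 := by
  have h : ∀ t : ℝ, cos (π * n * t) * cos (π * m * t)
      = (cos (π * ((n:ℤ) - (m:ℤ) : ℤ) * t) + cos (π * ((n:ℤ) + (m:ℤ) : ℤ) * t)) / 2 := by
    intro t
    push_cast
    have e1 : π * ((n:ℝ) - m) * t = π * n * t - π * m * t := by ring
    have e2 : π * ((n:ℝ) + m) * t = π * n * t + π * m * t := by ring
    rw [e1, e2, cos_sub, cos_add]; ring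
  simp_rw [h]
  rw [intervalIntegral.integral_div, intervalIntegral.integral_add (cont_ii (by fun_prop))
    (cont_ii (by fun_prop)), int_cos_int, int_cos_int]
  unfold w1
  by_cases hnm : n = m
  · subst hnm
    by_cases h0 : n = 0
    · simp [h0]
    · have : ¬ ((n:ℤ) + n = 0) := by omega
      simp [h0]
  · have h1 : ¬ ((n:ℤ) - m = 0) := by omega
    have h2 : ¬ ((n:ℤ) + m = 0) := by omega
    simp [h1, h2, hnm]

lemma int_sin_sin (n m : ℕ) (hn : n ≠ 0) :
    ∫ t in (0:ℝ)..1, sin (π * n * t) * sin (π * m * t) = if n = m then w1 n else 0 := by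
  have h : ∀ t : ℝ, sin (π * n * t) * sin (π * m * t)
      = (cos (π * ((n:ℤ) - (m:ℤ) : ℤ) * t) - cos (π * ((n:ℤ) + (m:ℤ) : ℤ) * t)) / 2 := by
    intro t
    push_cast
    have e1 : π * ((n:ℝ) - m) * t = π * n * t - π * m * t := by ring
    have e2 : π * ((n:ℝ) + m) * t = π * n * t + π * m * t := by ring
    rw [e1, e2, cos_sub, cos_add]; ring
  simp_rw [h]
  rw [intervalIntegral.integral_div, intervalIntegral.integral_sub (cont_ii (by fun_prop))
    (cont_ii (by fun_prop)), int_cos_int, int_cos_int]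
  unfold w1
  have h2 : ¬ ((n:ℤ) + m = 0) := by omega
  by_cases hnm : n = m
  · subst hnm
    simp [hn]
  · have h1 : ¬ ((n:ℤ) - m = 0) := by omega
    simp [h1, h2, hnm]

lemma int_cube_prod {d : ℕ} (f : Fin d → ℝ → ℝ) :
    ∫ y in Icc (0 : Fin d → ℝ) 1, ∏ i, f i (y i) = ∏ i, ∫ t in (0:ℝ)..1, f i t := by
  have : (volume : Measure (Fin d → ℝ)).restrict (Icc 0 1)
      = Measure.pi (fun _ => (volume : Measure ℝ).restrict (Icc 0 1)) := by
    rw [← Set.pi_univ_Icc, volume_pi, Measure.restrict_pi_pi]; rfl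
  rw [this, MeasureTheory.integral_fintype_prod_eq_prod]
  refine Finset.prod_congr rfl fun i _ => ?_
  rw [intervalIntegral.integral_of_le zero_le_one, integral_Icc_eq_integral_Ioc]

/-- The Neumann eigenfunctions of the unit cube. -/
def cosP {d : ℕ} (n : Fin d → ℕ) (y : Fin d → ℝ) : ℝ := ∏ i, cos (π * n i * y i)

def sinP {d : ℕ} (i : Fin d) (n : Fin d → ℕ) (y : Fin d → ℝ) : ℝ :=
  ∏ j, (if j = i then sin (π * n j * y j) else cos (π * n j * y j))

def wP {d : ℕ} (n : Fin d → ℕ) : ℝ := ∏ i, w1 (n i)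

lemma wP_pos {d : ℕ} (n : Fin d → ℕ) : 0 < wP n := Finset.prod_pos fun _ _ => w1_pos _

lemma prod_ite_w {d : ℕ} (n m : Fin d → ℕ) :
    (∏ i, (if n i = m i then w1 (n i) else 0)) = if n = m then wP n else 0 := by
  split_ifs with h
  · subst h; simp [wP]
  · obtain ⟨i, hi⟩ := Function.ne_iff.mp h
    exact Finset.prod_eq_zero (Finset.mem_univ i) (by simp [hi])

lemma cosP_orth {d : ℕ} (n m : Fin d → ℕ) :
    ∫ y in Icc (0 : Fin d → ℝ) 1, cosP n y * cosP m y = if n = m then wP n else 0 := by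
  simp_rw [cosP, ← Finset.prod_mul_distrib]
  rw [int_cube_prod (fun i t => cos (π * n i * t) * cos (π * m i * t))]
  simp_rw [int_cos_cos]
  exact prod_ite_w n m

lemma sinP_orth {d : ℕ} (i : Fin d) (n m : Fin d → ℕ) (hn : n i ≠ 0) :
    ∫ y in Icc (0 : Fin d → ℝ) 1, sinP i n y * sinP i m y = if n = m then wP n else 0 := by
  simp_rw [sinP, ← Finset.prod_mul_distrib]
  rw [int_cube_prod (fun j t => (if j = i then sin (π * n j * t) else cos (π * n j * t)) *
    (if j = i then sin (π * m j * t) else cos (π * m j * t)))]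
  rw [← prod_ite_w]
  refine Finset.prod_congr rfl fun j _ => ?_
  by_cases hj : j = i
  · subst hj; simp only [if_true]; exact int_sin_sin _ _ hn
  · simp only [hj, if_false]; exact int_cos_cos _ _

lemma cosP_cont {d : ℕ} (n : Fin d → ℕ) : Continuous (cosP n) := by
  unfold cosP; fun_prop

lemma sinP_cont {d : ℕ} (i : Fin d) (n : Fin d → ℕ) : Continuous (sinP i n) := by
  unfold sinP
  refine continuous_finsetProd _ fun j _ => ?_
  split_ifs <;> fun_prop

lemma cube_int {d : ℕ} {f : (Fin d → ℝ) → ℝ} (hf : Continuous f) :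
    IntegrableOn f (Icc (0 : Fin d → ℝ) 1) :=
  hf.continuousOn.integrableOn_compact isCompact_Icc

/-- Expansion of the square distance to a combination of an orthogonal system. -/
lemma expand_sq {d : ℕ} {J : Type*} (S : Finset J) (e : J → (Fin d → ℝ) → ℝ) (w : J → ℝ)
    (hw : ∀ n ∈ S, 0 < w n) (he : ∀ n ∈ S, Continuous (e n))
    [DecidableEq J]
    (ho : ∀ n ∈ S, ∀ m ∈ S, ∫ y in Icc (0 : Fin d → ℝ) 1, e n y * e m y = if n = m then w n else 0)
    (g : (Fin d → ℝ) → ℝ) (hg : Continuous g) (α : J → ℝ) :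
    ∫ y in Icc (0 : Fin d → ℝ) 1, (g y - ∑ n ∈ S, α n * e n y) ^ 2
      = (∫ y in Icc (0 : Fin d → ℝ) 1, g y ^ 2)
        - ∑ n ∈ S, (∫ y in Icc (0 : Fin d → ℝ) 1, g y * e n y) ^ 2 / w n
        + ∑ n ∈ S, w n * (α n - (∫ y in Icc (0 : Fin d → ℝ) 1, g y * e n y) / w n) ^ 2 := by
  have h1 : ∀ y, (g y - ∑ n ∈ S, α n * e n y) ^ 2
      = g y ^ 2 - ∑ n ∈ S, 2 * α n * (g y * e n y)
        + ∑ n ∈ S, ∑ m ∈ S, α n * α m * (e n y * e m y) := by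
    intro y
    have : (∑ n ∈ S, α n * e n y) ^ 2 = ∑ n ∈ S, ∑ m ∈ S, α n * α m * (e n y * e m y) := by
      rw [sq, Finset.sum_mul_sum]
      exact Finset.sum_congr rfl fun n _ => Finset.sum_congr rfl fun m _ => by ring
    have h2 : ∑ n ∈ S, 2 * α n * (g y * e n y) = 2 * g y * ∑ n ∈ S, α n * e n y := by
      rw [Finset.mul_sum]; exact Finset.sum_congr rfl fun n _ => by ring
    rw [← this, h2]; ring
  have i2 : ∀ n ∈ S, IntegrableOn (fun y => 2 * α n * (g y * e n y)) (Icc (0 : Fin d → ℝ) 1) :=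
    fun n hn => cube_int (by have := he n hn; fun_prop)
  have i3 : ∀ n ∈ S, ∀ m ∈ S,
      IntegrableOn (fun y => α n * α m * (e n y * e m y)) (Icc (0 : Fin d → ℝ) 1) :=
    fun n hn m hm => cube_int (by have := he n hn; have := he m hm; fun_prop)
  simp_rw [h1]
  rw [integral_add, integral_sub, integral_finsetSum S i2, integral_finsetSum]
  · have h3 : ∀ n ∈ S, (∫ y in Icc (0 : Fin d → ℝ) 1, ∑ m ∈ S, α n * α m * (e n y * e m y))
        = α n ^ 2 * w n := by
      intro n hn
      rw [integral_finsetSum S (i3 n hn)]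
      rw [Finset.sum_eq_single n]
      · rw [integral_const_mul, ho n hn n hn, if_pos rfl]; ring
      · intro m hm hmn
        rw [integral_const_mul, ho n hn m hm, if_neg hmn.symm, mul_zero]
      · intro h; exact absurd hn h
    rw [Finset.sum_congr rfl h3, sub_add, sub_add, ← Finset.sum_sub_distrib,
      ← Finset.sum_sub_distrib]
    congr 1
    refine Finset.sum_congr rfl fun n hn => ?_
    have := hw n hn
    rw [integral_const_mul]
    field_simp
    ring
  · intro n hn; exact integrable_finsetSum S (i3 n hn)
  · exact cube_int (by fun_prop)
  · exact integrable_finsetSum S i2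
  · exact (cube_int (by fun_prop : Continuous fun y => g y ^ 2)).sub (integrable_finsetSum S i2)
  · exact integrable_finsetSum S fun n hn => integrable_finsetSum S (i3 n hn)

lemma bessel {d : ℕ} {J : Type*} (S : Finset J) (e : J → (Fin d → ℝ) → ℝ) (w : J → ℝ)
    (hw : ∀ n ∈ S, 0 < w n) (he : ∀ n ∈ S, Continuous (e n))
    [DecidableEq J]
    (ho : ∀ n ∈ S, ∀ m ∈ S, ∫ y in Icc (0 : Fin d → ℝ) 1, e n y * e m y = if n = m then w n else 0)
    (g : (Fin d → ℝ) → ℝ) (hg : Continuous g) :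
    ∑ n ∈ S, (∫ y in Icc (0 : Fin d → ℝ) 1, g y * e n y) ^ 2 / w n
      ≤ ∫ y in Icc (0 : Fin d → ℝ) 1, g y ^ 2 := by
  have h := expand_sq S e w hw he ho g hg
    (fun n => (∫ y in Icc (0 : Fin d → ℝ) 1, g y * e n y) / w n)
  simp only [sub_self, ne_eq, OfNat.ofNat_ne_zero, not_false_eq_true, zero_pow, mul_zero,
    Finset.sum_const_zero, add_zero] at h
  have h0 : 0 ≤ ∫ y in Icc (0 : Fin d → ℝ) 1,
    (g y - ∑ n ∈ S, (∫ y in Icc (0 : Fin d → ℝ) 1, g y * e n y) / w n * e n y) ^ 2 :=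
    integral_nonneg fun y => sq_nonneg _
  linarith

/-! ### Part 2: the Neumann inequality on the unit cube -/

def cosC {d : ℕ} (n : Fin d → ℕ) : C(↥(Icc (0 : Fin d → ℝ) 1), ℝ) :=
  ⟨fun x => cosP n x.1, (cosP_cont n).comp continuous_subtype_val⟩

def tC {d : ℕ} (i : Fin d) : C(↥(Icc (0 : Fin d → ℝ) 1), ℝ) :=
  ⟨fun x => cos (π * x.1 i), continuous_cos.comp
    (continuous_const.mul ((continuous_apply i).comp continuous_subtype_val))⟩

lemma cosP_erase {d : ℕ} (n : Fin d → ℕ) (i : Fin d) (y : Fin d → ℝ) :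
    cosP n y = cos (π * n i * y i) * ∏ j ∈ Finset.univ.erase i, cos (π * n j * y j) := by
  rw [cosP, Finset.mul_prod_erase _ (fun j => cos (π * n j * y j)) (Finset.mem_univ i)]

lemma cosP_update {d : ℕ} (n : Fin d → ℕ) (i : Fin d) (k : ℕ) (y : Fin d → ℝ) :
    cosP (Function.update n i k) y
      = cos (π * k * y i) * ∏ j ∈ Finset.univ.erase i, cos (π * n j * y j) := by
  rw [cosP_erase _ i]
  congr 1
  · simp
  · refine Finset.prod_congr rfl fun j hj => ?_
    rw [Function.update_of_ne (Finset.ne_of_mem_erase hj)]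

lemma tC_mul_cosC {d : ℕ} (n : Fin d → ℕ) (i : Fin d) :
    tC i * cosC n ∈ Submodule.span ℝ (range (cosC (d := d))) := by
  have key : tC i * cosC n = (1 / 2 : ℝ) • cosC (Function.update n i (n i + 1))
      + (1 / 2 : ℝ) • cosC (Function.update n i (n i - 1 + (1 - n i))) := by
    ext x
    simp only [ContinuousMap.mul_apply, ContinuousMap.add_apply, ContinuousMap.smul_apply,
      tC, cosC, ContinuousMap.coe_mk, smul_eq_mul]
    rw [cosP_update, cosP_update, cosP_erase n i]
    have h1 : cos (π * ((n i - 1 + (1 - n i) : ℕ) : ℝ) * x.1 i)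
        = cos (π * n i * x.1 i - π * x.1 i) := by
      rcases Nat.eq_zero_or_pos (n i) with h | h
      · rw [h]; simp
      · have : n i - 1 + (1 - n i) = n i - 1 := by omega
        rw [this, Nat.cast_sub h]; congr 1; push_cast; ring
    have h2 : cos (π * ((n i + 1 : ℕ) : ℝ) * x.1 i) = cos (π * n i * x.1 i + π * x.1 i) := by
      congr 1; push_cast; ring
    rw [h1, h2, cos_add, cos_sub]; ring
  rw [key]
  exact Submodule.add_mem _ (Submodule.smul_mem _ _ (Submodule.subset_span ⟨_, rfl⟩))
    (Submodule.smul_mem _ _ (Submodule.subset_span ⟨_, rfl⟩))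

lemma adjoin_le_span {d : ℕ} (f : C(↥(Icc (0 : Fin d → ℝ) 1), ℝ))
    (hf : f ∈ Algebra.adjoin ℝ (range (tC (d := d)))) :
    f ∈ Submodule.span ℝ (range (cosC (d := d))) := by
  have key : ∀ g ∈ Submodule.span ℝ (range (cosC (d := d))),
      f * g ∈ Submodule.span ℝ (range (cosC (d := d))) := by
    induction hf using Algebra.adjoin_induction with
    | mem x hx =>
      obtain ⟨i, rfl⟩ := hx
      intro g hg
      induction hg using Submodule.span_induction with
      | mem y hy => obtain ⟨n, rfl⟩ := hy; exact tC_mul_cosC n i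
      | zero => simp
      | add a b _ _ ha hb => rw [mul_add]; exact Submodule.add_mem _ ha hb
      | smul c a _ ha => rw [mul_smul_comm]; exact Submodule.smul_mem _ _ ha
    | algebraMap r =>
      intro g hg
      rw [← Algebra.smul_def]; exact Submodule.smul_mem _ _ hg
    | add a b _ _ ha hb => intro g hg; rw [add_mul]; exact Submodule.add_mem _ (ha g hg) (hb g hg)
    | mul a b _ _ ha hb => intro g hg; rw [mul_assoc]; exact ha _ (hb g hg)
  have h1 : (1 : C(↥(Icc (0 : Fin d → ℝ) 1), ℝ)) ∈ Submodule.span ℝ (range (cosC (d := d))) := by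
    refine Submodule.subset_span ⟨0, ?_⟩
    ext x; simp [cosC, cosP]
  simpa using key 1 h1

lemma sep_pts {d : ℕ} : (Algebra.adjoin ℝ (range (tC (d := d)))).SeparatesPoints := by
  intro x y hxy
  have : ∃ i, x.1 i ≠ y.1 i := by
    by_contra h; push Not at h; exact hxy (Subtype.ext (funext h))
  obtain ⟨i, hi⟩ := this
  refine ⟨tC i, ⟨tC i, Algebra.subset_adjoin ⟨i, rfl⟩, rfl⟩, ?_⟩
  simp only [tC, ContinuousMap.coe_mk]
  intro h
  have hx := x.2; have hy := y.2
  have hx0 := hx.1 i; have hx1 := hx.2 i; have hy0 := hy.1 i; have hy1 := hy.2 i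
  simp only [Pi.zero_apply, Pi.one_apply] at hx0 hx1 hy0 hy1
  have := Real.injOn_cos ⟨by positivity, by nlinarith [pi_pos]⟩
    ⟨by positivity, by nlinarith [pi_pos]⟩ h
  exact hi (mul_left_cancel₀ pi_ne_zero this)

lemma vol_cube01 {d : ℕ} : volume (Icc (0 : Fin d → ℝ) 1) = 1 := by
  rw [Real.volume_Icc_pi]; simp

lemma parseval_approx {d : ℕ} (v : (Fin d → ℝ) → ℝ) (hv : Continuous v) (ε : ℝ) (hε : 0 < ε) :
    ∃ S : Finset (Fin d → ℕ), (∫ y in Icc (0 : Fin d → ℝ) 1, v y ^ 2)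
      ≤ ∑ n ∈ S, (∫ y in Icc (0 : Fin d → ℝ) 1, v y * cosP n y) ^ 2 / wP n + ε := by
  classical
  obtain ⟨g, hg⟩ := ContinuousMap.exists_mem_subalgebra_near_continuous_of_separatesPoints
    (Algebra.adjoin ℝ (range (tC (d := d)))) sep_pts (fun x => v x.1)
    (hv.comp continuous_subtype_val) (√ε) (by positivity)
  have hs := adjoin_le_span g.1 g.2
  rw [Finsupp.mem_span_range_iff_exists_finsupp] at hs
  obtain ⟨c, hc⟩ := hs
  refine ⟨c.support, ?_⟩
  have hx := expand_sq c.support cosP wP (fun n _ => wP_pos n) (fun n _ => cosP_cont n)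
    (fun n _ m _ => cosP_orth n m) v hv c
  have h1 : ∫ y in Icc (0 : Fin d → ℝ) 1, (v y - ∑ n ∈ c.support, c n * cosP n y) ^ 2
      ≤ ∫ y in Icc (0 : Fin d → ℝ) 1, ε := by
    refine setIntegral_mono_on (cube_int ?_) (cube_int continuous_const) measurableSet_Icc ?_
    · have := fun n => cosP_cont (d := d) n
      fun_prop
    · intro y hy
      have := hg ⟨y, hy⟩
      have e : (g.1 : C(↥(Icc (0 : Fin d → ℝ) 1), ℝ)) ⟨y, hy⟩
          = ∑ n ∈ c.support, c n * cosP n y := by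
        rw [← hc, Finsupp.sum, ContinuousMap.sum_apply]
        simp [cosC]
      rw [e, Real.norm_eq_abs, abs_sub_comm] at this
      calc _ = |v y - ∑ n ∈ c.support, c n * cosP n y| ^ 2 := (sq_abs _).symm
        _ ≤ (√ε) ^ 2 := by gcongr
        _ = ε := Real.sq_sqrt hε.le
  rw [setIntegral_const, measureReal_def, vol_cube01] at h1
  simp only [ENNReal.toReal_one, one_smul] at h1
  have h2 : 0 ≤ ∑ n ∈ c.support, wP n *
      (c n - (∫ y in Icc (0 : Fin d → ℝ) 1, v y * cosP n y) / wP n) ^ 2 :=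
    Finset.sum_nonneg fun n _ => mul_nonneg (wP_pos n).le (sq_nonneg _)
  linarith

lemma sinP_contDiff {d : ℕ} (i : Fin d) (n : Fin d → ℕ) : ContDiff ℝ 1 (sinP i n) := by
  unfold sinP
  refine contDiff_prod fun j _ => ?_
  split_ifs <;> fun_prop

lemma fderiv_sinP {d : ℕ} (i : Fin d) (n : Fin d → ℕ) (y : Fin d → ℝ) :
    fderiv ℝ (sinP i n) y (Pi.single i 1) = π * n i * cosP n y := by
  rw [← (((sinP_contDiff i n).differentiable (by norm_num)) y).lineDeriv_eq_fderiv]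
  have e : (fun t : ℝ => sinP i n (y + t • Pi.single i 1))
      = fun t => sin (π * n i * (y i + t)) * ∏ j ∈ Finset.univ.erase i, cos (π * n j * y j) := by
    ext t
    rw [sinP, ← Finset.mul_prod_erase _ _ (Finset.mem_univ i)]
    congr 1
    · simp
    · refine Finset.prod_congr rfl fun j hj => ?_
      have := Finset.ne_of_mem_erase hj
      simp [this]
  rw [lineDeriv, e, cosP_erase n i]
  have h : HasDerivAt (fun t : ℝ => sin (π * n i * (y i + t)))
      (cos (π * n i * (y i + 0)) * (π * n i * 1)) 0 :=
    (((hasDerivAt_id (0:ℝ)).const_add (y i)).const_mul (π * n i)).sin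
  rw [(h.mul_const _).deriv]
  simp; ring

lemma ibp_cube {k : ℕ} (i : Fin (k + 1)) (n : Fin (k + 1) → ℕ) (v : (Fin (k + 1) → ℝ) → ℝ)
    (hv : ContDiff ℝ 1 v) :
    ∫ y in Icc (0 : Fin (k + 1) → ℝ) 1, fderiv ℝ v y (Pi.single i 1) * sinP i n y
      = - (π * n i * ∫ y in Icc (0 : Fin (k + 1) → ℝ) 1, v y * cosP n y) := by
  have hs := sinP_contDiff i n
  have hvs : ContDiff ℝ 1 (fun y => v y * sinP i n y) := hv.mul hs
  have hvc : Continuous (fun y => fderiv ℝ v y (Pi.single i 1)) :=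
    (hv.continuous_fderiv (by norm_num)).clm_apply continuous_const
  have hd : ∀ y, fderiv ℝ (fun y => v y * sinP i n y) y (Pi.single i 1)
      = fderiv ℝ v y (Pi.single i 1) * sinP i n y + π * n i * (v y * cosP n y) := by
    intro y
    rw [fderiv_fun_mul ((hv.differentiable (by norm_num)) y)
      ((hs.differentiable (by norm_num)) y)]
    simp [fderiv_sinP]; ring
  have hsum : ∀ y, (∑ j, (if j = i then fderiv ℝ (fun y => v y * sinP i n y) y else 0)
        (Pi.single j 1)) = fderiv ℝ (fun y => v y * sinP i n y) y (Pi.single i 1) := by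
    intro y
    rw [Finset.sum_eq_single i]
    · simp
    · intro j _ hj; simp [hj]
    · simp
  have key := integral_divergence_of_hasFDerivAt_off_countable' (E := ℝ)
    (0 : Fin (k + 1) → ℝ) 1 (by intro j; simp)
    (fun j => if j = i then (fun y => v y * sinP i n y) else 0)
    (fun j y => if j = i then fderiv ℝ (fun y => v y * sinP i n y) y else 0) ∅ countable_empty
    (by
      intro j
      split_ifs
      · exact hvs.continuous.continuousOn
      · exact continuousOn_const)
    (by
      intro y _ j
      split_ifs
      · exact ((hvs.differentiable (by norm_num)) y).hasFDerivAt
      · exact hasFDerivAt_const _ _)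
    (by
      simp_rw [hsum]
      exact cube_int ((hvs.continuous_fderiv (by norm_num)).clm_apply continuous_const))
  simp_rw [hsum, hd] at key
  have hz : ∀ y : Fin (k + 1) → ℝ, (y i = 0 ∨ y i = 1) → sinP i n y = 0 := by
    intro y hy
    refine Finset.prod_eq_zero (Finset.mem_univ i) ?_
    rcases hy with h | h
    · simp [h]
    · simp [h, mul_comm π, Real.sin_nat_mul_pi]
  rw [Finset.sum_eq_single i] at key
  · simp only [if_true] at key
    have z0 : ∀ x : Fin k → ℝ, sinP i n (i.insertNth ((0 : Fin (k + 1) → ℝ) i) x) = 0 :=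
      fun x => hz _ (Or.inl (by simp))
    have z1 : ∀ x : Fin k → ℝ, sinP i n (i.insertNth ((1 : Fin (k + 1) → ℝ) i) x) = 0 :=
      fun x => hz _ (Or.inr (by simp))
    simp only [z0, z1, mul_zero, integral_zero, sub_zero] at key
    rw [integral_add, integral_const_mul] at key
    · linarith
    · exact cube_int (hvc.mul (sinP_cont i n))
    · exact cube_int (by have := cosP_cont n; have := hv.continuous; fun_prop)
  · intro j _ hj; simp [hj]
  · simp

lemma neumann_unit {k : ℕ} (v : (Fin (k + 1) → ℝ) → ℝ) (hv : ContDiff ℝ 1 v) (Λ : ℝ)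
    (h : ∀ n : Fin (k + 1) → ℕ, π ^ 2 * ∑ i, (n i : ℝ) ^ 2 < Λ →
      ∫ y in Icc (0 : Fin (k + 1) → ℝ) 1, v y * cosP n y = 0) :
    Λ * ∫ y in Icc (0 : Fin (k + 1) → ℝ) 1, v y ^ 2
      ≤ ∑ i, ∫ y in Icc (0 : Fin (k + 1) → ℝ) 1, (fderiv ℝ v y (Pi.single i 1)) ^ 2 := by
  classical
  have hr : 0 ≤ ∑ i, ∫ y in Icc (0 : Fin (k + 1) → ℝ) 1, (fderiv ℝ v y (Pi.single i 1)) ^ 2 :=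
    Finset.sum_nonneg fun i _ => integral_nonneg fun y => sq_nonneg _
  have hl : 0 ≤ ∫ y in Icc (0 : Fin (k + 1) → ℝ) 1, v y ^ 2 :=
    integral_nonneg fun y => sq_nonneg _
  rcases le_or_gt Λ 0 with hΛ | hΛ
  · nlinarith
  refine le_of_forall_pos_le_add fun ε hε => ?_
  obtain ⟨S, hS⟩ := parseval_approx v hv.continuous (ε / Λ) (by positivity)
  have hb : ∀ i, ∑ n ∈ S, (π * n i * ∫ y in Icc (0 : Fin (k + 1) → ℝ) 1, v y * cosP n y) ^ 2 / wP n
      ≤ ∫ y in Icc (0 : Fin (k + 1) → ℝ) 1, (fderiv ℝ v y (Pi.single i 1)) ^ 2 := by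
    intro i
    have := bessel (S.filter fun n => n i ≠ 0) (sinP i) wP (fun n _ => wP_pos n)
      (fun n _ => sinP_cont i n)
      (fun n hn m _ => sinP_orth i n m (Finset.mem_filter.mp hn).2)
      (fun y => fderiv ℝ v y (Pi.single i 1))
      ((hv.continuous_fderiv (by norm_num)).clm_apply continuous_const)
    refine le_trans (le_of_eq ?_) this
    rw [Finset.sum_filter]
    refine Finset.sum_congr rfl fun n _ => ?_
    split_ifs with h0
    · rw [ibp_cube i n v hv, neg_sq]
    · push Not at h0; simp [h0]
  have h2 : Λ * ∑ n ∈ S, (∫ y in Icc (0 : Fin (k + 1) → ℝ) 1, v y * cosP n y) ^ 2 / wP n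
      ≤ ∑ i, ∑ n ∈ S,
        (π * n i * ∫ y in Icc (0 : Fin (k + 1) → ℝ) 1, v y * cosP n y) ^ 2 / wP n := by
    rw [Finset.sum_comm, Finset.mul_sum]
    refine Finset.sum_le_sum fun n _ => ?_
    have e : ∑ i, (π * n i * ∫ y in Icc (0 : Fin (k + 1) → ℝ) 1, v y * cosP n y) ^ 2 / wP n
        = (π ^ 2 * ∑ i, (n i : ℝ) ^ 2) *
          ((∫ y in Icc (0 : Fin (k + 1) → ℝ) 1, v y * cosP n y) ^ 2 / wP n) := by
      rw [Finset.mul_sum, Finset.sum_mul]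
      exact Finset.sum_congr rfl fun i _ => by ring
    rw [e]
    by_cases hn : π ^ 2 * ∑ i, (n i : ℝ) ^ 2 < Λ
    · rw [h n hn]; simp
    · push Not at hn
      exact mul_le_mul_of_nonneg_right hn (div_nonneg (sq_nonneg _) (wP_pos n).le)
  have h3 := Finset.sum_le_sum fun i (_ : i ∈ Finset.univ) => hb i
  have h4 := mul_le_mul_of_nonneg_left hS hΛ.le
  have h5 : Λ * (ε / Λ) = ε := by field_simp
  rw [mul_add, h5] at h4
  linarith

/-! ### Part 3: cells, and the upper bound by Neumann bracketing -/

def cell {d : ℕ} (a : Fin d → ℝ) (l : ℝ) : Set (Ed d) := {x | ∀ i, a i ≤ x i ∧ x i < a i + l}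

def embC {d : ℕ} (a : Fin d → ℝ) (l : ℝ) (y : Fin d → ℝ) : Ed d := WithLp.toLp 2 (a + l • y)

lemma cell_meas {d : ℕ} (a : Fin d → ℝ) (l : ℝ) : MeasurableSet (cell a l) := by
  have : cell a l = ⋂ i, {x : Ed d | a i ≤ x i ∧ x i < a i + l} := by
    ext x; simp [cell]
  rw [this]
  refine MeasurableSet.iInter fun i => ?_
  have hc : Measurable fun x : Ed d => x i := by fun_prop
  exact (measurableSet_le measurable_const hc).inter (measurableSet_lt hc measurable_const)

lemma cell_integral {d : ℕ} (a : Fin d → ℝ) (l : ℝ) (hl : 0 < l) (f : Ed d → ℝ) :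
    ∫ x in cell a l, f x = l ^ d * ∫ y in Icc (0 : Fin d → ℝ) 1, f (embC a l y) := by
  rw [← integral_indicator (cell_meas a l)]
  rw [← (EuclideanSpace.volume_preserving_symm_measurableEquiv_toLp (Fin d)).symm.integral_comp
    (MeasurableEquiv.measurableEmbedding _)]
  rw [← integral_add_left_eq_self (μ := (volume : Measure (Fin d → ℝ))) _ a]
  have h := Measure.integral_comp_smul (volume : Measure (Fin d → ℝ))
    (fun z => (cell a l).indicator f (WithLp.toLp 2 (a + z))) l
  have hp : 0 < l ^ d := by positivity
  simp only [Module.finrank_fintype_fun_eq_card, Fintype.card_fin, smul_eq_mul,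
    abs_of_pos (inv_pos.mpr hp)] at h
  have h' : ∫ z : Fin d → ℝ, (cell a l).indicator f (WithLp.toLp 2 (a + z))
      = l ^ d * ∫ x, (cell a l).indicator f (WithLp.toLp 2 (a + l • x)) := by
    rw [h]; field_simp
  have e : (fun x => (cell a l).indicator f (WithLp.toLp 2 (a + l • x)))
      = (Set.pi univ fun i => Ico ((0 : Fin d → ℝ) i) ((1 : Fin d → ℝ) i)).indicator
          (fun y => f (embC a l y)) := by
    ext x
    simp only [indicator, embC]
    congr 1
    simp only [cell, mem_ofPred_eq, Set.mem_pi, mem_univ, forall_true_left, mem_Ico, Pi.zero_apply,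
      Pi.one_apply, eq_iff_iff, Pi.add_apply, Pi.smul_apply, smul_eq_mul]
    refine forall_congr' fun i => and_congr ?_ ?_
    · rw [le_add_iff_nonneg_right, mul_nonneg_iff_of_pos_left hl]
    · rw [add_lt_add_iff_left, mul_lt_iff_lt_one_right hl]
  have e2 : ∫ y in Icc (0 : Fin d → ℝ) 1, f (embC a l y)
      = ∫ x, (cell a l).indicator f (WithLp.toLp 2 (a + l • x)) := by
    rw [e, integral_indicator (MeasurableSet.univ_pi fun i => measurableSet_Ico)]
    refine (setIntegral_congr_set ?_).symm
    exact Measure.univ_pi_Ico_ae_eq_Icc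
  rw [e2, ← h']
  rfl

lemma norm_grad {d : ℕ} (u : Ed d → ℝ) (x : Ed d) : ‖gradient u x‖ = ‖fderiv ℝ u x‖ := by
  rw [gradient, LinearIsometryEquiv.norm_map]

lemma grad_sq {d : ℕ} (u : Ed d → ℝ) (x : Ed d) :
    ‖gradient u x‖ ^ 2 = ∑ i, (fderiv ℝ u x (EuclideanSpace.single i 1)) ^ 2 := by
  rw [EuclideanSpace.norm_sq_eq]
  refine Finset.sum_congr rfl fun i _ => ?_
  have : gradient u x i = fderiv ℝ u x (EuclideanSpace.single i 1) := by
    have h1 : inner ℝ (gradient u x) (EuclideanSpace.single i (1:ℝ))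
      = fderiv ℝ u x (EuclideanSpace.single i 1) := by
      rw [gradient, InnerProductSpace.toDual_symm_apply]
    rw [← h1, EuclideanSpace.inner_single_right]; simp
  rw [this, Real.norm_eq_abs, sq_abs]

def cosQ {d : ℕ} (a : Fin d → ℝ) (l : ℝ) (n : Fin d → ℕ) (x : Ed d) : ℝ :=
  cosP n (fun i => (x i - a i) / l)

lemma cosQ_cont {d : ℕ} (a : Fin d → ℝ) (l : ℝ) (n : Fin d → ℕ) : Continuous (cosQ a l n) := by
  unfold cosQ
  refine (cosP_cont n).comp ?_
  fun_prop

lemma cosQ_emb {d : ℕ} (a : Fin d → ℝ) (l : ℝ) (hl : 0 < l) (n : Fin d → ℕ) (y : Fin d → ℝ) :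
    cosQ a l n (embC a l y) = cosP n y := by
  unfold cosQ embC
  congr 1
  ext i
  simp; field_simp

lemma embC_hasFDerivAt {d : ℕ} (a : Fin d → ℝ) (l : ℝ) (y : Fin d → ℝ) :
    HasFDerivAt (embC a l)
      (((EuclideanSpace.equiv (Fin d) ℝ).symm : (Fin d → ℝ) →L[ℝ] Ed d).comp
        (l • ContinuousLinearMap.id ℝ (Fin d → ℝ))) y := by
  have h : HasFDerivAt (fun y : Fin d → ℝ => a + l • y) (l • ContinuousLinearMap.id ℝ _) y :=
    ((hasFDerivAt_id y).const_smul l).const_add a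
  exact ((EuclideanSpace.equiv (Fin d) ℝ).symm :
    (Fin d → ℝ) →L[ℝ] Ed d).hasFDerivAt.comp y h

lemma embC_contDiff {d : ℕ} (a : Fin d → ℝ) (l : ℝ) {m : WithTop ℕ∞} :
    ContDiff ℝ m (embC a l) := by
  have h : ContDiff ℝ m (fun y : Fin d → ℝ => a + l • y) := by fun_prop
  exact ((EuclideanSpace.equiv (Fin d) ℝ).symm : (Fin d → ℝ) →L[ℝ] Ed d).contDiff.comp h

lemma fderiv_emb {d : ℕ} (a : Fin d → ℝ) (l : ℝ) (u : Ed d → ℝ) (hu : Differentiable ℝ u)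
    (y : Fin d → ℝ) (i : Fin d) :
    fderiv ℝ (fun y => u (embC a l y)) y (Pi.single i 1)
      = l * fderiv ℝ u (embC a l y) (EuclideanSpace.single i 1) := by
  have h := (hu (embC a l y)).hasFDerivAt.comp y (embC_hasFDerivAt a l y)
  have h' : fderiv ℝ (fun y => u (embC a l y)) y = _ := h.fderiv
  rw [h']
  simp

lemma neumann_cell {d : ℕ} (hd : 1 ≤ d) (a : Fin d → ℝ) (l : ℝ) (hl : 0 < l) (u : Ed d → ℝ)
    (hu : ContDiff ℝ 1 u) (Λ : ℝ)
    (h : ∀ n : Fin d → ℕ, π ^ 2 * (∑ i, (n i : ℝ) ^ 2) / l ^ 2 < Λ →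
      ∫ x in cell a l, u x * cosQ a l n x = 0) :
    Λ * ∫ x in cell a l, u x ^ 2 ≤ ∫ x in cell a l, ‖gradient u x‖ ^ 2 := by
  obtain ⟨k, rfl⟩ : ∃ k, d = k + 1 := ⟨d - 1, by omega⟩
  have hp : 0 < l ^ (k + 1) := by positivity
  have hv : ContDiff ℝ 1 (fun y => u (embC a l y)) := hu.comp (embC_contDiff a l)
  have key := neumann_unit (fun y => u (embC a l y)) hv (Λ * l ^ 2) (by
    intro n hn
    have h1 := h n (by rw [div_lt_iff₀ (by positivity)]; exact hn)
    rw [cell_integral a l hl] at h1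
    simp_rw [cosQ_emb a l hl] at h1
    exact (mul_eq_zero.mp h1).resolve_left hp.ne')
  simp_rw [fderiv_emb a l u (hu.differentiable (by norm_num)), mul_pow] at key
  simp_rw [integral_const_mul] at key
  rw [← Finset.mul_sum, ← integral_finsetSum] at key
  · rw [cell_integral a l hl, cell_integral a l hl]
    simp_rw [grad_sq]
    have hl2 : 0 < l ^ 2 := by positivity
    have key2 : Λ * (∫ y in Icc (0 : Fin (k+1) → ℝ) 1, u (embC a l y) ^ 2) ≤ _ :=
      le_of_mul_le_mul_left (by linarith [key]) hl2
    calc _ = l ^ (k + 1) * (Λ * (∫ y in Icc (0 : Fin (k+1) → ℝ) 1, u (embC a l y) ^ 2)) := by ring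
      _ ≤ _ := mul_le_mul_of_nonneg_left key2 hp.le
  · intro i _
    refine cube_int ?_
    have := ((hu.continuous_fderiv (by norm_num)).comp
      (embC_contDiff a l (m := 0)).continuous).clm_apply
        (continuous_const (y := (EuclideanSpace.single i 1 : Ed (k+1))))
    exact this.pow 2

lemma cs_int {d : ℕ} {u : Ed d → ℝ} (hu : ContDiff ℝ (⊤ : ℕ∞) u) (hc : HasCompactSupport u)
    {v : Ed d → ℝ} (hv : Continuous v) : Integrable (fun x => v x * u x ^ 2) := by
  refine (hv.mul (hu.continuous.pow 2)).integrable_of_hasCompactSupport ?_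
  have h : HasCompactSupport (fun x => u x ^ 2) :=
    hc.comp_left (g := fun t : ℝ => t ^ 2) (by simp)
  exact h.mul_left

lemma cs_grad_cont {d : ℕ} {u : Ed d → ℝ} (hu : ContDiff ℝ (⊤ : ℕ∞) u) :
    Continuous (fun x => ‖gradient u x‖ ^ 2) := by
  simp_rw [norm_grad]
  exact ((hu.continuous_fderiv (by simp)).norm).pow 2

lemma cs_grad_int {d : ℕ} {u : Ed d → ℝ} (hu : ContDiff ℝ (⊤ : ℕ∞) u) (hc : HasCompactSupport u) :
    Integrable (fun x => ‖gradient u x‖ ^ 2) := by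
  refine (cs_grad_cont hu).integrable_of_hasCompactSupport ?_
  simp_rw [norm_grad]
  exact (hc.fderiv ℝ).comp_left (g := fun L : Ed d →L[ℝ] ℝ => ‖L‖ ^ 2) (by simp)

theorem upperA {d : ℕ} (hd : 1 ≤ d) {I : Type*} [Fintype I] (a : I → Fin d → ℝ) (l : I → ℝ)
    (hl : ∀ i, 0 < l i) (hdis : Pairwise (Function.onFun Disjoint fun i => cell (a i) (l i)))
    (v : Ed d → ℝ) (hv : Continuous v) (θ : ℝ) (hθ : 0 < θ) (B : I → ℝ)
    (hB : ∀ i, ∀ x ∈ cell (a i) (l i), -B i ≤ v x)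
    (hout : ∀ x, (∀ i, x ∉ cell (a i) (l i)) → 0 ≤ v x)
    (S : I → Finset (Fin d → ℕ))
    (hS : ∀ i n, π ^ 2 * (∑ j, (n j : ℝ) ^ 2) / l i ^ 2 < B i / θ → n ∈ S i)
    (F : Submodule ℝ (Ed d → ℝ))
    (hF : ∀ u ∈ F, ContDiff ℝ (⊤ : ℕ∞) u ∧ HasCompactSupport u)
    (hneg : ∀ u ∈ F, u ≠ 0 → θ * (∫ x, ‖gradient u x‖ ^ 2) + ∫ x, v x * u x ^ 2 < 0) :
    Module.finrank ℝ F ≤ ∑ i, (S i).card := by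
  classical
  by_contra hcon
  push Not at hcon
  have hfd : FiniteDimensional ℝ F := Module.finite_of_finrank_pos (by omega)
  have hIntg : ∀ (u : F) (p : Σ i, S i),
      IntegrableOn (fun x => u.1 x * cosQ (a p.1) (l p.1) p.2.1 x) (cell (a p.1) (l p.1)) := by
    intro u p
    refine Integrable.integrableOn ?_
    exact ((hF _ u.2).1.continuous.mul (cosQ_cont _ _ _)).integrable_of_hasCompactSupport
      (hF _ u.2).2.mul_right
  let ψ : F →ₗ[ℝ] ((Σ i, S i) → ℝ) :=
    { toFun := fun u p => ∫ x in cell (a p.1) (l p.1), u.1 x * cosQ (a p.1) (l p.1) p.2.1 x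
      map_add' := by
        intro u w
        ext p
        simp only [Submodule.coe_add, Pi.add_apply, add_mul]
        exact integral_add (hIntg u p) (hIntg w p)
      map_smul' := by
        intro c u
        ext p
        simp only [Submodule.coe_smul, Pi.smul_apply, smul_eq_mul, mul_assoc, RingHom.id_apply]
        exact integral_const_mul _ _ }
  have hker : LinearMap.ker ψ ≠ ⊥ := by
    refine LinearMap.ker_ne_bot_of_finrank_lt ?_
    simpa using hcon
  obtain ⟨u, hu, hu0⟩ := Submodule.exists_mem_ne_zero_of_ne_bot hker
  have hz : ∀ i, ∀ n ∈ S i, ∫ x in cell (a i) (l i), u.1 x * cosQ (a i) (l i) n x = 0 := by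
    intro i n hn
    exact congrFun (LinearMap.mem_ker.mp hu) ⟨i, ⟨n, hn⟩⟩
  obtain ⟨hs, hc⟩ := hF _ u.2
  have hlt := hneg u.1 u.2 (by simpa using hu0)
  have i1 := cs_grad_int hs hc
  have i2 := cs_int hs hc hv
  have i0 : Integrable (fun x => u.1 x ^ 2) := by
    simpa using cs_int hs hc (continuous_const (y := (1:ℝ)))
  have i3 : Integrable (fun x => θ * ‖gradient u.1 x‖ ^ 2 + v x * u.1 x ^ 2) :=
    (i1.const_mul θ).add i2
  rw [← integral_const_mul, ← integral_add (i1.const_mul θ) i2] at hlt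
  have hm : MeasurableSet (⋃ i, cell (a i) (l i)) :=
    MeasurableSet.iUnion fun i => cell_meas _ _
  rw [← integral_add_compl hm i3] at hlt
  have h2 : 0 ≤ ∫ x in (⋃ i, cell (a i) (l i))ᶜ, θ * ‖gradient u.1 x‖ ^ 2 + v x * u.1 x ^ 2 := by
    refine setIntegral_nonneg hm.compl fun x hx => ?_
    have := hout x (by simpa using hx)
    positivity
  have h3 : 0 ≤ ∫ x in (⋃ i, cell (a i) (l i)), θ * ‖gradient u.1 x‖ ^ 2 + v x * u.1 x ^ 2 := by
    rw [integral_iUnion_fintype (fun i => cell_meas _ _) hdis (fun i => i3.integrableOn)]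
    refine Finset.sum_nonneg fun i _ => ?_
    have hN := neumann_cell hd (a i) (l i) (hl i) u.1 (hs.of_le (by exact_mod_cast le_top))
      (B i / θ) (fun n hn => hz i n (hS i n hn))
    have h4 : ∫ x in cell (a i) (l i), (θ * ‖gradient u.1 x‖ ^ 2 - B i * u.1 x ^ 2)
        ≤ ∫ x in cell (a i) (l i), (θ * ‖gradient u.1 x‖ ^ 2 + v x * u.1 x ^ 2) := by
      refine setIntegral_mono_on ((i1.const_mul θ).sub (i0.const_mul _)).integrableOn
        i3.integrableOn (cell_meas _ _) fun x hx => ?_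
      nlinarith [hB i x hx, sq_nonneg (u.1 x)]
    refine le_trans ?_ h4
    rw [integral_sub (i1.const_mul θ).integrableOn (i0.const_mul _).integrableOn,
      integral_const_mul, integral_const_mul]
    have h5 := mul_le_mul_of_nonneg_left hN hθ.le
    have h6 : θ * (B i / θ * ∫ x in cell (a i) (l i), u.1 x ^ 2)
      = B i * ∫ x in cell (a i) (l i), u.1 x ^ 2 := by field_simp
    linarith
  linarith

/-! ### Part 4: smooth approximations of the Dirichlet eigenfunctions (one dimension) -/

def stD : ℝ → ℝ := deriv Real.smoothTransition

lemma st_smooth {m : ℕ∞} : ContDiff ℝ m Real.smoothTransition := Real.smoothTransition.contDiff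

lemma st_hasDeriv (x : ℝ) : HasDerivAt Real.smoothTransition (stD x) x :=
  (((st_smooth (m := 1)).differentiable (by norm_num)) x).hasDerivAt

lemma stD_cont : Continuous stD := (st_smooth (m := 1)).continuous_deriv (by norm_num)

lemma stD_gt {x : ℝ} (h : 1 < x) : stD x = 0 := by
  have : Real.smoothTransition =ᶠ[𝓝 x] fun _ => 1 := by
    filter_upwards [lt_mem_nhds h] with y hy
    exact Real.smoothTransition.one_of_one_le hy.le
  rw [stD, this.deriv_eq]; simp

lemma stD_lt {x : ℝ} (h : x < 0) : stD x = 0 := by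
  have : Real.smoothTransition =ᶠ[𝓝 x] fun _ => 0 := by
    filter_upwards [gt_mem_nhds h] with y hy
    exact Real.smoothTransition.zero_of_nonpos hy.le
  rw [stD, this.deriv_eq]; simp

lemma stD_bdd : ∃ M : ℝ, 0 ≤ M ∧ ∀ x, |stD x| ≤ M := by
  obtain ⟨M, hM⟩ := (isCompact_Icc (a := (0:ℝ)) (b := 1)).exists_bound_of_continuousOn
    stD_cont.continuousOn
  have hM0 : 0 ≤ M := (norm_nonneg _).trans (hM 0 (by simp))
  refine ⟨M, hM0, fun x => ?_⟩
  rcases lt_or_ge x 0 with h | h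
  · rw [stD_lt h]; simpa
  rcases lt_or_ge 1 x with h' | h'
  · rw [stD_gt h']; simpa
  exact hM x ⟨h, h'⟩

def f1 (N k : ℕ) (x : ℝ) : ℝ :=
  Real.smoothTransition (N * x - 1) * Real.smoothTransition (N * (1 - x) - 1) * sin (π * k * x)

def g1 (N k : ℕ) (x : ℝ) : ℝ :=
  (stD (N * x - 1) * N * Real.smoothTransition (N * (1 - x) - 1)
    + Real.smoothTransition (N * x - 1) * (stD (N * (1 - x) - 1) * (-N))) * sin (π * k * x)
  + Real.smoothTransition (N * x - 1) * Real.smoothTransition (N * (1 - x) - 1)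
    * (cos (π * k * x) * (π * k))

lemma f1_smooth (N k : ℕ) {m : ℕ∞} : ContDiff ℝ m (f1 N k) := by
  unfold f1
  refine (ContDiff.mul ?_ ?_).mul ?_
  · exact st_smooth.comp (by fun_prop)
  · exact st_smooth.comp (by fun_prop)
  · fun_prop

lemma f1_hasDeriv (N k : ℕ) (x : ℝ) : HasDerivAt (f1 N k) (g1 N k x) x := by
  unfold f1 g1
  have h1 : HasDerivAt (fun x : ℝ => (N:ℝ) * x - 1) N x := by
    simpa using ((hasDerivAt_id x).const_mul (N:ℝ)).sub_const 1
  have h2 : HasDerivAt (fun x : ℝ => (N:ℝ) * (1 - x) - 1) (-N) x := by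
    simpa using (((hasDerivAt_id x).const_sub 1).const_mul (N:ℝ)).sub_const 1
  have h3 : HasDerivAt (fun x : ℝ => π * k * x) (π * k) x := by
    simpa using (hasDerivAt_id x).const_mul (π * k)
  have h1' := (st_hasDeriv ((N:ℝ) * x - 1)).comp x h1
  have h2' := (st_hasDeriv ((N:ℝ) * (1 - x) - 1)).comp x h2
  exact (h1'.mul h2').mul h3.sin

lemma f1_cont (N k : ℕ) : Continuous (f1 N k) := (f1_smooth N k (m := 0)).continuous

lemma g1_cont (N k : ℕ) : Continuous (g1 N k) := by
  have h1 := stD_cont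
  have h2 : Continuous Real.smoothTransition := Real.smoothTransition.continuous
  unfold g1
  fun_prop

lemma f1_zero (N k : ℕ) (x : ℝ) (h : N * x ≤ 1 ∨ N * (1 - x) ≤ 1) : f1 N k x = 0 := by
  unfold f1
  rcases h with h | h
  · rw [Real.smoothTransition.zero_of_nonpos (by linarith)]; simp
  · rw [Real.smoothTransition.zero_of_nonpos (x := N * (1 - x) - 1) (by linarith)]; simp

lemma st_abs (x : ℝ) : |Real.smoothTransition x| ≤ 1 := by
  rw [abs_of_nonneg (Real.smoothTransition.nonneg x)]; exact Real.smoothTransition.le_one x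

lemma f1_bdd (N k : ℕ) (x : ℝ) : |f1 N k x| ≤ 1 := by
  unfold f1
  rw [abs_mul, abs_mul]
  have h1 := st_abs (N * x - 1)
  have h2 := st_abs (N * (1 - x) - 1)
  have h3 := abs_sin_le_one (π * k * x)
  calc _ ≤ (1:ℝ) * 1 * 1 := by gcongr
    _ = 1 := by norm_num

lemma g1_bdd (k : ℕ) : ∃ M : ℝ, ∀ N : ℕ, ∀ x ∈ Icc (0:ℝ) 1, |g1 N k x| ≤ M := by
  obtain ⟨M, hM0, hM⟩ := stD_bdd
  refine ⟨2 * π * k * M + 2 * π * k * M + π * k, fun N x hx => ?_⟩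
  have hsx : |sin (π * k * x)| ≤ π * k * x := by
    have := hx.1
    refine (abs_sin_le_abs).trans (le_of_eq (abs_of_nonneg (by positivity)))
  have hsx' : |sin (π * k * x)| ≤ π * k * (1 - x) := by
    have e : π * k * x = k * π - π * k * (1 - x) := by ring
    rw [e, Real.sin_nat_mul_pi_sub, abs_neg, abs_mul, abs_pow, abs_neg, abs_one, one_pow, one_mul]
    have := sub_nonneg.mpr hx.2
    refine (abs_sin_le_abs).trans (le_of_eq (abs_of_nonneg (by positivity)))
  have A : |stD (N * x - 1) * N * Real.smoothTransition (N * (1 - x) - 1) * sin (π * k * x)|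
      ≤ 2 * π * k * M := by
    rcases lt_or_ge 1 ((N:ℝ) * x - 1) with h | h
    · rw [stD_gt h]; simp; positivity
    · rw [abs_mul, abs_mul, abs_mul, abs_of_nonneg (Nat.cast_nonneg N : (0:ℝ) ≤ N)]
      calc _ ≤ M * N * 1 * (π * k * x) := by
            gcongr
            · exact hM _
            · exact st_abs _
        _ = M * (π * k) * (N * x) := by ring
        _ ≤ M * (π * k) * 2 := by gcongr; linarith
        _ = _ := by ring
  have B : |Real.smoothTransition (N * x - 1) * (stD (N * (1 - x) - 1) * (-N)) * sin (π * k * x)|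
      ≤ 2 * π * k * M := by
    rcases lt_or_ge 1 ((N:ℝ) * (1 - x) - 1) with h | h
    · rw [stD_gt h]; simp; positivity
    · rw [abs_mul, abs_mul, abs_mul, abs_neg, abs_of_nonneg (Nat.cast_nonneg N : (0:ℝ) ≤ N)]
      calc _ ≤ 1 * (M * N) * (π * k * (1 - x)) := by
            gcongr
            · exact st_abs _
            · exact hM _
        _ = M * (π * k) * (N * (1 - x)) := by ring
        _ ≤ M * (π * k) * 2 := by gcongr; linarith
        _ = _ := by ring
  have C : |Real.smoothTransition (N * x - 1) * Real.smoothTransition (N * (1 - x) - 1)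
    * (cos (π * k * x) * (π * k))| ≤ π * k := by
    rw [abs_mul, abs_mul, abs_mul, abs_of_nonneg (by positivity : 0 ≤ π * (k:ℝ))]
    calc _ ≤ (1:ℝ) * 1 * (1 * (π * k)) := by
          gcongr
          · exact st_abs _
          · exact st_abs _
          · exact abs_cos_le_one _
      _ = _ := by ring
  unfold g1
  rw [add_mul]
  exact (abs_add_le _ _).trans (add_le_add ((abs_add_le _ _).trans (add_le_add A B)) C)

lemma ev_big {x : ℝ} (hx : x ∈ Ioo (0:ℝ) 1) :
    ∀ᶠ N : ℕ in atTop, 1 < (N:ℝ) * x - 1 ∧ 1 < (N:ℝ) * (1 - x) - 1 := by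
  have h1 : Tendsto (fun N : ℕ => (N:ℝ) * x) atTop atTop :=
    tendsto_natCast_atTop_atTop.atTop_mul_const hx.1
  have h2 : Tendsto (fun N : ℕ => (N:ℝ) * (1 - x)) atTop atTop :=
    tendsto_natCast_atTop_atTop.atTop_mul_const (sub_pos.mpr hx.2)
  filter_upwards [h1.eventually_gt_atTop 2, h2.eventually_gt_atTop 2] with N a b
  constructor <;> linarith

lemma f1_lim (k : ℕ) {x : ℝ} (hx : x ∈ Ioo (0:ℝ) 1) :
    Tendsto (fun N : ℕ => f1 N k x) atTop (𝓝 (sin (π * k * x))) := by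
  refine tendsto_const_nhds.congr' ?_
  filter_upwards [ev_big hx] with N h
  unfold f1
  rw [Real.smoothTransition.one_of_one_le h.1.le, Real.smoothTransition.one_of_one_le h.2.le]; ring

lemma g1_lim (k : ℕ) {x : ℝ} (hx : x ∈ Ioo (0:ℝ) 1) :
    Tendsto (fun N : ℕ => g1 N k x) atTop (𝓝 (π * k * cos (π * k * x))) := by
  refine tendsto_const_nhds.congr' ?_
  filter_upwards [ev_big hx] with N h
  unfold g1
  rw [Real.smoothTransition.one_of_one_le h.1.le, Real.smoothTransition.one_of_one_le h.2.le,
    stD_gt h.1, stD_gt h.2]; ring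

lemma ae_Ioo : ∀ᵐ x : ℝ, x ∈ uIoc (0:ℝ) 1 → x ∈ Ioo (0:ℝ) 1 := by
  have : ∀ᵐ x : ℝ, x ≠ 1 := by simp [ae_iff]
  filter_upwards [this] with x hx h
  rw [uIoc_of_le zero_le_one] at h
  exact ⟨h.1, lt_of_le_of_ne h.2 hx⟩

lemma f1_gram (k m : ℕ) (hk : k ≠ 0) :
    Tendsto (fun N : ℕ => ∫ x in (0:ℝ)..1, f1 N k x * f1 N m x) atTop
      (𝓝 (if k = m then 1 / 2 else 0)) := by
  have e := int_sin_sin k m hk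
  simp only [w1, hk, if_false] at e
  rw [← e]
  refine intervalIntegral.tendsto_integral_filter_of_dominated_convergence (fun _ => 1) ?_ ?_ ?_ ?_
  · exact Eventually.of_forall fun N => ((f1_cont N k).mul (f1_cont N m)).aestronglyMeasurable
  · refine Eventually.of_forall fun N => Eventually.of_forall fun x _ => ?_
    rw [Real.norm_eq_abs, abs_mul]
    exact mul_le_one₀ (f1_bdd N k x) (abs_nonneg _) (f1_bdd N m x)
  · exact intervalIntegrable_const
  · filter_upwards [ae_Ioo] with x hx h
    exact (f1_lim k (hx h)).mul (f1_lim m (hx h))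

lemma g1_gram (k m : ℕ) (hk : k ≠ 0) :
    Tendsto (fun N : ℕ => ∫ x in (0:ℝ)..1, g1 N k x * g1 N m x) atTop
      (𝓝 (if k = m then π ^ 2 * k ^ 2 * (1 / 2) else 0)) := by
  have e : ∫ t in (0:ℝ)..1, (π * k * cos (π * k * t)) * (π * m * cos (π * m * t))
      = if k = m then π ^ 2 * k ^ 2 * (1 / 2) else 0 := by
    have h : ∀ t : ℝ, (π * k * cos (π * k * t)) * (π * m * cos (π * m * t))
      = (π * k * (π * m)) * (cos (π * k * t) * cos (π * m * t)) := fun t => by ring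
    simp_rw [h]
    rw [intervalIntegral.integral_const_mul, int_cos_cos]
    simp only [w1, hk, if_false]
    split_ifs with hkm
    · subst hkm; ring
    · simp
  rw [← e]
  obtain ⟨A, hA⟩ := g1_bdd k
  obtain ⟨B, hB⟩ := g1_bdd m
  have hA0 : 0 ≤ A := (abs_nonneg _).trans (hA 0 0 (by simp))
  refine intervalIntegral.tendsto_integral_filter_of_dominated_convergence (fun _ => A * B)
    ?_ ?_ ?_ ?_
  · exact Eventually.of_forall fun N => ((g1_cont N k).mul (g1_cont N m)).aestronglyMeasurable
  · refine Eventually.of_forall fun N => Eventually.of_forall fun x hx => ?_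
    rw [uIoc_of_le zero_le_one] at hx
    rw [Real.norm_eq_abs, abs_mul]
    have hx' : x ∈ Icc (0:ℝ) 1 := ⟨hx.1.le, hx.2⟩
    exact mul_le_mul (hA N x hx') (hB N x hx') (abs_nonneg _) hA0
  · exact intervalIntegrable_const
  · filter_upwards [ae_Ioo] with x hx h
    exact (g1_lim k (hx h)).mul (g1_lim m (hx h))

/-! ### Part 5: the lower bound by Dirichlet bracketing -/

def fP {d : ℕ} (N : ℕ) (n : Fin d → ℕ) (y : Fin d → ℝ) : ℝ := ∏ i, f1 N (n i) (y i)

def gP {d : ℕ} (N : ℕ) (i : Fin d) (n : Fin d → ℕ) (y : Fin d → ℝ) : ℝ :=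
  ∏ j, if j = i then g1 N (n j) (y j) else f1 N (n j) (y j)

lemma fP_smooth {d : ℕ} (N : ℕ) (n : Fin d → ℕ) {m : ℕ∞} : ContDiff ℝ m (fP N n) := by
  unfold fP
  refine contDiff_prod fun i _ => ?_
  exact (f1_smooth N (n i)).comp (contDiff_apply ℝ ℝ i)

lemma fderiv_fP {d : ℕ} (N : ℕ) (i : Fin d) (n : Fin d → ℕ) (y : Fin d → ℝ) :
    fderiv ℝ (fP N n) y (Pi.single i 1) = gP N i n y := by
  rw [← (((fP_smooth N n (m := 1)).differentiable (by norm_num)) y).lineDeriv_eq_fderiv]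
  have e : (fun t : ℝ => fP N n (y + t • Pi.single i 1))
      = fun t => f1 N (n i) (y i + t) * ∏ j ∈ Finset.univ.erase i, f1 N (n j) (y j) := by
    ext t
    rw [fP, ← Finset.mul_prod_erase _ _ (Finset.mem_univ i)]
    congr 1
    · simp
    · refine Finset.prod_congr rfl fun j hj => ?_
      have := Finset.ne_of_mem_erase hj
      simp [this]
  rw [lineDeriv, e, gP, ← Finset.mul_prod_erase _ _ (Finset.mem_univ i)]
  have h : HasDerivAt (fun t : ℝ => f1 N (n i) (y i + t)) (g1 N (n i) (y i)) 0 := by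
    have h0 : HasDerivAt (f1 N (n i)) (g1 N (n i) (y i)) (y i + 0) := by
      simpa using f1_hasDeriv N (n i) (y i)
    simpa using h0.comp_const_add (y i) 0
  rw [(h.mul_const _).deriv]
  simp only [if_true]
  congr 1
  refine Finset.prod_congr rfl fun j hj => ?_
  rw [if_neg (Finset.ne_of_mem_erase hj)]

lemma fP_gram {d : ℕ} (n m : Fin d → ℕ) (hn : ∀ i, n i ≠ 0) :
    Tendsto (fun N : ℕ => ∫ y in Icc (0 : Fin d → ℝ) 1, fP N n y * fP N m y) atTop
      (𝓝 (if n = m then (1 / 2) ^ d else 0)) := by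
  have e : ∀ N : ℕ, ∫ y in Icc (0 : Fin d → ℝ) 1, fP N n y * fP N m y
      = ∏ i, ∫ t in (0:ℝ)..1, f1 N (n i) t * f1 N (m i) t := by
    intro N
    rw [← int_cube_prod]
    simp only [fP, Finset.prod_mul_distrib]
  simp_rw [e]
  have e2 : (if n = m then (1 / 2 : ℝ) ^ d else 0) = ∏ i, if n i = m i then (1/2 : ℝ) else 0 := by
    by_cases h : n = m
    · subst h; simp
    · rw [if_neg h]
      obtain ⟨i, hi⟩ := Function.ne_iff.mp h
      exact (Finset.prod_eq_zero (Finset.mem_univ i) (by simp [hi])).symm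
  rw [e2]
  exact tendsto_finsetProd _ fun i _ => f1_gram (n i) (m i) (hn i)

lemma gP_gram {d : ℕ} (i : Fin d) (n m : Fin d → ℕ) (hn : ∀ i, n i ≠ 0) :
    Tendsto (fun N : ℕ => ∫ y in Icc (0 : Fin d → ℝ) 1, gP N i n y * gP N i m y) atTop
      (𝓝 (if n = m then π ^ 2 * (n i : ℝ) ^ 2 * (1 / 2) ^ d else 0)) := by
  have e : ∀ N : ℕ, ∫ y in Icc (0 : Fin d → ℝ) 1, gP N i n y * gP N i m y
      = ∏ j, ∫ t in (0:ℝ)..1, if j = i then g1 N (n j) t * g1 N (m j) t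
          else f1 N (n j) t * f1 N (m j) t := by
    intro N
    rw [← int_cube_prod]
    simp only [gP, ← Finset.prod_mul_distrib]
    congr 1; ext y
    refine Finset.prod_congr rfl fun j _ => ?_
    split_ifs <;> rfl
  simp_rw [e]
  have e2 : (if n = m then π ^ 2 * (n i : ℝ) ^ 2 * (1 / 2 : ℝ) ^ d else 0)
      = ∏ j, if j = i then (if n j = m j then π ^ 2 * (n j : ℝ) ^ 2 * (1/2 : ℝ) else 0)
        else (if n j = m j then (1/2 : ℝ) else 0) := by
    by_cases h : n = m
    · subst h
      simp only [if_true]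
      have : ∀ j, (if j = i then π ^ 2 * (n j : ℝ) ^ 2 * (1/2 : ℝ) else 1 / 2)
        = (if j = i then π ^ 2 * (n j : ℝ) ^ 2 else 1) * (1 / 2) := by
        intro j; split_ifs <;> ring
      simp_rw [this]
      rw [Finset.prod_mul_distrib]
      simp
    · rw [if_neg h]
      obtain ⟨j, hj⟩ := Function.ne_iff.mp h
      exact (Finset.prod_eq_zero (Finset.mem_univ j) (by simp [hj])).symm
  rw [e2]
  refine tendsto_finsetProd _ fun j _ => ?_
  by_cases h1 : j = i
  · simp only [h1, if_true]
    exact g1_gram (n i) (m i) (hn i)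
  · simp only [h1, if_false]
    exact f1_gram (n j) (m j) (hn j)

lemma negdef_of_near {J : Type*} (S : Finset J) (G D : J → J → ℝ) (g : J → ℝ) (ε δ : ℝ)
    (hε : 0 ≤ ε)
    (hGD : ∀ n ∈ S, ∀ m ∈ S, |G n m - D n m| ≤ ε)
    (hD : ∀ (α : J → ℝ), ∑ n ∈ S, ∑ m ∈ S, α n * α m * D n m = ∑ n ∈ S, g n * α n ^ 2)
    (hg : ∀ n ∈ S, g n ≤ -δ) (h : ε * S.card < δ) (α : J → ℝ) (hα : ∃ n ∈ S, α n ≠ 0) :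
    ∑ n ∈ S, ∑ m ∈ S, α n * α m * G n m < 0 := by
  have hpos : 0 < ∑ n ∈ S, α n ^ 2 := by
    obtain ⟨n, hn, h0⟩ := hα
    exact Finset.sum_pos' (fun _ _ => sq_nonneg _) ⟨n, hn, by positivity⟩
  have h1 : ∑ n ∈ S, ∑ m ∈ S, α n * α m * G n m
      ≤ ∑ n ∈ S, ∑ m ∈ S, (α n * α m * D n m + ε * (|α n| * |α m|)) := by
    refine Finset.sum_le_sum fun n hn => Finset.sum_le_sum fun m hm => ?_
    have h2 : α n * α m * (G n m - D n m) ≤ |α n * α m| * ε := by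
      refine (le_abs_self _).trans ?_
      rw [abs_mul]
      exact mul_le_mul_of_nonneg_left (hGD n hn m hm) (abs_nonneg _)
    rw [abs_mul] at h2
    linarith
  have h2 : ∑ n ∈ S, ∑ m ∈ S, (α n * α m * D n m + ε * (|α n| * |α m|))
      = ∑ n ∈ S, g n * α n ^ 2 + ε * (∑ n ∈ S, |α n|) ^ 2 := by
    simp_rw [Finset.sum_add_distrib]
    rw [hD, sq, Finset.sum_mul_sum, Finset.mul_sum]
    simp_rw [Finset.mul_sum]
  have h3 : (∑ n ∈ S, |α n|) ^ 2 ≤ S.card * ∑ n ∈ S, α n ^ 2 := by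
    have := sq_sum_le_card_mul_sum_sq (s := S) (f := fun n => |α n|)
    simpa using this
  have h4 : ∑ n ∈ S, g n * α n ^ 2 ≤ -δ * ∑ n ∈ S, α n ^ 2 := by
    rw [Finset.mul_sum]
    exact Finset.sum_le_sum fun n hn => mul_le_mul_of_nonneg_right (hg n hn) (sq_nonneg _)
  have h5 := mul_le_mul_of_nonneg_left h3 hε
  have h6 := mul_lt_mul_of_pos_right h hpos
  rw [h2] at h1
  nlinarith

lemma negdef_lim {J : Type*} [DecidableEq J] (S : Finset J) (G : ℕ → J → J → ℝ) (g : J → ℝ)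
    (hG : ∀ n ∈ S, ∀ m ∈ S, Tendsto (fun N => G N n m) atTop (𝓝 (if n = m then g n else 0)))
    (hg : ∀ n ∈ S, g n < 0) :
    ∀ᶠ N in atTop, ∀ α : J → ℝ, (∃ n ∈ S, α n ≠ 0) →
      ∑ n ∈ S, ∑ m ∈ S, α n * α m * G N n m < 0 := by
  obtain ⟨δ, hδ, hgδ⟩ : ∃ δ > 0, ∀ n ∈ S, g n ≤ -δ := by
    rcases S.eq_empty_or_nonempty with h | h
    · exact ⟨1, one_pos, by simp [h]⟩
    · obtain ⟨n, hn, hmax⟩ := S.exists_max_image g h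
      exact ⟨-g n, by linarith [hg n hn], fun m hm => by linarith [hmax m hm]⟩
  have hε : 0 < δ / (S.card + 1) := by positivity
  have hev : ∀ᶠ N in atTop, ∀ n ∈ S, ∀ m ∈ S,
      |G N n m - (if n = m then g n else 0)| ≤ δ / (S.card + 1) := by
    rw [eventually_all_finset]
    intro n hn
    rw [eventually_all_finset]
    intro m hm
    have := (Metric.tendsto_nhds.mp (hG n hn m hm)) _ hε
    filter_upwards [this] with N hN
    exact hN.le
  filter_upwards [hev] with N hN α hα
  refine negdef_of_near S (G N) (fun n m => if n = m then g n else 0) g _ δ hε.le hN ?_ hgδ ?_ α hα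
  · intro α
    refine Finset.sum_congr rfl fun n hn => ?_
    rw [Finset.sum_eq_single n]
    · simp; ring
    · intro m _ hm; simp [hm.symm]
    · intro h; exact absurd hn h
  · rw [div_mul_eq_mul_div, div_lt_iff₀ (by positivity)]
    nlinarith

def uQ {d : ℕ} (a : Fin d → ℝ) (l : ℝ) (N : ℕ) (n : Fin d → ℕ) (x : Ed d) : ℝ :=
  fP N n (fun i => (x i - a i) / l)

lemma uQ_emb {d : ℕ} (a : Fin d → ℝ) (l : ℝ) (hl : 0 < l) (N : ℕ) (n : Fin d → ℕ)
    (y : Fin d → ℝ) : uQ a l N n (embC a l y) = fP N n y := by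
  unfold uQ embC
  congr 1
  ext i
  simp; field_simp

lemma uQ_smooth {d : ℕ} (a : Fin d → ℝ) (l : ℝ) (N : ℕ) (n : Fin d → ℕ) {m : ℕ∞} :
    ContDiff ℝ m (uQ a l N n) := by
  unfold uQ
  refine (fP_smooth N n).comp ?_
  fun_prop

lemma uQ_fderiv {d : ℕ} (a : Fin d → ℝ) (l : ℝ) (hl : 0 < l) (N : ℕ) (n : Fin d → ℕ) (i : Fin d)
    (y : Fin d → ℝ) :
    fderiv ℝ (uQ a l N n) (embC a l y) (EuclideanSpace.single i 1) = l⁻¹ * gP N i n y := by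
  have h := fderiv_emb a l (uQ a l N n) ((uQ_smooth a l N n (m := 1)).differentiable (by norm_num))
    y i
  simp_rw [uQ_emb a l hl] at h
  have h2 := fderiv_fP N i n y
  rw [show (fun y => fP N n y) = fP N n from rfl, h2] at h
  rw [h]; field_simp

lemma uQ_supp {d : ℕ} (a : Fin d → ℝ) (l : ℝ) (hl : 0 < l) (N : ℕ) (hN : 0 < N)
    (n : Fin d → ℕ) : tsupport (uQ a l N n) ⊆ cell a l ∧ HasCompactSupport (uQ a l N n) := by
  have hN' : (0:ℝ) < N := by exact_mod_cast hN
  let K : Set (Ed d) := {x | ∀ i, a i + l / N ≤ x i ∧ x i ≤ a i + l - l / N}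
  have hK : IsClosed K := by
    have : K = ⋂ i, {x : Ed d | a i + l / N ≤ x i ∧ x i ≤ a i + l - l / N} := by
      ext x; simp [K]
    rw [this]
    refine isClosed_iInter fun i => ?_
    have hc : Continuous fun x : Ed d => x i := by fun_prop
    exact (isClosed_le continuous_const hc).inter (isClosed_le hc continuous_const)
  have hsub : Function.support (uQ a l N n) ⊆ K := by
    intro x hx i
    by_contra hcon
    refine hx (Finset.prod_eq_zero (Finset.mem_univ i) (f1_zero _ _ _ ?_))
    by_contra h2
    push Not at h2
    refine hcon ⟨?_, ?_⟩
    · have := h2.1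
      rw [mul_div_assoc', lt_div_iff₀ hl] at this
      have h3 : l / N ≤ x i - a i := by rw [div_le_iff₀ hN']; linarith
      linarith
    · have := h2.2
      have e : (N:ℝ) * (1 - (x i - a i) / l) = (N * (l - (x i - a i))) / l := by field_simp
      rw [e, lt_div_iff₀ hl] at this
      have h3 : l / N ≤ l - (x i - a i) := by rw [div_le_iff₀ hN']; linarith
      linarith
  have hts : tsupport (uQ a l N n) ⊆ K := closure_minimal hsub hK
  have hp : 0 < l / N := by positivity
  have hKc : IsCompact K := by
    have h1 : IsCompact (Icc a (fun i => a i + l)) := isCompact_Icc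
    have h2 : IsCompact ((EuclideanSpace.equiv (Fin d) ℝ).symm '' (Icc a (fun i => a i + l))) :=
      h1.image (EuclideanSpace.equiv (Fin d) ℝ).symm.continuous
    refine h2.of_isClosed_subset hK ?_
    intro x hx
    refine ⟨EuclideanSpace.equiv (Fin d) ℝ x, ⟨fun i => ?_, fun i => ?_⟩, by simp⟩
    · have := (hx i).1
      simp; linarith
    · have := (hx i).2
      simp; linarith
  refine ⟨hts.trans ?_, hKc.of_isClosed_subset (isClosed_tsupport _) hts⟩
  intro x hx i
  exact ⟨by linarith [(hx i).1], by linarith [(hx i).2]⟩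

lemma sum_sq_expand {J : Type*} (S : Finset J) (α x : J → ℝ) :
    (∑ n ∈ S, α n * x n) ^ 2 = ∑ n ∈ S, ∑ m ∈ S, α n * α m * (x n * x m) := by
  rw [sq, Finset.sum_mul_sum]
  refine Finset.sum_congr rfl fun n _ => Finset.sum_congr rfl fun m _ => by ring

lemma fderiv_lincomb {d : ℕ} {J : Type*} (S : Finset J) (α : J → ℝ) (T : J → Ed d → ℝ)
    (hT : ∀ n ∈ S, Differentiable ℝ (T n)) (x : Ed d) :
    fderiv ℝ (fun x => ∑ n ∈ S, α n * T n x) x = ∑ n ∈ S, α n • fderiv ℝ (T n) x := by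
  rw [fderiv_fun_sum]
  · refine Finset.sum_congr rfl fun n hn => ?_
    exact fderiv_const_mul (hT n hn x) _
  · intro n hn
    exact (hT n hn x).const_mul _

lemma cs_intOn_mul {d : ℕ} {f g : Ed d → ℝ} (hf : Continuous f) (hg : Continuous g)
    (hc : HasCompactSupport f) (s : Set (Ed d)) : IntegrableOn (fun x => f x * g x) s :=
  ((hf.mul hg).integrable_of_hasCompactSupport hc.mul_right).integrableOn

lemma dirichlet_cell {d : ℕ} (a : Fin d → ℝ) (l : ℝ) (hl : 0 < l) (θ B : ℝ)
    (S : Finset (Fin d → ℕ))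
    (hS : ∀ n ∈ S, (∀ i, n i ≠ 0) ∧ θ * (π ^ 2 * (∑ j, (n j : ℝ) ^ 2) / l ^ 2) < B) :
    ∃ T : (Fin d → ℕ) → Ed d → ℝ, (∀ n, ContDiff ℝ (⊤ : ℕ∞) (T n)) ∧
      (∀ n, HasCompactSupport (T n)) ∧ (∀ n, tsupport (T n) ⊆ cell a l) ∧
      ∀ α : (Fin d → ℕ) → ℝ, (∃ n ∈ S, α n ≠ 0) →
        θ * (∫ x in cell a l, ‖gradient (fun x => ∑ n ∈ S, α n * T n x) x‖ ^ 2)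
          - B * (∫ x in cell a l, (∑ n ∈ S, α n * T n x) ^ 2) < 0 := by
  classical
  let G : ℕ → (Fin d → ℕ) → (Fin d → ℕ) → ℝ := fun N n m =>
    θ * ∑ i, (∫ x in cell a l, fderiv ℝ (uQ a l N n) x (EuclideanSpace.single i 1) *
      fderiv ℝ (uQ a l N m) x (EuclideanSpace.single i 1))
      - B * ∫ x in cell a l, uQ a l N n x * uQ a l N m x
  let g : (Fin d → ℕ) → ℝ := fun n =>
    l ^ d * (1 / 2) ^ d * (θ * (π ^ 2 * (∑ j, (n j : ℝ) ^ 2) / l ^ 2) - B)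
  have hG : ∀ n ∈ S, ∀ m ∈ S, Tendsto (fun N => G N n m) atTop (𝓝 (if n = m then g n else 0)) := by
    intro n hn m hm
    have e : ∀ N, G N n m = θ * ∑ i, (l ^ d * ((l⁻¹) ^ 2 *
        ∫ y in Icc (0 : Fin d → ℝ) 1, gP N i n y * gP N i m y))
        - B * (l ^ d * ∫ y in Icc (0 : Fin d → ℝ) 1, fP N n y * fP N m y) := by
      intro N
      simp only [G]
      congr 2
      · refine Finset.sum_congr rfl fun i _ => ?_
        rw [cell_integral a l hl]
        simp_rw [uQ_fderiv a l hl]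
        congr 1
        rw [← integral_const_mul]
        refine setIntegral_congr_fun measurableSet_Icc fun y _ => ?_
        ring
      · rw [cell_integral a l hl]
        simp_rw [uQ_emb a l hl]
    simp_rw [e]
    have e2 : (if n = m then g n else 0) = θ * ∑ i, (l ^ d * ((l⁻¹) ^ 2 *
        (if n = m then π ^ 2 * (n i : ℝ) ^ 2 * (1 / 2) ^ d else 0)))
        - B * (l ^ d * (if n = m then (1 / 2) ^ d else 0)) := by
      split_ifs
      · simp only [g]
        have : ∑ i, (l ^ d * ((l⁻¹) ^ 2 * (π ^ 2 * (n i : ℝ) ^ 2 * (1 / 2) ^ d)))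
          = l ^ d * (1 / 2) ^ d * (π ^ 2 * (∑ j, (n j : ℝ) ^ 2) / l ^ 2) := by
          rw [Finset.mul_sum, Finset.sum_div, Finset.mul_sum]
          refine Finset.sum_congr rfl fun i _ => ?_
          field_simp
        rw [this]; ring
      · simp
    rw [e2]
    refine ((tendsto_finsetSum _ fun i _ => ?_).const_mul θ).sub
      (((fP_gram n m (hS n hn).1).const_mul _).const_mul _)
    exact ((gP_gram i n m (hS n hn).1).const_mul _).const_mul _
  have hg : ∀ n ∈ S, g n < 0 := by
    intro n hn
    have := (hS n hn).2
    exact mul_neg_of_pos_of_neg (by positivity) (by linarith)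
  obtain ⟨N, hN, hN1⟩ := ((negdef_lim S G g hG hg).and (eventually_gt_atTop 0)).exists
  have hsm : ∀ n, ContDiff ℝ (⊤ : ℕ∞) (uQ a l N n) := fun n => uQ_smooth a l N n
  have hcs : ∀ n, HasCompactSupport (uQ a l N n) := fun n => (uQ_supp a l hl N hN1 n).2
  refine ⟨fun n => uQ a l N n, hsm, hcs,
    fun n => (uQ_supp a l hl N hN1 n).1, fun α hα => ?_⟩
  have h := hN α hα
  convert h using 1
  have hfc : ∀ n i, Continuous fun x => fderiv ℝ (uQ a l N n) x (EuclideanSpace.single i 1) :=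
    fun n i => ((hsm n).continuous_fderiv (by simp)).clm_apply continuous_const
  have hfs : ∀ n i, HasCompactSupport
      fun x => fderiv ℝ (uQ a l N n) x (EuclideanSpace.single i 1) := fun n i =>
    ((hcs n).fderiv ℝ).comp_left (g := fun L : Ed d →L[ℝ] ℝ => L (EuclideanSpace.single i 1))
      (by simp)
  have hgr : ∀ x, ‖gradient (fun x => ∑ n ∈ S, α n * uQ a l N n x) x‖ ^ 2
      = ∑ i, ∑ n ∈ S, ∑ m ∈ S, α n * α m * (fderiv ℝ (uQ a l N n) x (EuclideanSpace.single i 1) *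
        fderiv ℝ (uQ a l N m) x (EuclideanSpace.single i 1)) := by
    intro x
    rw [grad_sq]
    refine Finset.sum_congr rfl fun i _ => ?_
    rw [fderiv_lincomb S α _ fun n _ => (hsm n).differentiable (by simp), ← sum_sq_expand]
    congr 1
    simp
  simp_rw [hgr, sum_sq_expand]
  rw [integral_finsetSum]
  swap
  · intro i _
    refine integrable_finsetSum _ fun n _ => integrable_finsetSum _ fun m _ => ?_
    exact (cs_intOn_mul (hfc n i) (hfc m i) (hfs n i) _).const_mul _
  rw [integral_finsetSum]
  swap
  · intro n _
    refine integrable_finsetSum _ fun m _ => ?_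
    exact (cs_intOn_mul (hsm n).continuous (hsm m).continuous (hcs n) _).const_mul _
  have e1 : ∀ i, ∫ x in cell a l, ∑ n ∈ S, ∑ m ∈ S, α n * α m *
      (fderiv ℝ (uQ a l N n) x (EuclideanSpace.single i 1) *
        fderiv ℝ (uQ a l N m) x (EuclideanSpace.single i 1))
      = ∑ n ∈ S, ∑ m ∈ S, α n * α m * ∫ x in cell a l,
        (fderiv ℝ (uQ a l N n) x (EuclideanSpace.single i 1) *
        fderiv ℝ (uQ a l N m) x (EuclideanSpace.single i 1)) := by
    intro i
    rw [integral_finsetSum]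
    · refine Finset.sum_congr rfl fun n _ => ?_
      rw [integral_finsetSum]
      · refine Finset.sum_congr rfl fun m _ => integral_const_mul _ _
      · intro m _
        exact (cs_intOn_mul (hfc n i) (hfc m i) (hfs n i) _).const_mul _
    · intro n _
      refine integrable_finsetSum _ fun m _ => ?_
      exact (cs_intOn_mul (hfc n i) (hfc m i) (hfs n i) _).const_mul _
  have e2 : ∀ n ∈ S, ∫ x in cell a l, ∑ m ∈ S, α n * α m * (uQ a l N n x * uQ a l N m x)
      = ∑ m ∈ S, α n * α m * ∫ x in cell a l, (uQ a l N n x * uQ a l N m x) := by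
    intro n _
    rw [integral_finsetSum]
    · refine Finset.sum_congr rfl fun m _ => integral_const_mul _ _
    · intro m _
      exact (cs_intOn_mul (hsm n).continuous (hsm m).continuous (hcs n) _).const_mul _
  simp_rw [e1]
  rw [Finset.sum_congr rfl e2]
  simp only [G, mul_sub, Finset.sum_sub_distrib]
  congr 1
  · rw [Finset.sum_comm, Finset.mul_sum]
    refine Finset.sum_congr rfl fun n _ => ?_
    rw [Finset.sum_comm, Finset.mul_sum]
    refine Finset.sum_congr rfl fun m _ => ?_
    simp_rw [← Finset.mul_sum]
    ring
  · rw [Finset.mul_sum]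
    refine Finset.sum_congr rfl fun n _ => ?_
    rw [Finset.mul_sum]
    refine Finset.sum_congr rfl fun m _ => by ring

theorem lowerB {d : ℕ} {I : Type*} [Fintype I] (a : I → Fin d → ℝ) (l : I → ℝ)
    (hl : ∀ i, 0 < l i) (hdis : Pairwise (Function.onFun Disjoint fun i => cell (a i) (l i)))
    (v : Ed d → ℝ) (hv : Continuous v) (θ : ℝ) (B : I → ℝ)
    (hB : ∀ i, ∀ x ∈ cell (a i) (l i), v x ≤ -B i)
    (S : I → Finset (Fin d → ℕ))
    (hS : ∀ i, ∀ n ∈ S i, (∀ j, n j ≠ 0) ∧ θ * (π ^ 2 * (∑ j, (n j : ℝ) ^ 2) / l i ^ 2) < B i) :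
    ∃ F : Submodule ℝ (Ed d → ℝ), (∀ u ∈ F, ContDiff ℝ (⊤ : ℕ∞) u ∧ HasCompactSupport u) ∧
      (∀ u ∈ F, u ≠ 0 → θ * (∫ x, ‖gradient u x‖ ^ 2) + ∫ x, v x * u x ^ 2 < 0) ∧
      Module.finrank ℝ F = ∑ i, (S i).card := by
  classical
  choose T hT1 hT2 hT3 hT4 using fun i => dirichlet_cell (a i) (l i) (hl i) θ (B i) (S i) (hS i)
  let L : ((Σ i, S i) → ℝ) →ₗ[ℝ] (Ed d → ℝ) :=
    { toFun := fun α x => ∑ p : Σ i, S i, α p * T p.1 p.2.1 x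
      map_add' := by
        intro α β; ext x
        simp [add_mul, Finset.sum_add_distrib]
      map_smul' := by
        intro c α; ext x
        simp [Finset.mul_sum, mul_assoc] }
  have hLs : ∀ α, ContDiff ℝ (⊤ : ℕ∞) (L α) := by
    intro α
    refine ContDiff.sum fun p _ => ?_
    exact contDiff_const.mul (hT1 p.1 p.2.1)
  have hLc : ∀ α, HasCompactSupport (L α) := by
    intro α
    have hK : IsCompact (⋃ p : Σ i, S i, tsupport (T p.1 p.2.1)) :=
      isCompact_iUnion fun p => hT2 p.1 p.2.1
    refine HasCompactSupport.intro hK fun x hx => ?_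
    refine Finset.sum_eq_zero fun p _ => ?_
    have : x ∉ tsupport (T p.1 p.2.1) := fun h => hx (mem_iUnion.mpr ⟨p, h⟩)
    rw [image_eq_zero_of_notMem_tsupport this, mul_zero]
  have hT0 : ∀ i n x, x ∉ cell (a i) (l i) → T i n x = 0 := fun i n x hx =>
    image_eq_zero_of_notMem_tsupport fun h => hx (hT3 i n h)
  have hD0 : ∀ i n x, x ∉ cell (a i) (l i) → fderiv ℝ (T i n) x = 0 := fun i n x hx =>
    fderiv_of_notMem_tsupport ℝ fun h => hx (hT3 i n h)
  have hTd : ∀ i n, Differentiable ℝ (T i n) := fun i n => (hT1 i n).differentiable (by simp)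
  have hLf : ∀ α x, fderiv ℝ (L α) x = ∑ p : Σ i, S i, α p • fderiv ℝ (T p.1 p.2.1) x := by
    intro α x
    exact fderiv_lincomb Finset.univ α (fun p : Σ i, S i => T p.1 p.2.1)
      (fun p _ => hTd _ _) x
  let β : ((Σ i, S i) → ℝ) → I → (Fin d → ℕ) → ℝ := fun α i n =>
    if h : n ∈ S i then α ⟨i, ⟨n, h⟩⟩ else 0
  have hnot : ∀ i j x, x ∈ cell (a i) (l i) → j ≠ i → x ∉ cell (a j) (l j) := by
    intro i j x hx hji hxj
    exact Set.disjoint_left.mp (hdis hji) hxj hx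
  have hsumS : ∀ {X : Type} [AddCommMonoid X] [Module ℝ X] (α : (Σ i, S i) → ℝ) (i : I)
      (f : (Fin d → ℕ) → X), ∑ n : S i, α ⟨i, n⟩ • f n.1 = ∑ n ∈ S i, β α i n • f n := by
    intro X _ _ α i f
    rw [← Finset.sum_coe_sort (S i)]
    refine Finset.sum_congr rfl fun n _ => ?_
    simp [β]
  have hLx : ∀ α i x, x ∈ cell (a i) (l i) → L α x = ∑ n ∈ S i, β α i n * T i n x := by
    intro α i x hx
    have h1 : L α x = ∑ j, ∑ n : S j, α ⟨j, n⟩ * T j n.1 x :=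
      Fintype.sum_sigma (fun p : Σ i, S i => α p * T p.1 p.2.1 x)
    rw [h1, Finset.sum_eq_single i]
    · exact hsumS α i fun n => T i n x
    · intro j _ hj
      refine Finset.sum_eq_zero fun n _ => ?_
      rw [hT0 j _ x (hnot i j x hx hj), mul_zero]
    · simp
  have hLg : ∀ α i x, x ∈ cell (a i) (l i) →
      gradient (L α) x = gradient (fun x => ∑ n ∈ S i, β α i n * T i n x) x := by
    intro α i x hx
    unfold gradient
    congr 1
    rw [hLf, fderiv_lincomb _ _ _ (fun n _ => hTd i n)]
    rw [Fintype.sum_sigma, Finset.sum_eq_single i]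
    · exact hsumS α i fun n => fderiv ℝ (T i n) x
    · intro j _ hj
      refine Finset.sum_eq_zero fun n _ => ?_
      rw [hD0 j _ x (hnot i j x hx hj), smul_zero]
    · simp
  have key : ∀ α, α ≠ 0 →
      θ * (∫ x, ‖gradient (L α) x‖ ^ 2) + ∫ x, v x * L α x ^ 2 < 0 := by
    intro α hα
    have i1 := cs_grad_int (hLs α) (hLc α)
    have i2 := cs_int (hLs α) (hLc α) hv
    have i0 : Integrable (fun x => L α x ^ 2) := by
      simpa using cs_int (hLs α) (hLc α) (continuous_const (y := (1:ℝ)))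
    have i3 : Integrable (fun x => θ * ‖gradient (L α) x‖ ^ 2 + v x * L α x ^ 2) :=
      (i1.const_mul θ).add i2
    rw [← integral_const_mul, ← integral_add (i1.const_mul θ) i2]
    have hm : MeasurableSet (⋃ i, cell (a i) (l i)) :=
      MeasurableSet.iUnion fun i => cell_meas _ _
    rw [← integral_add_compl hm i3]
    have h2 : ∫ x in (⋃ i, cell (a i) (l i))ᶜ, θ * ‖gradient (L α) x‖ ^ 2 + v x * L α x ^ 2
        = 0 := by
      refine setIntegral_eq_zero_of_forall_eq_zero fun x hx => ?_
      have hx' : ∀ i, x ∉ cell (a i) (l i) := by simpa using hx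
      have z1 : L α x = 0 := Finset.sum_eq_zero fun p _ => by rw [hT0 _ _ x (hx' _), mul_zero]
      have z2 : fderiv ℝ (L α) x = 0 := by
        rw [hLf]
        exact Finset.sum_eq_zero fun p _ => by rw [hD0 _ _ x (hx' _), smul_zero]
      rw [norm_grad, z1, z2]; simp
    rw [h2, add_zero, integral_iUnion_fintype (fun i => cell_meas _ _) hdis
      (fun i => i3.integrableOn)]
    have hle : ∀ i, ∫ x in cell (a i) (l i), (θ * ‖gradient (L α) x‖ ^ 2 + v x * L α x ^ 2)
        ≤ θ * (∫ x in cell (a i) (l i), ‖gradient (fun x => ∑ n ∈ S i, β α i n * T i n x) x‖ ^ 2)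
          - B i * (∫ x in cell (a i) (l i), (∑ n ∈ S i, β α i n * T i n x) ^ 2) := by
      intro i
      have h4 : ∫ x in cell (a i) (l i), (θ * ‖gradient (L α) x‖ ^ 2 + v x * L α x ^ 2)
        ≤ ∫ x in cell (a i) (l i), (θ * ‖gradient (L α) x‖ ^ 2 - B i * L α x ^ 2) := by
        refine setIntegral_mono_on i3.integrableOn
          ((i1.const_mul θ).sub (i0.const_mul _)).integrableOn (cell_meas _ _) fun x hx => ?_
        nlinarith [hB i x hx, sq_nonneg (L α x)]
      refine h4.trans_eq ?_
      rw [integral_sub (i1.const_mul θ).integrableOn (i0.const_mul _).integrableOn,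
        integral_const_mul, integral_const_mul]
      congr 2
      · refine setIntegral_congr_fun (cell_meas _ _) fun x hx => ?_
        simp only [hLg α i x hx]
      · refine setIntegral_congr_fun (cell_meas _ _) fun x hx => ?_
        simp only [hLx α i x hx]
    have hle0 : ∀ i, ∫ x in cell (a i) (l i), (θ * ‖gradient (L α) x‖ ^ 2 + v x * L α x ^ 2)
        ≤ 0 := by
      intro i
      by_cases h : ∃ n ∈ S i, β α i n ≠ 0
      · exact (hle i).trans (hT4 i _ h).le
      · push Not at h
        refine (hle i).trans_eq ?_
        have z : (fun x => ∑ n ∈ S i, β α i n * T i n x) = 0 := by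
          ext x
          exact Finset.sum_eq_zero fun n hn => by rw [h n hn, zero_mul]
        have z' : ∀ x, ∑ n ∈ S i, β α i n * T i n x = 0 := fun x => congrFun z x
        simp_rw [z', norm_grad]
        simp
    obtain ⟨⟨i, n, hn⟩, hp⟩ := Function.ne_iff.mp hα
    refine Finset.sum_neg' (fun i _ => hle0 i) ⟨i, Finset.mem_univ i, ?_⟩
    refine (hle i).trans_lt (hT4 i _ ⟨n, hn, ?_⟩)
    simpa [β, hn] using hp
  have hinj : Function.Injective L := by
    rw [← LinearMap.ker_eq_bot, LinearMap.ker_eq_bot']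
    intro α hα
    by_contra h0
    have := key α h0
    rw [hα] at this
    have z : ∀ x, gradient (0 : Ed d → ℝ) x = 0 := by
      intro x
      rw [← norm_eq_zero, norm_grad]; simp
    simp [z] at this
  refine ⟨LinearMap.range L, ?_, ?_, ?_⟩
  · rintro u ⟨α, rfl⟩
    exact ⟨hLs α, hLc α⟩
  · rintro u ⟨α, rfl⟩ hu
    refine key α ?_
    rintro rfl
    exact hu (map_zero L)
  · rw [LinearMap.finrank_range_of_inj hinj]
    simp

/-! ### Part 6: counting lattice points -/

/-- folding map `ℤ → ℕ`, two-to-one -/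
def fold (m : ℤ) : ℕ := match m with
  | Int.ofNat a => a
  | Int.negSucc a => a

lemma fold_abs (x : ℝ) : (fold ⌊x⌋ : ℝ) ≤ |x| ∧ |x| ≤ fold ⌊x⌋ + 1 := by
  have h1 := Int.floor_le x
  have h2 := Int.lt_floor_add_one x
  generalize hm : ⌊x⌋ = m at *
  cases m with
  | ofNat a =>
    simp only [fold] at *
    simp only [Int.ofNat_eq_natCast, Int.cast_natCast] at h1 h2
    rw [abs_of_nonneg (le_trans (by positivity) h1)]
    exact ⟨h1, h2.le⟩
  | negSucc a =>
    simp only [fold] at *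
    rw [Int.cast_negSucc] at h1 h2
    push_cast at h1 h2
    have : x < 0 := by
      have : (0:ℝ) ≤ a := by positivity
      linarith
    rw [abs_of_neg this]
    constructor <;> linarith

def unfoldS (n : ℕ) : Finset ℤ := {Int.ofNat n, Int.negSucc n}

lemma mem_unfoldS (n : ℕ) (m : ℤ) : m ∈ unfoldS n ↔ fold m = n := by
  cases m with
  | ofNat a => simp [unfoldS, fold]
  | negSucc a => simp [unfoldS, fold]

lemma card_unfoldS (n : ℕ) : (unfoldS n).card = 2 := by
  rw [unfoldS, Finset.card_pair]
  exact fun h => by cases h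

def box {d : ℕ} (m : Fin d → ℤ) : Set (Ed d) := cell (fun i => (m i : ℝ)) 1

lemma mem_box {d : ℕ} (m : Fin d → ℤ) (x : Ed d) : x ∈ box m ↔ ∀ i, ⌊x i⌋ = m i := by
  unfold box cell
  simp only [mem_ofPred_eq]
  exact forall_congr' fun i => (Int.floor_eq_iff).symm

lemma cell_vol {d : ℕ} (a : Fin d → ℝ) (l : ℝ) (hl : 0 < l) :
    volume (cell a l) = ENNReal.ofReal (l ^ d) := by
  have e : cell a l = (MeasurableEquiv.toLp 2 (Fin d → ℝ)).symm ⁻¹'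
      (Set.pi univ fun i => Ico (a i) (a i + l)) := by
    ext x
    simp [cell, Set.mem_pi]
  rw [e, (EuclideanSpace.volume_preserving_symm_measurableEquiv_toLp (Fin d)).measure_preimage
    (MeasurableSet.univ_pi fun i => measurableSet_Ico).nullMeasurableSet, volume_pi_pi]
  simp [ENNReal.ofReal_pow hl.le]

/-- union of the unit boxes over a finite set of folded indices -/
def boxU {d : ℕ} (S : Finset (Fin d → ℕ)) : Set (Ed d) := {x | (fun i => fold ⌊x i⌋) ∈ S}

lemma boxU_vol {d : ℕ} (S : Finset (Fin d → ℕ)) :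
    volume (boxU S) = ENNReal.ofReal (2 ^ d * S.card) := by
  classical
  let Z : Finset (Fin d → ℤ) := S.biUnion fun n => Fintype.piFinset fun i => unfoldS (n i)
  have hZ : Z.card = 2 ^ d * S.card := by
    rw [Finset.card_biUnion]
    · simp [Fintype.card_piFinset, card_unfoldS, mul_comm]
    · intro n _ m _ hnm
      rw [Function.onFun, Finset.disjoint_left]
      intro z hz hz'
      apply hnm
      ext i
      rw [Fintype.mem_piFinset] at hz hz'
      rw [← (mem_unfoldS _ _).mp (hz i), ← (mem_unfoldS _ _).mp (hz' i)]
  have e : boxU S = ⋃ z ∈ Z, box z := by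
    ext x
    simp only [boxU, mem_ofPred_eq, mem_iUnion, exists_prop, mem_box, Z, Finset.mem_biUnion,
      Fintype.mem_piFinset, mem_unfoldS]
    constructor
    · intro h
      exact ⟨fun i => ⌊x i⌋, ⟨_, h, fun i => rfl⟩, fun i => rfl⟩
    · rintro ⟨z, ⟨n, hn, hz⟩, hx⟩
      convert hn using 1
      ext i
      rw [hx i, hz i]
  rw [e, measure_biUnion_finset]
  · simp only [box, cell_vol _ 1 one_pos]
    simp [hZ, ENNReal.ofReal_mul]
  · intro z _ z' _ hzz
    rw [Function.onFun, Set.disjoint_left]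
    intro x hx hx'
    exact hzz (by ext i; rw [← (mem_box _ _).mp hx i, (mem_box _ _).mp hx' i])
  · intro z _
    exact cell_meas _ _

lemma ball_vol {d : ℕ} (T : ℝ) (hT : 0 ≤ T) (hd : 1 ≤ d) :
    volume (Metric.ball (0 : Ed d) T) = ENNReal.ofReal (T ^ d * tau d) := by
  have : Nontrivial (Ed d) := by
    haveI : Nonempty (Fin d) := ⟨⟨0, hd⟩⟩
    infer_instance
  rw [Measure.addHaar_ball _ _ hT, tau, ENNReal.ofReal_mul (by positivity),
    ENNReal.ofReal_toReal measure_ball_lt_top.ne]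
  simp

lemma finite_lt {d : ℕ} (T : ℝ) : {n : Fin d → ℕ | ∑ i, (n i : ℝ) ^ 2 < T}.Finite := by
  refine (Set.Finite.pi' (fun _ : Fin d => Set.finite_Iio (⌈T⌉₊ + 1))).subset ?_
  intro n hn i
  simp only [mem_ofPred_eq] at hn
  have h1 : (n i : ℝ) ^ 2 ≤ ∑ i, (n i : ℝ) ^ 2 :=
    Finset.single_le_sum (f := fun i => (n i : ℝ) ^ 2) (fun _ _ => sq_nonneg _) (Finset.mem_univ i)
  have h2 : (n i : ℝ) ≤ (n i : ℝ) ^ 2 := by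
    exact_mod_cast Nat.le_self_pow (by norm_num) (n i)
  have h3 : (n i : ℝ) < ⌈T⌉₊ := lt_of_lt_of_le (by linarith) (Nat.le_ceil T)
  have : n i < ⌈T⌉₊ := by exact_mod_cast h3
  simp; omega

/-- Neumann index set. -/
def SN (d : ℕ) (T : ℝ) : Finset (Fin d → ℕ) := (finite_lt (d := d) (T ^ 2)).toFinset

lemma mem_SN {d : ℕ} {T : ℝ} (n : Fin d → ℕ) : n ∈ SN d T ↔ ∑ i, (n i : ℝ) ^ 2 < T ^ 2 := by
  simp [SN]

/-- Dirichlet index set. -/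
def SD (d : ℕ) (T : ℝ) : Finset (Fin d → ℕ) := (SN d T).filter fun n => ∀ i, n i ≠ 0

lemma card_SN {d : ℕ} (hd : 1 ≤ d) (T : ℝ) (hT : 0 ≤ T) :
    ((SN d T).card : ℝ) ≤ (1 / 2) ^ d * tau d * (T + √d) ^ d := by
  have hsub : boxU (SN d T) ⊆ Metric.ball (0 : Ed d) (T + √d) := by
    intro x hx
    rw [boxU, mem_ofPred_eq, mem_SN] at hx
    rw [mem_ball_zero_iff]
    let p : Ed d := WithLp.toLp 2 fun i => (fold ⌊x i⌋ : ℝ)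
    let q : Ed d := WithLp.toLp 2 fun i => (1 : ℝ)
    have hp : ‖p‖ < T := by
      rw [EuclideanSpace.norm_eq, Real.sqrt_lt' (lt_of_le_of_ne hT ?_)]
      · simpa [p] using hx
      · rintro rfl
        have : (0:ℝ) ≤ ∑ i, ((fold ⌊x i⌋ : ℕ) : ℝ) ^ 2 := Finset.sum_nonneg fun _ _ => sq_nonneg _
        simp at hx
        linarith
    have hq : ‖q‖ = √d := by
      rw [EuclideanSpace.norm_eq]; simp [q]
    have hx2 : ‖x‖ ≤ ‖p + q‖ := by
      rw [EuclideanSpace.norm_eq, EuclideanSpace.norm_eq]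
      refine Real.sqrt_le_sqrt (Finset.sum_le_sum fun i _ => ?_)
      refine pow_le_pow_left₀ (norm_nonneg _) ?_ 2
      have := (fold_abs (x i)).2
      simp only [p, q, PiLp.add_apply, Real.norm_eq_abs]
      exact this.trans (le_abs_self _)
    calc ‖x‖ ≤ ‖p + q‖ := hx2
      _ ≤ ‖p‖ + ‖q‖ := norm_add_le _ _
      _ < _ := by rw [hq]; linarith
  have h := measure_mono (μ := volume) hsub
  rw [boxU_vol, ball_vol _ (by positivity) hd, ENNReal.ofReal_le_ofReal_iff
    (by unfold tau; positivity)] at h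
  have h2 : (1/2:ℝ) ^ d * 2 ^ d = 1 := by rw [← mul_pow]; norm_num
  calc ((SN d T).card : ℝ) = (1/2) ^ d * (2 ^ d * (SN d T).card) := by rw [← mul_assoc, h2, one_mul]
    _ ≤ (1/2) ^ d * ((T + √d) ^ d * tau d) := by gcongr
    _ = _ := by ring

lemma card_SD {d : ℕ} (hd : 1 ≤ d) (T : ℝ) :
    (1 / 2) ^ d * tau d * (max (T - √d) 0) ^ d ≤ ((SD d T).card : ℝ) := by
  classical
  rcases le_total (T - √d) 0 with h0 | h0
  · rw [max_eq_right h0, zero_pow (by omega), mul_zero]; positivity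
  rw [max_eq_left h0]
  let S' : Finset (Fin d → ℕ) := (SN d T).filter fun n => (fun i => n i + 1) ∈ SN d T
  have hcard : S'.card ≤ (SD d T).card := by
    refine Finset.card_le_card_of_injOn (fun n i => n i + 1) ?_ ?_
    · intro n hn
      have hn' := (Finset.mem_filter.mp (Finset.mem_coe.mp hn)).2
      exact Finset.mem_coe.mpr (Finset.mem_filter.mpr ⟨hn', fun i => by simp⟩)
    · intro n _ m _ h
      ext i
      have := congrFun h i
      simpa using this
  have hsub : Metric.ball (0 : Ed d) (T - √d) ⊆ boxU S' := by
    intro x hx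
    rw [mem_ball_zero_iff] at hx
    let p : Ed d := WithLp.toLp 2 fun i => |x i|
    let q : Ed d := WithLp.toLp 2 fun i => (1 : ℝ)
    have hq : ‖q‖ = √d := by
      rw [EuclideanSpace.norm_eq]; simp [q]
    have hp : ‖p‖ = ‖x‖ := by
      rw [EuclideanSpace.norm_eq, EuclideanSpace.norm_eq]; simp [p]
    have hpq : ‖p + q‖ < T := by
      calc _ ≤ ‖p‖ + ‖q‖ := norm_add_le _ _
        _ < _ := by rw [hq, hp]; linarith
    have hT : 0 < T := (norm_nonneg _).trans_lt hpq
    rw [EuclideanSpace.norm_eq, Real.sqrt_lt' hT] at hpq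
    have hb : ∑ i, (((fold ⌊x i⌋ + 1 : ℕ) : ℝ)) ^ 2 < T ^ 2 := by
      refine lt_of_le_of_lt (Finset.sum_le_sum fun i _ => ?_) hpq
      refine pow_le_pow_left₀ (by positivity) ?_ 2
      have := (fold_abs (x i)).1
      simp only [p, q, PiLp.add_apply, Real.norm_eq_abs]
      refine le_trans ?_ (le_abs_self _)
      push_cast; linarith
    rw [boxU, mem_ofPred_eq, Finset.mem_filter, mem_SN, mem_SN]
    refine ⟨lt_of_le_of_lt (Finset.sum_le_sum fun i _ => ?_) hb, hb⟩
    refine pow_le_pow_left₀ (by positivity) ?_ 2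
    push_cast; linarith
  have h := measure_mono (μ := volume) hsub
  rw [boxU_vol, ball_vol _ h0 hd, ENNReal.ofReal_le_ofReal_iff (by positivity)] at h
  have h2 : (1/2:ℝ) ^ d * 2 ^ d = 1 := by rw [← mul_pow]; norm_num
  have h3 : (S'.card : ℝ) ≤ (SD d T).card := by exact_mod_cast hcard
  calc (1/2:ℝ) ^ d * tau d * (T - √d) ^ d = (1/2) ^ d * ((T - √d) ^ d * tau d) := by ring
    _ ≤ (1/2) ^ d * (2 ^ d * S'.card) := by gcongr
    _ = S'.card := by rw [← mul_assoc, h2, one_mul]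
    _ ≤ _ := h3

/-! ### Part 7: removing the oscillation by integration by parts -/

lemma grad_inner_le {d : ℕ} (f g : Ed d → ℝ) (x : Ed d) :
    |∑ i, fderiv ℝ f x (EuclideanSpace.single i 1) * fderiv ℝ g x (EuclideanSpace.single i 1)|
      ≤ ‖fderiv ℝ f x‖ * ‖fderiv ℝ g x‖ := by
  rw [← norm_grad, ← norm_grad]
  refine abs_le_of_sq_le_sq ?_ (by positivity)
  rw [mul_pow, grad_sq, grad_sq]
  exact Finset.sum_mul_sq_le_sq_mul_sq _ _ _

def Rem {d : ℕ} (W : Ed d → ℝ) (M ω : ℝ) (x : Ed d) : ℝ :=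
  M * ‖fderiv ℝ W x‖ + ω⁻¹ * M ^ 2 * W x ^ 2

lemma Rem_cont {d : ℕ} {W : Ed d → ℝ} (hW : ContDiff ℝ 2 W) (M ω : ℝ) : Continuous (Rem W M ω) := by
  have := hW.continuous
  have := hW.continuous_fderiv (by norm_num)
  unfold Rem
  fun_prop

lemma lap_eq {d : ℕ} {φ : Ed d → ℝ} (hφ : ContDiff ℝ 2 φ) (x : Ed d) :
    lap d φ x = ∑ i, fderiv ℝ (fun y => fderiv ℝ φ y (EuclideanSpace.single i 1)) x
      (EuclideanSpace.single i 1) := by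
  unfold lap
  refine Finset.sum_congr rfl fun i _ => ?_
  rw [iteratedFDeriv_two_apply]
  have hd : DifferentiableAt ℝ (fderiv ℝ φ) x :=
    ((hφ.fderiv_right (m := 1) (by norm_num)).differentiable (by norm_num)) x
  rw [fderiv_clm_apply hd (differentiableAt_const _)]
  simp

lemma lap_cont {d : ℕ} {φ : Ed d → ℝ} (hφ : ContDiff ℝ 2 φ) : Continuous (lap d φ) := by
  unfold lap
  refine continuous_finsetSum _ fun i _ => ?_
  have h := hφ.continuous_iteratedFDeriv (m := 2) (by norm_num)
  exact (continuous_eval_const _).comp h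

theorem form_compare {d : ℕ} {W φ : Ed d → ℝ} (hW : ContDiff ℝ 2 W) (hφ : ContDiff ℝ 2 φ)
    (M ω : ℝ) (hω : 0 < ω) (hM : ∀ x, ‖fderiv ℝ φ x‖ ≤ M) {u : Ed d → ℝ}
    (hu : ContDiff ℝ (⊤ : ℕ∞) u) (hc : HasCompactSupport u) :
    |∫ x, lap d φ x * W x * u x ^ 2| ≤ ω * (∫ x, ‖gradient u x‖ ^ 2) + ∫ x, Rem W M ω x * u x ^ 2 := by
  have hM0 : 0 ≤ M := (norm_nonneg _).trans (hM 0)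
  have hWd : Differentiable ℝ W := hW.differentiable (by norm_num)
  have hud : Differentiable ℝ u := hu.differentiable (by simp)
  let e : Fin d → Ed d := fun i => EuclideanSpace.single i 1
  have hu2 : HasCompactSupport (fun x => u x ^ 2) :=
    hc.comp_left (g := fun t : ℝ => t ^ 2) (by simp)
  have hg1 : ContDiff ℝ 1 (fun x => W x * u x ^ 2) :=
    (hW.of_le (by norm_num)).mul ((hu.of_le (by exact_mod_cast le_top)).pow 2)
  have hgc : HasCompactSupport (fun x => W x * u x ^ 2) := hu2.mul_left
  have hp1 : ∀ i, ContDiff ℝ 1 (fun y => fderiv ℝ φ y (e i)) := fun i =>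
    (hφ.fderiv_right (m := 1) (by norm_num)).clm_apply contDiff_const
  have hder : ∀ x i, fderiv ℝ (fun x => W x * u x ^ 2) x (e i)
      = fderiv ℝ W x (e i) * u x ^ 2 + 2 * (W x * u x) * fderiv ℝ u x (e i) := by
    intro x i
    rw [fderiv_fun_mul (hWd x) ((hud x).fun_pow 2), fderiv_fun_pow _ (hud x)]
    simp; ring
  have hgi : ∀ i, HasCompactSupport (fun x => fderiv ℝ (fun x => W x * u x ^ 2) x (e i)) := fun i =>
    (hgc.fderiv ℝ).comp_left (g := fun L : Ed d →L[ℝ] ℝ => L (e i)) (by simp)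
  have hgic : ∀ i, Continuous (fun x => fderiv ℝ (fun x => W x * u x ^ 2) x (e i)) := fun i =>
    (hg1.continuous_fderiv (by norm_num)).clm_apply continuous_const
  have hpic : ∀ i, Continuous (fun x => fderiv ℝ (fun y => fderiv ℝ φ y (e i)) x (e i)) := fun i =>
    ((hp1 i).continuous_fderiv (by norm_num)).clm_apply continuous_const
  have ibp : ∀ i, ∫ x, (W x * u x ^ 2) * fderiv ℝ (fun y => fderiv ℝ φ y (e i)) x (e i)
      = - ∫ x, fderiv ℝ (fun x => W x * u x ^ 2) x (e i) * fderiv ℝ φ x (e i) := by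
    intro i
    refine integral_mul_fderiv_eq_neg_fderiv_mul_of_integrable ?_ ?_ ?_
      (fun x _ => hg1.differentiable (by norm_num) x)
      (fun x _ => (hp1 i).differentiable (by norm_num) x)
    · exact ((hgic i).mul (hp1 i).continuous).integrable_of_hasCompactSupport (hgi i).mul_right
    · exact (hg1.continuous.mul (hpic i)).integrable_of_hasCompactSupport hgc.mul_right
    · exact (hg1.continuous.mul (hp1 i).continuous).integrable_of_hasCompactSupport hgc.mul_right
  have hL : ∫ x, lap d φ x * W x * u x ^ 2
      = - ∫ x, ∑ i, fderiv ℝ (fun x => W x * u x ^ 2) x (e i) * fderiv ℝ φ x (e i) := by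
    have : ∀ x, lap d φ x * W x * u x ^ 2
        = ∑ i, (W x * u x ^ 2) * fderiv ℝ (fun y => fderiv ℝ φ y (e i)) x (e i) := by
      intro x
      rw [lap_eq hφ, ← Finset.mul_sum]; ring
    simp_rw [this]
    rw [integral_finsetSum, integral_finsetSum, ← Finset.sum_neg_distrib]
    · exact Finset.sum_congr rfl fun i _ => ibp i
    · intro i _
      exact ((hgic i).mul (hp1 i).continuous).integrable_of_hasCompactSupport (hgi i).mul_right
    · intro i _
      exact (hg1.continuous.mul (hpic i)).integrable_of_hasCompactSupport hgc.mul_right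
  rw [hL, abs_neg]
  have i1 := cs_grad_int hu hc
  have i2 := cs_int hu hc (Rem_cont hW M ω)
  rw [← integral_const_mul, ← integral_add (i1.const_mul ω) i2]
  refine abs_integral_le_integral_abs.trans ?_
  refine integral_mono_of_nonneg (Eventually.of_forall fun x => abs_nonneg _)
    ((i1.const_mul ω).add i2) (Eventually.of_forall fun x => ?_)
  simp only [hder]
  have e1 : ∑ i, (fderiv ℝ W x (e i) * u x ^ 2 + 2 * (W x * u x) * fderiv ℝ u x (e i))
      * fderiv ℝ φ x (e i)
      = (∑ i, fderiv ℝ W x (e i) * fderiv ℝ φ x (e i)) * u x ^ 2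
        + 2 * (W x * u x) * ∑ i, fderiv ℝ u x (e i) * fderiv ℝ φ x (e i) := by
    rw [Finset.sum_mul, Finset.mul_sum, ← Finset.sum_add_distrib]
    exact Finset.sum_congr rfl fun i _ => by ring
  rw [e1]
  have a1 := grad_inner_le W φ x
  have a2 := grad_inner_le u φ x
  rw [norm_grad]
  have b1 : |(∑ i, fderiv ℝ W x (e i) * fderiv ℝ φ x (e i)) * u x ^ 2|
      ≤ M * ‖fderiv ℝ W x‖ * u x ^ 2 := by
    rw [abs_mul, abs_of_nonneg (sq_nonneg (u x))]
    refine mul_le_mul_of_nonneg_right (a1.trans ?_) (sq_nonneg _)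
    rw [mul_comm]
    exact mul_le_mul_of_nonneg_right (hM x) (norm_nonneg _)
  have b2 : |2 * (W x * u x) * ∑ i, fderiv ℝ u x (e i) * fderiv ℝ φ x (e i)|
      ≤ 2 * (|W x| * |u x|) * (‖fderiv ℝ u x‖ * M) := by
    rw [abs_mul, abs_mul, abs_mul, abs_two]
    refine mul_le_mul_of_nonneg_left (a2.trans ?_) (by positivity)
    exact mul_le_mul_of_nonneg_left (hM x) (norm_nonneg _)
  have b3 : 2 * (|W x| * |u x|) * (‖fderiv ℝ u x‖ * M)
      ≤ ω * ‖fderiv ℝ u x‖ ^ 2 + ω⁻¹ * M ^ 2 * W x ^ 2 * u x ^ 2 := by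
    have h := sq_nonneg (ω * ‖fderiv ℝ u x‖ - M * |W x| * |u x|)
    have h' := mul_nonneg (inv_nonneg.mpr hω.le) h
    have e3 : ω⁻¹ * (ω * ‖fderiv ℝ u x‖ - M * |W x| * |u x|) ^ 2
        = ω * ‖fderiv ℝ u x‖ ^ 2 + ω⁻¹ * M ^ 2 * |W x| ^ 2 * |u x| ^ 2
          - 2 * (|W x| * |u x|) * (‖fderiv ℝ u x‖ * M) := by
      field_simp; ring
    rw [e3, sq_abs, sq_abs] at h'
    linarith
  refine (abs_add_le _ _).trans ?_
  unfold Rem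
  nlinarith

/-! ### Part 8: dyadic cells -/

def Bx {d : ℕ} (t : ℝ) : Set (Ed d) := {x | ∀ i, -t ≤ x i ∧ x i < t}

def sideL (M j : ℕ) : ℝ := 2 ^ j / M

def corner {d : ℕ} (M j : ℕ) (k : Fin d → ℤ) : Fin d → ℝ := fun i => k i * sideL M j

def KM (d M : ℕ) : Finset (Fin d → ℤ) :=
  (Fintype.piFinset fun _ => Finset.Ico (-(2 * M : ℤ)) (2 * M)) \
    (Fintype.piFinset fun _ => Finset.Ico (-(M : ℤ)) M)

def lcell {d : ℕ} (M j : ℕ) (k : Fin d → ℤ) : Set (Ed d) := cell (corner M j k) (sideL M j)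

lemma sideL_pos {M : ℕ} (hM : 0 < M) (j : ℕ) : 0 < sideL M j := by
  have : (0:ℝ) < M := by exact_mod_cast hM
  unfold sideL; positivity

lemma mem_lcell {d M : ℕ} (hM : 0 < M) (j : ℕ) (k : Fin d → ℤ) (x : Ed d) :
    x ∈ lcell M j k ↔ ∀ i, ⌊x i / sideL M j⌋ = k i := by
  have hl := sideL_pos hM j
  unfold lcell cell corner
  simp only [mem_ofPred_eq]
  refine forall_congr' fun i => ?_
  rw [Int.floor_eq_iff, le_div_iff₀ hl, div_lt_iff₀ hl]
  constructor
  · rintro ⟨h1, h2⟩; exact ⟨h1, by linarith⟩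
  · rintro ⟨h1, h2⟩; exact ⟨h1, by linarith⟩

lemma mem_Bx {d M : ℕ} (hM : 0 < M) (j : ℕ) (m : ℕ) (x : Ed d) :
    x ∈ (Bx (m * 2 ^ j) : Set (Ed d)) ↔
      ∀ i, ⌊x i / sideL M j⌋ ∈ Finset.Ico (-(m * M : ℤ)) (m * M) := by
  have hl := sideL_pos hM j
  have hM' : (0:ℝ) < M := by exact_mod_cast hM
  have e : (m:ℝ) * 2 ^ j = m * M * sideL M j := by
    unfold sideL; field_simp
  unfold Bx
  simp only [mem_ofPred_eq, Finset.mem_Ico]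
  refine forall_congr' fun i => ?_
  rw [Int.le_floor, Int.floor_lt, le_div_iff₀ hl, div_lt_iff₀ hl, e]
  push_cast
  rw [neg_mul]

lemma lcell_iff {d M : ℕ} (hM : 0 < M) (j : ℕ) (x : Ed d) :
    (∃ k ∈ KM d M, x ∈ lcell M j k) ↔ x ∈ (Bx (2 ^ (j + 1)) : Set (Ed d)) ∧ x ∉ (Bx (2 ^ j) : Set (Ed d)) := by
  have h2 := mem_Bx hM j 2 x
  have h1 := mem_Bx hM j 1 x
  rw [show ((2:ℕ):ℝ) * 2 ^ j = 2 ^ (j+1) by push_cast; ring] at h2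
  rw [show ((1:ℕ):ℝ) * 2 ^ j = 2 ^ j by push_cast; ring] at h1
  rw [h1, h2]
  unfold KM
  simp only [Finset.mem_sdiff, Fintype.mem_piFinset, mem_lcell hM, Finset.mem_Ico, Nat.cast_ofNat,
    Nat.cast_one, one_mul]
  constructor
  · rintro ⟨k, ⟨ha, hb⟩, hx⟩
    simp only [hx]
    exact ⟨ha, hb⟩
  · rintro ⟨ha, hb⟩
    exact ⟨fun i => ⌊x i / sideL M j⌋, ⟨ha, hb⟩, fun i => rfl⟩

lemma Bx_mono {d : ℕ} {s t : ℝ} (h : s ≤ t) : (Bx s : Set (Ed d)) ⊆ Bx t := by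
  intro x hx i
  have := hx i
  constructor <;> linarith

lemma not_Bx_norm {d : ℕ} {s : ℝ} (x : Ed d) (h : x ∉ (Bx s : Set (Ed d))) : s ≤ ‖x‖ := by
  simp only [Bx, mem_ofPred_eq, not_forall] at h
  obtain ⟨i, hi⟩ := h
  have h1 : |x i| ≤ ‖x‖ := by simpa using PiLp.norm_apply_le x i
  refine le_trans ?_ h1
  rcases lt_or_ge (x i) (-s) with h2 | h2
  · exact le_trans (by linarith) (neg_le_abs _)
  · have : s ≤ x i := by
      by_contra h3; exact hi ⟨h2, by linarith⟩
    exact this.trans (le_abs_self _)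

lemma lcell_norm {d M : ℕ} (hM : 0 < M) (j : ℕ) (k : Fin d → ℤ) (hk : k ∈ KM d M) (x : Ed d)
    (hx : x ∈ lcell M j k) : (2:ℝ) ^ j ≤ ‖x‖ :=
  not_Bx_norm x ((lcell_iff hM j x).mp ⟨k, hk, hx⟩).2

lemma Bx_cover {d M : ℕ} (hM : 0 < M) (j0 J : ℕ) (x : Ed d)
    (h0 : x ∉ (Bx (2 ^ j0) : Set (Ed d))) (hJ : x ∈ (Bx (2 ^ J) : Set (Ed d))) :
    ∃ j ∈ Finset.Ico j0 J, ∃ k ∈ KM d M, x ∈ lcell M j k := by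
  induction J with
  | zero =>
    exfalso
    refine h0 (Bx_mono ?_ hJ)
    exact pow_le_pow_right₀ (by norm_num) (by omega)
  | succ J ih =>
    by_cases h : x ∈ (Bx (2 ^ J) : Set (Ed d))
    · obtain ⟨j, hj, hk⟩ := ih h
      rw [Finset.mem_Ico] at hj
      exact ⟨j, Finset.mem_Ico.mpr ⟨hj.1, by omega⟩, hk⟩
    · refine ⟨J, Finset.mem_Ico.mpr ⟨?_, by omega⟩, (lcell_iff hM J x).mpr ⟨hJ, h⟩⟩
      by_contra hlt
      refine h0 (Bx_mono ?_ hJ)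
      exact pow_le_pow_right₀ (by norm_num) (by omega)

/-- index type of the decomposition -/
abbrev Idx (d M j0 J : ℕ) := Option ↥(Finset.Ico j0 J ×ˢ KM d M)

def aI {d M j0 J : ℕ} : Idx d M j0 J → Fin d → ℝ
  | none => fun _ => -2 ^ j0
  | some p => corner M p.1.1 p.1.2

def lI {d M j0 J : ℕ} : Idx d M j0 J → ℝ
  | none => 2 * 2 ^ j0
  | some p => sideL M p.1.1

lemma lI_pos {d M j0 J : ℕ} (hM : 0 < M) (i : Idx d M j0 J) : 0 < lI i := by
  cases i with
  | none => simp only [lI]; positivity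
  | some p => exact sideL_pos hM _

lemma cell_none {d M j0 J : ℕ} :
    cell (aI (none : Idx d M j0 J)) (lI (none : Idx d M j0 J)) = Bx (2 ^ j0) := by
  ext x
  simp only [cell, Bx, aI, lI, mem_ofPred_eq]
  refine forall_congr' fun i => and_congr_right fun _ => ?_
  rw [show (-2 ^ j0 : ℝ) + 2 * 2 ^ j0 = 2 ^ j0 by ring]

lemma cellI_disj {d M j0 J : ℕ} (hM : 0 < M) :
    Pairwise (Function.onFun Disjoint fun i : Idx d M j0 J => cell (aI i) (lI i)) := by
  have hsome : ∀ p : ↥(Finset.Ico j0 J ×ˢ KM d M), ∀ x ∈ lcell M p.1.1 p.1.2,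
      x ∈ (Bx (2 ^ (p.1.1 + 1)) : Set (Ed d)) ∧ x ∉ (Bx (2 ^ p.1.1) : Set (Ed d)) := by
    intro p x hx
    exact (lcell_iff hM _ x).mp ⟨_, (Finset.mem_product.mp p.2).2, hx⟩
  have hj : ∀ p : ↥(Finset.Ico j0 J ×ˢ KM d M), j0 ≤ p.1.1 := fun p =>
    (Finset.mem_Ico.mp (Finset.mem_product.mp p.2).1).1
  have hns : ∀ p : ↥(Finset.Ico j0 J ×ˢ KM d M), ∀ x ∈ lcell M p.1.1 p.1.2,
      x ∉ (Bx (2 ^ j0) : Set (Ed d)) := by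
    intro p x hx h
    exact (hsome p x hx).2 (Bx_mono (pow_le_pow_right₀ (by norm_num) (hj p)) h)
  have hlt : ∀ p q : ↥(Finset.Ico j0 J ×ˢ KM d M), p.1.1 < q.1.1 → ∀ x ∈ lcell M p.1.1 p.1.2,
      x ∉ lcell M q.1.1 q.1.2 := by
    intro p q hpq x hx hx'
    exact (hsome q x hx').2 (Bx_mono (pow_le_pow_right₀ (by norm_num) hpq) (hsome p x hx).1)
  intro i i' hne
  rw [Function.onFun, Set.disjoint_left]
  intro x hx hx'
  cases i with
  | none =>
    cases i' with
    | none => exact hne rfl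
    | some q =>
      rw [cell_none] at hx
      exact hns q x hx' hx
  | some p =>
    cases i' with
    | none =>
      rw [cell_none] at hx'
      exact hns p x hx hx'
    | some q =>
      have hx1 : x ∈ lcell M p.1.1 p.1.2 := hx
      have hx2 : x ∈ lcell M q.1.1 q.1.2 := hx'
      rcases lt_trichotomy p.1.1 q.1.1 with h | h | h
      · exact hlt p q h x hx1 hx2
      · refine hne (congrArg some (Subtype.ext (Prod.ext h ?_)))
        rw [← h] at hx2
        ext i
        rw [← (mem_lcell hM _ _ _).mp hx1 i, ← (mem_lcell hM _ _ _).mp hx2 i]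
      · exact hlt q p h x hx2 hx1

lemma cellI_out {d M j0 J : ℕ} (hM : 0 < M) (x : Ed d)
    (h : ∀ i : Idx d M j0 J, x ∉ cell (aI i) (lI i)) : (2:ℝ) ^ J ≤ ‖x‖ := by
  refine not_Bx_norm x fun hJ => ?_
  have h0 := h none
  rw [cell_none] at h0
  obtain ⟨j, hj, k, hk, hx⟩ := Bx_cover hM j0 J x h0 hJ
  exact h (some ⟨(j, k), Finset.mem_product.mpr ⟨hj, hk⟩⟩) hx

lemma cell_convex {d : ℕ} (a : Fin d → ℝ) (l : ℝ) : Convex ℝ (cell a l) := by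
  have : cell a l = ⋂ i, {x : Ed d | a i ≤ x i ∧ x i < a i + l} := by
    ext x; simp [cell]
  rw [this]
  refine convex_iInter fun i => ?_
  have hlin : IsLinearMap ℝ (fun x : Ed d => x i) := ⟨fun _ _ => rfl, fun _ _ => rfl⟩
  exact (convex_halfSpace_ge hlin _).inter (convex_halfSpace_lt hlin _)

lemma cell_corner_mem {d : ℕ} (a : Fin d → ℝ) (l : ℝ) (hl : 0 < l) :
    (WithLp.toLp 2 a : Ed d) ∈ cell a l := by
  intro i
  simp [hl]

lemma cell_diam {d : ℕ} (a : Fin d → ℝ) (l : ℝ) (x : Ed d) (hx : x ∈ cell a l) :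
    ‖x - WithLp.toLp 2 a‖ ≤ √d * l := by
  have hl : 0 ≤ l ∨ d = 0 := by
    rcases Nat.eq_zero_or_pos d with h | h
    · exact Or.inr h
    · have := hx ⟨0, h⟩
      exact Or.inl (by linarith)
  rcases hl with hl | rfl
  · rw [EuclideanSpace.norm_eq]
    have : √d * l = √(∑ _i : Fin d, l ^ 2) := by
      rw [Finset.sum_const, Finset.card_fin, nsmul_eq_mul, Real.sqrt_mul (by positivity),
        Real.sqrt_sq hl]
    rw [this]
    refine Real.sqrt_le_sqrt (Finset.sum_le_sum fun i _ => ?_)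
    refine pow_le_pow_left₀ (norm_nonneg _) ?_ 2
    have := hx i
    simp only [PiLp.sub_apply, Real.norm_eq_abs]
    rw [abs_le]; constructor <;> linarith
  · have : x - WithLp.toLp 2 a = 0 := Subsingleton.elim _ _
    rw [this]; simp

lemma card_KM (d M : ℕ) : ((KM d M).card : ℝ) ≤ (4 * M) ^ d := by
  have h : (KM d M).card ≤ (4 * M) ^ d := by
    refine (Finset.card_le_card Finset.sdiff_subset).trans ?_
    rw [Fintype.card_piFinset]
    simp only [Int.card_Ico, Finset.prod_const, Finset.card_univ, Fintype.card_fin]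
    refine Nat.pow_le_pow_left ?_ d
    omega
  exact_mod_cast h

/-! ### Part 9: elementary estimates for one cell -/

lemma ana_up (d : ℕ) (A ε : ℝ) (hε : 0 < ε) :
    ∀ᶠ ω in 𝓝 (0:ℝ), ∀ t ∈ Icc 0 A, (√((t + 3 * ω) / (1 - ω)) + ω) ^ d ≤ √t ^ d + ε := by
  refine (isCompact_Icc (a := (0:ℝ)) (b := A)).eventually_forall_of_forall_eventually ?_
  intro t ht
  have hc : ContinuousAt (fun p : ℝ × ℝ => (√((p.2 + 3 * p.1) / (1 - p.1)) + p.1) ^ d - √p.2 ^ d)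
      ((0:ℝ), t) := by
    have h1 : ContinuousAt (fun p : ℝ × ℝ => (p.2 + 3 * p.1) / (1 - p.1)) ((0:ℝ), t) :=
      ContinuousAt.div (by fun_prop) (by fun_prop) (by simp)
    have h2 : ContinuousAt (fun p : ℝ × ℝ => √((p.2 + 3 * p.1) / (1 - p.1))) ((0:ℝ), t) :=
      Real.continuous_sqrt.continuousAt.comp h1
    have h3 : ContinuousAt (fun p : ℝ × ℝ => √p.2) ((0:ℝ), t) :=
      Real.continuous_sqrt.continuousAt.comp continuousAt_snd
    exact ((h2.add continuousAt_fst).pow d).sub (h3.pow d)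
  have h := Filter.Tendsto.eventually_lt_const (u := ε) (by simpa using hε) hc
  filter_upwards [h] with p hp
  linarith

lemma ana_lo (d : ℕ) (A ε : ℝ) (hε : 0 < ε) :
    ∀ᶠ ω in 𝓝 (0:ℝ), ∀ t ∈ Icc 0 A,
      √t ^ d - ε ≤ (max (√(max (t - 3 * ω) 0 / (1 + ω)) - ω) 0) ^ d := by
  refine (isCompact_Icc (a := (0:ℝ)) (b := A)).eventually_forall_of_forall_eventually ?_
  intro t ht
  have hc : ContinuousAt (fun p : ℝ × ℝ =>
      √p.2 ^ d - (max (√(max (p.2 - 3 * p.1) 0 / (1 + p.1)) - p.1) 0) ^ d) ((0:ℝ), t) := by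
    have h1 : ContinuousAt (fun p : ℝ × ℝ => max (p.2 - 3 * p.1) 0 / (1 + p.1)) ((0:ℝ), t) :=
      ContinuousAt.div (by fun_prop) (by fun_prop) (by simp)
    have h2 : ContinuousAt (fun p : ℝ × ℝ => √(max (p.2 - 3 * p.1) 0 / (1 + p.1))) ((0:ℝ), t) :=
      Real.continuous_sqrt.continuousAt.comp h1
    have h3 : ContinuousAt (fun p : ℝ × ℝ => √p.2) ((0:ℝ), t) :=
      Real.continuous_sqrt.continuousAt.comp continuousAt_snd
    exact (h3.pow d).sub (((h2.sub continuousAt_fst).max continuousAt_const).pow d)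
  have h := Filter.Tendsto.eventually_lt_const (u := ε) (by simpa [ht.1] using hε) hc
  filter_upwards [h] with p hp
  linarith

def cd (d : ℕ) : ℝ := tau d / (2 * π) ^ d

lemma tau_nonneg (d : ℕ) : 0 ≤ tau d := ENNReal.toReal_nonneg

lemma cd_nonneg (d : ℕ) : 0 ≤ cd d := div_nonneg (tau_nonneg d) (by positivity)

/-- radius of the index set -/
def TT (l θ B : ℝ) : ℝ := l * √(max B 0 / θ) / π

lemma TT_nonneg {l : ℝ} (hl : 0 < l) (θ B : ℝ) : 0 ≤ TT l θ B := by
  unfold TT; positivity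

lemma TT_sq {l θ : ℝ} (hθ : 0 < θ) (B : ℝ) : TT l θ B ^ 2 = l ^ 2 * (max B 0 / θ) / π ^ 2 := by
  unfold TT
  rw [div_pow, mul_pow, Real.sq_sqrt (by positivity)]

lemma SN_spec {d : ℕ} {l θ B : ℝ} (hl : 0 < l) (hθ : 0 < θ) (n : Fin d → ℕ)
    (h : π ^ 2 * (∑ j, (n j : ℝ) ^ 2) / l ^ 2 < B / θ) : n ∈ SN d (TT l θ B) := by
  rw [mem_SN, TT_sq hθ, lt_div_iff₀ (by positivity)]
  rw [div_lt_iff₀ (by positivity)] at h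
  have : B / θ ≤ max B 0 / θ := by gcongr; exact le_max_left _ _
  have h2 := mul_le_mul_of_nonneg_right this (sq_nonneg l)
  linarith

lemma SD_spec {d : ℕ} {l θ B : ℝ} (hl : 0 < l) (hθ : 0 < θ) (n : Fin d → ℕ)
    (h : n ∈ SD d (TT l θ B)) :
    (∀ j, n j ≠ 0) ∧ θ * (π ^ 2 * (∑ j, (n j : ℝ) ^ 2) / l ^ 2) < B := by
  rw [SD, Finset.mem_filter, mem_SN, TT_sq hθ, lt_div_iff₀ (by positivity)] at h
  refine ⟨h.2, ?_⟩
  have h1 := h.1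
  have hn : (0:ℝ) ≤ ∑ j, (n j : ℝ) ^ 2 := Finset.sum_nonneg fun _ _ => sq_nonneg _
  have hB : 0 < B := by
    by_contra hB
    rw [max_eq_right (not_lt.mp hB)] at h1
    simp at h1
    have : 0 ≤ (∑ j, (n j : ℝ) ^ 2) * π ^ 2 := by positivity
    linarith
  rw [max_eq_left hB.le] at h1
  have e : l ^ 2 * (B / θ) * (θ / l ^ 2) = B := by field_simp
  have h3 := mul_lt_mul_of_pos_right h1 (show 0 < θ / l ^ 2 by positivity)
  rw [e] at h3
  refine lt_of_eq_of_lt ?_ h3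
  ring

lemma cost_up {d : ℕ} (hd : 1 ≤ d) {l σ ω A ε t B : ℝ} (hl : 0 < l) (hσ : 0 < σ) (hω : 0 < ω)
    (hω1 : ω < 1)
    (hana : ∀ t ∈ Icc 0 A, (√((t + 3 * ω) / (1 - ω)) + ω) ^ d ≤ √t ^ d + ε)
    (ht : t ∈ Icc 0 A) (hB : B ≤ σ ^ 2 * (t + 3 * ω)) (hs : √d ≤ ω * (l * σ / π)) :
    ((SN d (TT l (1 - ω) B)).card : ℝ) ≤ cd d * (l ^ d * σ ^ d * (√t ^ d + ε)) := by
  refine (card_SN hd _ (TT_nonneg hl _ _)).trans ?_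
  have hθ : 0 < 1 - ω := by linarith
  have h1 : TT l (1 - ω) B ≤ (l * σ / π) * √((t + 3 * ω) / (1 - ω)) := by
    unfold TT
    have : √(max B 0 / (1 - ω)) ≤ σ * √((t + 3 * ω) / (1 - ω)) := by
      rw [← Real.sqrt_sq hσ.le, ← Real.sqrt_mul (sq_nonneg σ)]
      refine Real.sqrt_le_sqrt ?_
      rw [← mul_div_assoc]
      gcongr
      have := ht.1
      exact max_le hB (by positivity)
    calc l * √(max B 0 / (1 - ω)) / π ≤ l * (σ * √((t + 3 * ω) / (1 - ω))) / π := by gcongr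
      _ = _ := by ring
  have h2 : TT l (1 - ω) B + √d ≤ (l * σ / π) * (√((t + 3 * ω) / (1 - ω)) + ω) := by
    linarith
  have h3 : (TT l (1 - ω) B + √d) ^ d ≤ (l * σ / π) ^ d * (√t ^ d + ε) := by
    calc _ ≤ ((l * σ / π) * (√((t + 3 * ω) / (1 - ω)) + ω)) ^ d := by
          have := TT_nonneg hl (1 - ω) B
          gcongr
      _ = (l * σ / π) ^ d * (√((t + 3 * ω) / (1 - ω)) + ω) ^ d := mul_pow _ _ _
      _ ≤ _ := mul_le_mul_of_nonneg_left (hana t ht) (by positivity)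
  calc _ ≤ (1 / 2) ^ d * tau d * ((l * σ / π) ^ d * (√t ^ d + ε)) := by
        have := tau_nonneg d
        gcongr
    _ = _ := by
        unfold cd
        simp only [div_pow, mul_pow, one_pow]; field_simp

lemma cost_lo {d : ℕ} (hd : 1 ≤ d) {l σ ω A ε t B : ℝ} (hl : 0 < l) (hσ : 0 < σ) (hω : 0 < ω)
    (hana : ∀ t ∈ Icc 0 A, √t ^ d - ε ≤ (max (√(max (t - 3 * ω) 0 / (1 + ω)) - ω) 0) ^ d)
    (ht : t ∈ Icc 0 A) (hB : σ ^ 2 * max (t - 3 * ω) 0 ≤ max B 0) (hs : √d ≤ ω * (l * σ / π)) :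
    cd d * (l ^ d * σ ^ d * (√t ^ d - ε)) ≤ ((SD d (TT l (1 + ω) B)).card : ℝ) := by
  refine le_trans ?_ (card_SD hd _)
  have h1 : (l * σ / π) * √(max (t - 3 * ω) 0 / (1 + ω)) ≤ TT l (1 + ω) B := by
    unfold TT
    have : σ * √(max (t - 3 * ω) 0 / (1 + ω)) ≤ √(max B 0 / (1 + ω)) := by
      rw [← Real.sqrt_sq hσ.le, ← Real.sqrt_mul (sq_nonneg σ)]
      refine Real.sqrt_le_sqrt ?_
      rw [← mul_div_assoc]
      gcongr
    calc _ = l * (σ * √(max (t - 3 * ω) 0 / (1 + ω))) / π := by ring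
      _ ≤ _ := by gcongr
  have hk : 0 < l * σ / π := by positivity
  have h2 : (l * σ / π) * max (√(max (t - 3 * ω) 0 / (1 + ω)) - ω) 0
      ≤ max (TT l (1 + ω) B - √d) 0 := by
    rw [mul_max_of_nonneg _ _ hk.le, mul_zero]
    refine max_le_max ?_ le_rfl
    linarith
  have h3 : (l * σ / π) ^ d * (√t ^ d - ε) ≤ (max (TT l (1 + ω) B - √d) 0) ^ d := by
    calc _ ≤ (l * σ / π) ^ d * (max (√(max (t - 3 * ω) 0 / (1 + ω)) - ω) 0) ^ d :=
          mul_le_mul_of_nonneg_left (hana t ht) (by positivity)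
      _ = ((l * σ / π) * max (√(max (t - 3 * ω) 0 / (1 + ω)) - ω) 0) ^ d := (mul_pow _ _ _).symm
      _ ≤ _ := by gcongr
  calc _ = (1 / 2) ^ d * tau d * ((l * σ / π) ^ d * (√t ^ d - ε)) := by
        unfold cd
        simp only [div_pow, mul_pow, one_pow]; field_simp
    _ ≤ _ := by
        have := tau_nonneg d
        gcongr

lemma rpow_half (d : ℕ) {y : ℝ} (hy : 0 ≤ y) : y ^ ((d:ℝ) / 2) = √y ^ d := by
  rw [Real.sqrt_eq_rpow, ← Real.rpow_natCast, ← Real.rpow_mul hy]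
  congr 1; ring

/-! ### Part 10: summing over the cells -/

lemma cell_meas_real {d : ℕ} (a : Fin d → ℝ) (l : ℝ) (hl : 0 < l) :
    (volume : Measure (Ed d)).real (cell a l) = l ^ d := by
  rw [Measure.real, cell_vol a l hl, ENNReal.toReal_ofReal (by positivity)]

lemma cell_up {d : ℕ} (hd : 1 ≤ d) {l σ ω A ε lam : ℝ} (hl : 0 < l) (hσ : 0 < σ) (hω : 0 < ω)
    (hω1 : ω < 1) (hA : 0 ≤ A) (hlam : 0 ≤ lam)
    (hana : ∀ t ∈ Icc 0 A, (√((t + 3 * ω) / (1 - ω)) + ω) ^ d ≤ √t ^ d + ε)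
    (hs : √d ≤ ω * (l * σ / π)) (c : Fin d → ℝ) (f : Ed d → ℝ) (fc : ℝ)
    (hosc : ∀ x ∈ cell c l, |f x - fc| ≤ ω * σ ^ 2) (hfc : fc ≤ A * σ ^ 2)
    (hIntg : Integrable (fun x => √(max (f x - lam) 0) ^ d)) :
    ((SN d (TT l (1 - ω) (fc - lam + 2 * ω * σ ^ 2))).card : ℝ) ≤
      cd d * (∫ x in cell c l, √(max (f x - lam) 0) ^ d) + cd d * ε * (l ^ d * σ ^ d) := by
  set t := max ((fc - lam) / σ ^ 2 - ω) 0 with ht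
  have hσ2 : 0 < σ ^ 2 := by positivity
  have htm : t ∈ Icc 0 A := by
    refine ⟨le_max_right _ _, max_le ?_ hA⟩
    have : (fc - lam) / σ ^ 2 ≤ A := by rw [div_le_iff₀ hσ2]; linarith
    linarith
  have hσt : σ ^ 2 * t = max (fc - lam - ω * σ ^ 2) 0 := by
    rw [ht, mul_max_of_nonneg _ _ hσ2.le, mul_zero]
    congr 1; field_simp
  have h1 := cost_up hd (B := fc - lam + 2 * ω * σ ^ 2) hl hσ hω hω1 hana htm (by
    rw [mul_add, hσt]; have := le_max_left (fc - lam - ω * σ ^ 2) 0; linarith) hs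
  have h2 : l ^ d * σ ^ d * √t ^ d ≤ ∫ x in cell c l, √(max (f x - lam) 0) ^ d := by
    have e : l ^ d * σ ^ d * √t ^ d = ∫ x in cell c l, (√(σ ^ 2 * t) ^ d) := by
      rw [setIntegral_const, cell_meas_real c l hl, Real.sqrt_mul (sq_nonneg _),
        Real.sqrt_sq hσ.le, mul_pow, smul_eq_mul]; ring
    rw [e]
    refine setIntegral_mono_on ?_ hIntg.integrableOn (cell_meas c l) ?_
    · exact integrableOn_const (by rw [cell_vol c l hl]; exact ENNReal.ofReal_ne_top)
    · intro x hx
      rw [hσt]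
      have := abs_le.mp (hosc x hx)
      gcongr ?_ ^ d
      refine Real.sqrt_le_sqrt (max_le_max ?_ le_rfl)
      linarith
  have h3 := mul_le_mul_of_nonneg_left h2 (cd_nonneg d)
  calc _ ≤ _ := h1
    _ = cd d * (l ^ d * σ ^ d * √t ^ d) + cd d * ε * (l ^ d * σ ^ d) := by ring
    _ ≤ _ := by linarith

lemma cell_lo {d : ℕ} (hd : 1 ≤ d) {l σ ω A ε lam : ℝ} (hl : 0 < l) (hσ : 0 < σ) (hω : 0 < ω)
    (hω1 : ω < 1) (hA : 0 ≤ A) (hlam : 0 ≤ lam)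
    (hana : ∀ t ∈ Icc 0 (A + 1), √t ^ d - ε ≤ (max (√(max (t - 3 * ω) 0 / (1 + ω)) - ω) 0) ^ d)
    (hs : √d ≤ ω * (l * σ / π)) (c : Fin d → ℝ) (f : Ed d → ℝ) (fc : ℝ)
    (hosc : ∀ x ∈ cell c l, |f x - fc| ≤ ω * σ ^ 2) (hfc : fc ≤ A * σ ^ 2)
    (hIntg : Integrable (fun x => √(max (f x - lam) 0) ^ d)) :
    cd d * (∫ x in cell c l, √(max (f x - lam) 0) ^ d) - cd d * ε * (l ^ d * σ ^ d) ≤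
      ((SD d (TT l (1 + ω) (fc - lam - 2 * ω * σ ^ 2))).card : ℝ) := by
  set t := max ((fc - lam) / σ ^ 2 + ω) 0 with ht
  have hσ2 : 0 < σ ^ 2 := by positivity
  have htm : t ∈ Icc 0 (A + 1) := by
    refine ⟨le_max_right _ _, max_le ?_ (by linarith)⟩
    have : (fc - lam) / σ ^ 2 ≤ A := by rw [div_le_iff₀ hσ2]; linarith
    linarith
  have hσt : σ ^ 2 * t = max (fc - lam + ω * σ ^ 2) 0 := by
    rw [ht, mul_max_of_nonneg _ _ hσ2.le, mul_zero]
    congr 1; field_simp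
  have h1 := cost_lo hd (B := fc - lam - 2 * ω * σ ^ 2) hl hσ hω hana htm (by
    rw [mul_max_of_nonneg _ _ hσ2.le, mul_zero, mul_sub, hσt]
    refine max_le ?_ (le_max_right _ _)
    rcases max_cases (fc - lam + ω * σ ^ 2) 0 with ⟨h, _⟩ | ⟨h, _⟩
    · rw [h]; refine le_trans (le_of_eq ?_) (le_max_left _ _); ring
    · rw [h]; refine le_trans ?_ (le_max_right _ _)
      have : 0 ≤ σ ^ 2 * (3 * ω) := by positivity
      linarith) hs
  have h2 : (∫ x in cell c l, √(max (f x - lam) 0) ^ d) ≤ l ^ d * σ ^ d * √t ^ d := by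
    have e : l ^ d * σ ^ d * √t ^ d = ∫ x in cell c l, (√(σ ^ 2 * t) ^ d) := by
      rw [setIntegral_const, cell_meas_real c l hl, Real.sqrt_mul (sq_nonneg _),
        Real.sqrt_sq hσ.le, mul_pow, smul_eq_mul]; ring
    rw [e]
    refine setIntegral_mono_on hIntg.integrableOn ?_ (cell_meas c l) ?_
    · exact integrableOn_const (by rw [cell_vol c l hl]; exact ENNReal.ofReal_ne_top)
    · intro x hx
      rw [hσt]
      have := abs_le.mp (hosc x hx)
      gcongr ?_ ^ d
      refine Real.sqrt_le_sqrt (max_le_max ?_ le_rfl)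
      linarith
  have h3 := mul_le_mul_of_nonneg_left h2 (cd_nonneg d)
  calc _ ≤ cd d * (l ^ d * σ ^ d * √t ^ d) - cd d * ε * (l ^ d * σ ^ d) := by linarith
    _ = cd d * (l ^ d * σ ^ d * (√t ^ d - ε)) := by ring
    _ ≤ _ := h1

/-- scale of the potential in the dyadic shell -/
def sig (ρ : ℝ) (j : ℕ) : ℝ := ((2:ℝ) ^ j) ^ (-ρ / 2)

lemma sig_pos (ρ : ℝ) (j : ℕ) : 0 < sig ρ j := by unfold sig; positivity

lemma sig_sq (ρ : ℝ) (j : ℕ) : sig ρ j ^ 2 = ((2:ℝ) ^ j) ^ (-ρ) := by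
  unfold sig
  rw [← Real.rpow_natCast, ← Real.rpow_mul (by positivity)]
  congr 1; push_cast; ring

lemma esum {d M : ℕ} (hd : 1 ≤ d) (hM : 0 < M) (j0 J : ℕ) {ρ : ℝ} (hρ : ρ < 2) :
    ∑ p : ↥(Finset.Ico j0 J ×ˢ KM d M), sideL M p.1.1 ^ d * sig ρ p.1.1 ^ d ≤
      4 ^ d / ((2:ℝ) ^ ((d:ℝ) * (1 - ρ / 2)) - 1) * ((2:ℝ) ^ J) ^ ((d:ℝ) * (1 - ρ / 2)) := by
  set β : ℝ := (d:ℝ) * (1 - ρ / 2) with hβ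
  have hd' : (1:ℝ) ≤ d := by exact_mod_cast hd
  have hβ0 : 0 < β := by
    rw [hβ]; exact mul_pos (by linarith) (by linarith)
  have hq : 1 < (2:ℝ) ^ β := Real.one_lt_rpow (by norm_num) hβ0
  have hM' : (0:ℝ) < M := by exact_mod_cast hM
  rw [Finset.sum_coe_sort (Finset.Ico j0 J ×ˢ KM d M)
    (fun p => sideL M p.1 ^ d * sig ρ p.1 ^ d), Finset.sum_product]
  have h1 : ∀ j : ℕ, (∑ _k ∈ KM d M, sideL M j ^ d * sig ρ j ^ d) ≤ 4 ^ d * ((2:ℝ) ^ β) ^ j := by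
    intro j
    rw [Finset.sum_const, nsmul_eq_mul]
    have hp : 0 ≤ sideL M j ^ d * sig ρ j ^ d := by
      have := sideL_pos hM j; have := sig_pos ρ j; positivity
    refine (mul_le_mul_of_nonneg_right (card_KM d M) hp).trans (le_of_eq ?_)
    have e1 : ((2:ℝ) ^ β) ^ j = ((2:ℝ) ^ j) ^ β := by
      rw [← Real.rpow_natCast, ← Real.rpow_natCast, ← Real.rpow_mul (by norm_num),
        ← Real.rpow_mul (by norm_num), mul_comm]
    have e2 : ((2:ℝ) ^ j) ^ β = ((2:ℝ) ^ j) ^ d * sig ρ j ^ d := by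
      unfold sig
      rw [← Real.rpow_natCast (((2:ℝ) ^ j) ^ (-ρ / 2)), ← Real.rpow_mul (by positivity),
        ← Real.rpow_natCast ((2:ℝ) ^ j) d, ← Real.rpow_add (by positivity), hβ]
      congr 1; ring
    rw [e1, e2]
    unfold sideL
    rw [div_pow, mul_pow]; field_simp
  refine (Finset.sum_le_sum fun j _ => h1 j).trans ?_
  rw [← Finset.mul_sum]
  have h2 : ∑ j ∈ Finset.Ico j0 J, ((2:ℝ) ^ β) ^ j ≤ ((2:ℝ) ^ β) ^ J / ((2:ℝ) ^ β - 1) := by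
    calc _ ≤ ∑ j ∈ Finset.range J, ((2:ℝ) ^ β) ^ j := by
          refine Finset.sum_le_sum_of_subset_of_nonneg ?_ (fun _ _ _ => by positivity)
          intro j hj; rw [Finset.mem_Ico] at hj; exact Finset.mem_range.mpr hj.2
      _ = (((2:ℝ) ^ β) ^ J - 1) / ((2:ℝ) ^ β - 1) := geom_sum_eq (by linarith) J
      _ ≤ _ := by
          have : 0 < (2:ℝ) ^ β - 1 := by linarith
          gcongr; linarith
  have e1 : ((2:ℝ) ^ β) ^ J = ((2:ℝ) ^ J) ^ β := by
    rw [← Real.rpow_natCast, ← Real.rpow_natCast, ← Real.rpow_mul (by norm_num),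
      ← Real.rpow_mul (by norm_num), mul_comm]
  rw [e1] at h2
  calc _ ≤ 4 ^ d * (((2:ℝ) ^ J) ^ β / ((2:ℝ) ^ β - 1)) := by gcongr
    _ = _ := by ring

/-- standing assumptions on the potential -/
structure Good (d M j0 : ℕ) (ρ ω A : ℝ) (a Rm : Ed d → ℝ) : Prop where
  ca : Continuous a
  cR : Continuous Rm
  osc : ∀ j, j0 ≤ j → ∀ k ∈ KM d M, ∀ x ∈ lcell M j k,
    |a x - a (WithLp.toLp 2 (corner M j k))| ≤ ω * sig ρ j ^ 2
  R0 : ∀ x, 0 ≤ Rm x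
  hR : ∀ x, 2 ^ j0 ≤ ‖x‖ → Rm x ≤ ω * ‖x‖ ^ (-ρ)
  hA : ∀ x, 2 ^ j0 ≤ ‖x‖ → a x ≤ A * ‖x‖ ^ (-ρ)
  hs : ∀ j, j0 ≤ j → √d ≤ ω * (sideL M j * sig ρ j / π)

lemma Good.int {d M j0 : ℕ} {ρ ω A lam : ℝ} {a Rm : Ed d → ℝ} (hd : 1 ≤ d)
    (G : Good d M j0 ρ ω A a Rm) {T : ℝ}
    (hout : ∀ x, T ≤ ‖x‖ → a x + Rm x ≤ lam) :
    Integrable (fun x => √(max (a x - lam) 0) ^ d) := by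
  have hc : Continuous (fun x => √(max (a x - lam) 0) ^ d) := by
    have := G.ca; fun_prop
  refine hc.integrable_of_hasCompactSupport ?_
  refine HasCompactSupport.intro (isCompact_closedBall (0 : Ed d) T) ?_
  intro x hx
  have hx' : T ≤ ‖x‖ := by
    rw [mem_closedBall_zero_iff] at hx; linarith
  have := hout x hx'
  have := G.R0 x
  rw [max_eq_right (by linarith), Real.sqrt_zero, zero_pow (by omega)]

lemma rpow_anti {x y ρ : ℝ} (hx : 0 < x) (hxy : x ≤ y) (hρ : 0 < ρ) : y ^ (-ρ) ≤ x ^ (-ρ) :=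
  Real.rpow_le_rpow_of_nonpos hx hxy (by linarith)

lemma Good.some_bd {d M j0 : ℕ} {ρ ω A : ℝ} {a Rm : Ed d → ℝ} (hM : 0 < M) (hρ : 0 < ρ)
    (hA : 0 ≤ A) (hω : 0 < ω) (G : Good d M j0 ρ ω A a Rm) (j : ℕ) (hj : j0 ≤ j)
    (k : Fin d → ℤ) (hk : k ∈ KM d M) :
    a (WithLp.toLp 2 (corner M j k)) ≤ A * sig ρ j ^ 2 ∧
    ∀ x ∈ lcell M j k, Rm x ≤ ω * sig ρ j ^ 2 := by
  have hpos : (0:ℝ) < 2 ^ j := by positivity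
  have h2 : ((2:ℝ)) ^ j0 ≤ 2 ^ j := pow_le_pow_right₀ (by norm_num) hj
  rw [sig_sq]
  constructor
  · have hn := lcell_norm hM j k hk _ (cell_corner_mem (corner M j k) (sideL M j) (sideL_pos hM j))
    refine (G.hA _ (h2.trans hn)).trans ?_
    have := rpow_anti hpos hn hρ
    gcongr
  · intro x hx
    have hn := lcell_norm hM j k hk _ hx
    refine (G.hR _ (h2.trans hn)).trans ?_
    have := rpow_anti hpos hn hρ
    gcongr

lemma upper_sum {d M j0 J : ℕ} (hd : 1 ≤ d) {ρ ω A ε lam B0 : ℝ} {a Rm : Ed d → ℝ} (hM : 0 < M)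
    (hρ : 0 < ρ) (hρ2 : ρ < 2) (hA : 0 ≤ A) (hω : 0 < ω) (hω1 : ω < 1) (hε : 0 ≤ ε)
    (hlam : 0 ≤ lam)
    (hana : ∀ t ∈ Icc 0 A, (√((t + 3 * ω) / (1 - ω)) + ω) ^ d ≤ √t ^ d + ε)
    (G : Good d M j0 ρ ω A a Rm)
    (hB0 : ∀ x, a x + Rm x ≤ B0)
    (hout : ∀ x, 2 ^ J ≤ ‖x‖ → a x + Rm x ≤ lam)
    (F : Submodule ℝ (Ed d → ℝ)) (hF : ∀ u ∈ F, ContDiff ℝ (⊤ : ℕ∞) u ∧ HasCompactSupport u)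
    (hneg : ∀ u ∈ F, u ≠ 0 →
      (1 - ω) * (∫ x, ‖gradient u x‖ ^ 2) + ∫ x, (lam - a x - Rm x) * u x ^ 2 < 0) :
    (Module.finrank ℝ F : ℝ) ≤ (SN d (TT (2 * 2 ^ j0) (1 - ω) B0)).card +
      cd d * (∫ x, √(max (a x - lam) 0) ^ d) +
      cd d * ε * (4 ^ d / ((2:ℝ) ^ ((d:ℝ) * (1 - ρ / 2)) - 1) *
        ((2:ℝ) ^ J) ^ ((d:ℝ) * (1 - ρ / 2))) := by
  have hIntg := G.int hd hout
  let B : Idx d M j0 J → ℝ := fun i => match i with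
    | none => B0
    | some p => a (WithLp.toLp 2 (corner M p.1.1 p.1.2)) - lam + 2 * ω * sig ρ p.1.1 ^ 2
  let S : Idx d M j0 J → Finset (Fin d → ℕ) := fun i => SN d (TT (lI i) (1 - ω) (B i))
  have hp : ∀ p : ↥(Finset.Ico j0 J ×ˢ KM d M), j0 ≤ p.1.1 ∧ p.1.2 ∈ KM d M := fun p =>
    ⟨(Finset.mem_Ico.mp (Finset.mem_product.mp p.2).1).1, (Finset.mem_product.mp p.2).2⟩
  have hcount := upperA hd (aI : Idx d M j0 J → Fin d → ℝ) lI (lI_pos hM) (cellI_disj hM)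
    (fun x => lam - a x - Rm x) (by have := G.ca; have := G.cR; fun_prop) (1 - ω) (by linarith) B
    (by
      intro i x hx
      cases i with
      | none => have := hB0 x; simp only [B]; linarith
      | some p =>
        have h1 := abs_le.mp (G.osc _ (hp p).1 _ (hp p).2 x hx)
        have h2 := (G.some_bd hM hρ hA hω _ (hp p).1 _ (hp p).2).2 x hx
        simp only [B]; linarith)
    (by
      intro x hx
      have := hout x (cellI_out hM x hx)
      linarith)
    S (fun i n h => SN_spec (lI_pos hM i) (by linarith) n h) F hF hneg
  have hcount' : (Module.finrank ℝ F : ℝ) ≤ ∑ i, ((S i).card : ℝ) := by exact_mod_cast hcount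
  rw [Fintype.sum_option] at hcount'
  have hcell : ∀ p : ↥(Finset.Ico j0 J ×ˢ KM d M), ((S (some p)).card : ℝ) ≤
      cd d * (∫ x in lcell M p.1.1 p.1.2, √(max (a x - lam) 0) ^ d) +
        cd d * ε * (sideL M p.1.1 ^ d * sig ρ p.1.1 ^ d) := by
    intro p
    exact cell_up hd (sideL_pos hM _) (sig_pos ρ _) hω hω1 hA hlam hana (G.hs _ (hp p).1) _ a _
      (G.osc _ (hp p).1 _ (hp p).2) (G.some_bd hM hρ hA hω _ (hp p).1 _ (hp p).2).1 hIntg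
  have hsum := Finset.sum_le_sum (s := Finset.univ) fun p _ => hcell p
  rw [Finset.sum_add_distrib, ← Finset.mul_sum, ← Finset.mul_sum] at hsum
  have hU : ∑ p : ↥(Finset.Ico j0 J ×ˢ KM d M),
      (∫ x in lcell M p.1.1 p.1.2, √(max (a x - lam) 0) ^ d) ≤ ∫ x, √(max (a x - lam) 0) ^ d := by
    have hm : ∀ p : ↥(Finset.Ico j0 J ×ˢ KM d M),
        MeasurableSet (lcell M p.1.1 p.1.2 : Set (Ed d)) := fun p => cell_meas _ _
    rw [← integral_iUnion_fintype hm ?_ (fun p => hIntg.integrableOn)]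
    · exact setIntegral_le_integral hIntg (Filter.Eventually.of_forall fun x => by positivity)
    · intro p q hpq
      exact cellI_disj (d := d) (j0 := j0) (J := J) hM (i := some p) (j := some q) (by simpa using hpq)
  have hE := esum hd hM j0 J hρ2
  have h1 := mul_le_mul_of_nonneg_left hU (cd_nonneg d)
  have h2 := mul_le_mul_of_nonneg_left hE (mul_nonneg (cd_nonneg d) hε)
  have h0 : S none = SN d (TT (2 * 2 ^ j0) (1 - ω) B0) := rfl
  rw [h0] at hcount'
  linarith

lemma lower_sum {d M j0 J : ℕ} (hd : 1 ≤ d) {ρ ω A ε lam B0 : ℝ} {a Rm : Ed d → ℝ} (hM : 0 < M)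
    (hρ : 0 < ρ) (hρ2 : ρ < 2) (hA : 0 ≤ A) (hω : 0 < ω) (hω1 : ω < 1) (hε : 0 ≤ ε)
    (hlam : 0 ≤ lam) (hB00 : 0 ≤ B0)
    (hana : ∀ t ∈ Icc 0 (A + 1), √t ^ d - ε ≤ (max (√(max (t - 3 * ω) 0 / (1 + ω)) - ω) 0) ^ d)
    (G : Good d M j0 ρ ω A a Rm)
    (hB0 : ∀ x, a x + Rm x ≤ B0)
    (hout : ∀ x, 2 ^ J ≤ ‖x‖ → a x + Rm x ≤ lam) :
    ∃ F : Submodule ℝ (Ed d → ℝ), (∀ u ∈ F, ContDiff ℝ (⊤ : ℕ∞) u ∧ HasCompactSupport u) ∧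
    (∀ u ∈ F, u ≠ 0 →
      (1 + ω) * (∫ x, ‖gradient u x‖ ^ 2) + ∫ x, (lam - a x + Rm x) * u x ^ 2 < 0) ∧
    cd d * (∫ x, √(max (a x - lam) 0) ^ d) ≤ (Module.finrank ℝ F : ℝ) +
      cd d * ((2 * 2 ^ j0) ^ d * √B0 ^ d) +
      cd d * ε * (4 ^ d / ((2:ℝ) ^ ((d:ℝ) * (1 - ρ / 2)) - 1) *
        ((2:ℝ) ^ J) ^ ((d:ℝ) * (1 - ρ / 2))) := by
  have hIntg := G.int hd hout
  let B : ↥(Finset.Ico j0 J ×ˢ KM d M) → ℝ := fun p =>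
    a (WithLp.toLp 2 (corner M p.1.1 p.1.2)) - lam - 2 * ω * sig ρ p.1.1 ^ 2
  let S : ↥(Finset.Ico j0 J ×ˢ KM d M) → Finset (Fin d → ℕ) :=
    fun p => SD d (TT (sideL M p.1.1) (1 + ω) (B p))
  have hp : ∀ p : ↥(Finset.Ico j0 J ×ˢ KM d M), j0 ≤ p.1.1 ∧ p.1.2 ∈ KM d M := fun p =>
    ⟨(Finset.mem_Ico.mp (Finset.mem_product.mp p.2).1).1, (Finset.mem_product.mp p.2).2⟩
  have hdis : Pairwise (Function.onFun Disjoint fun p : ↥(Finset.Ico j0 J ×ˢ KM d M) =>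
      (cell (corner M p.1.1 p.1.2) (sideL M p.1.1) : Set (Ed d))) := fun p q hpq =>
    cellI_disj (d := d) (j0 := j0) (J := J) hM (i := some p) (j := some q) (by simpa using hpq)
  obtain ⟨F, hF, hneg, hcount⟩ := lowerB (fun p : ↥(Finset.Ico j0 J ×ˢ KM d M) =>
      corner M p.1.1 p.1.2) (fun p => sideL M p.1.1) (fun p => sideL_pos hM _) hdis
    (fun x => lam - a x + Rm x) (by have := G.ca; have := G.cR; fun_prop) (1 + ω) B
    (by
      intro p x hx
      have h1 := abs_le.mp (G.osc _ (hp p).1 _ (hp p).2 x hx)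
      have h2 := (G.some_bd hM hρ hA hω _ (hp p).1 _ (hp p).2).2 x hx
      simp only [B]; linarith)
    S (fun p n h => SD_spec (sideL_pos hM _) (by linarith) n h)
  refine ⟨F, hF, hneg, ?_⟩
  have hcount' : (Module.finrank ℝ F : ℝ) = ∑ i, ((S i).card : ℝ) := by exact_mod_cast hcount
  have hcell : ∀ p : ↥(Finset.Ico j0 J ×ˢ KM d M),
      cd d * (∫ x in lcell M p.1.1 p.1.2, √(max (a x - lam) 0) ^ d) -
        cd d * ε * (sideL M p.1.1 ^ d * sig ρ p.1.1 ^ d) ≤ ((S p).card : ℝ) := by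
    intro p
    exact cell_lo hd (sideL_pos hM _) (sig_pos ρ _) hω hω1 hA hlam hana (G.hs _ (hp p).1) _ a _
      (G.osc _ (hp p).1 _ (hp p).2) (G.some_bd hM hρ hA hω _ (hp p).1 _ (hp p).2).1 hIntg
  have hsum := Finset.sum_le_sum (s := Finset.univ) fun p _ => hcell p
  rw [Finset.sum_sub_distrib, ← Finset.mul_sum, ← Finset.mul_sum] at hsum
  have hU : (∫ x, √(max (a x - lam) 0) ^ d) = ∑ i : Idx d M j0 J,
      (∫ x in cell (aI i) (lI i), √(max (a x - lam) 0) ^ d) := by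
    rw [← integral_iUnion_fintype (fun p => cell_meas _ _) (cellI_disj hM)
      (fun p => hIntg.integrableOn)]
    symm
    refine setIntegral_eq_integral_of_forall_compl_eq_zero ?_
    intro x hx
    rw [mem_iUnion, not_exists] at hx
    have := hout x (cellI_out hM x hx)
    have := G.R0 x
    rw [max_eq_right (by linarith), Real.sqrt_zero, zero_pow (by omega)]
  rw [Fintype.sum_option] at hU
  have hnone : (∫ x in cell (aI (none : Idx d M j0 J)) (lI (none : Idx d M j0 J)),
      √(max (a x - lam) 0) ^ d) ≤ (2 * 2 ^ j0) ^ d * √B0 ^ d := by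
    have e : (2 * 2 ^ j0) ^ d * √B0 ^ d =
        ∫ x in cell (aI (none : Idx d M j0 J)) (lI (none : Idx d M j0 J)), √B0 ^ d := by
      rw [setIntegral_const, cell_meas_real _ _ (lI_pos hM _), smul_eq_mul]; rfl
    rw [e]
    refine setIntegral_mono_on hIntg.integrableOn ?_ (cell_meas _ _) ?_
    · exact integrableOn_const (by rw [cell_vol _ _ (lI_pos hM _)]; exact ENNReal.ofReal_ne_top)
    · intro x hx
      gcongr ?_ ^ d
      refine Real.sqrt_le_sqrt (max_le ?_ hB00)
      have := hB0 x; have := G.R0 x; linarith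
  have hE := esum hd hM j0 J hρ2
  have h1 := mul_le_mul_of_nonneg_left hnone (cd_nonneg d)
  have h2 := mul_le_mul_of_nonneg_left hE (mul_nonneg (cd_nonneg d) hε)
  rw [hU, mul_add]
  have h3 : ∑ p : ↥(Finset.Ico j0 J ×ˢ KM d M),
      (∫ x in lcell M p.1.1 p.1.2, √(max (a x - lam) 0) ^ d) = ∑ p : ↥(Finset.Ico j0 J ×ˢ KM d M),
      ∫ x in cell (aI (some p : Idx d M j0 J)) (lI (some p : Idx d M j0 J)),
        √(max (a x - lam) 0) ^ d := rfl
  rw [h3] at hsum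
  linarith

/-! ### Part 11: verification of the assumptions -/

lemma SC_bounds {d : ℕ} {ρ : ℝ} {W : Ed d → ℝ} {C : ℝ} (hρ : 0 < ρ) (hC : 0 < C)
    (h : ∀ k : ℕ, k ≤ 2 → ∀ x : Ed d,
      ‖iteratedFDeriv ℝ k W x‖ ≤ C * (1 + ‖x‖) ^ (-ρ - (k : ℝ))) :
    (∀ x, |W x| ≤ C) ∧ (∀ x, ‖fderiv ℝ W x‖ ≤ C) ∧
    (∀ s : ℝ, 0 < s → ∀ x, s ≤ ‖x‖ → |W x| ≤ C * s ^ (-ρ)) ∧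
    (∀ s : ℝ, 0 < s → ∀ x, s ≤ ‖x‖ → ‖fderiv ℝ W x‖ ≤ C * s ^ (-ρ - 1)) := by
  have h0 : ∀ x, |W x| ≤ C * (1 + ‖x‖) ^ (-ρ) := by
    intro x
    have := h 0 (by norm_num) x
    rw [norm_iteratedFDeriv_zero] at this
    simpa using this
  have h1 : ∀ x, ‖fderiv ℝ W x‖ ≤ C * (1 + ‖x‖) ^ (-ρ - 1) := by
    intro x
    have := h 1 (by norm_num) x
    rw [norm_iteratedFDeriv_one] at this
    simpa using this
  refine ⟨fun x => (h0 x).trans ?_, fun x => (h1 x).trans ?_, fun s hs x hx => (h0 x).trans ?_,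
    fun s hs x hx => (h1 x).trans ?_⟩
  · have : (1 + ‖x‖) ^ (-ρ) ≤ 1 :=
      Real.rpow_le_one_of_one_le_of_nonpos (by linarith [norm_nonneg x]) (by linarith)
    nlinarith
  · have : (1 + ‖x‖) ^ (-ρ - 1) ≤ 1 :=
      Real.rpow_le_one_of_one_le_of_nonpos (by linarith [norm_nonneg x]) (by linarith)
    nlinarith
  · have := Real.rpow_le_rpow_of_nonpos hs (by linarith : s ≤ 1 + ‖x‖) (by linarith : -ρ ≤ 0)
    gcongr
  · have := Real.rpow_le_rpow_of_nonpos hs (by linarith : s ≤ 1 + ‖x‖) (by linarith : -ρ - 1 ≤ 0)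
    gcongr

lemma good_exists {d : ℕ} {ρ : ℝ} {W : Ed d → ℝ} {C η₀ M1 ω : ℝ} (hρ : 0 < ρ) (hρ2 : ρ < 2)
    (hC : 0 < C) (hW : ContDiff ℝ 2 W)
    (h : ∀ k : ℕ, k ≤ 2 → ∀ x : Ed d,
      ‖iteratedFDeriv ℝ k W x‖ ≤ C * (1 + ‖x‖) ^ (-ρ - (k : ℝ)))
    (hη₀ : 0 < η₀) (hM1 : 0 ≤ M1) (hω : 0 < ω) :
    ∃ M j0 : ℕ, 0 < M ∧ Good d M j0 ρ ω (η₀ * C) (fun x => -(η₀ * W x)) (Rem W M1 ω) := by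
  obtain ⟨-, -, hW0, hW1⟩ := SC_bounds hρ hC h
  obtain ⟨M, hMM⟩ := exists_nat_gt (η₀ * C * √d / ω)
  have hM' : (0:ℝ) < M := lt_of_le_of_lt (by positivity) hMM
  have hM : 0 < M := by exact_mod_cast hM'
  have ht1 : ∀ᶠ s : ℝ in atTop, M1 * C * s ^ (-1:ℝ) + ω⁻¹ * M1 ^ 2 * C ^ 2 * s ^ (-ρ) < ω := by
    have a1 := (tendsto_rpow_neg_atTop (zero_lt_one' ℝ)).const_mul (M1 * C)
    have a2 := (tendsto_rpow_neg_atTop hρ).const_mul (ω⁻¹ * M1 ^ 2 * C ^ 2)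
    have a3 := a1.add a2
    simp only [mul_zero, add_zero] at a3
    exact a3.eventually_lt_const hω
  have ht2 : ∀ᶠ s : ℝ in atTop, √d * M * π / ω ≤ s ^ (1 - ρ / 2) :=
    (tendsto_rpow_atTop (by linarith : 0 < 1 - ρ / 2)).eventually_ge_atTop _
  obtain ⟨s0, hs0⟩ := eventually_atTop.mp (ht1.and ht2)
  obtain ⟨j0, hj0⟩ := pow_unbounded_of_one_lt s0 (by norm_num : (1:ℝ) < 2)
  refine ⟨M, j0, hM, ?_⟩
  have hcW : Continuous W := hW.continuous
  refine ⟨by fun_prop, Rem_cont hW M1 ω, ?_, ?_, ?_, ?_, ?_⟩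
  · intro j hj k hk x hx
    have hcc := cell_corner_mem (corner M j k) (sideL M j) (sideL_pos hM j)
    have hp : (0:ℝ) < 2 ^ j := by positivity
    have hdiff : Differentiable ℝ W := hW.differentiable (by norm_num)
    have key := Convex.norm_image_sub_le_of_norm_fderiv_le (𝕜 := ℝ) (f := W)
      (s := lcell M j k) (C := C * ((2:ℝ) ^ j) ^ (-ρ - 1)) (fun y _ => hdiff y)
      (fun y hy => hW1 _ hp y (lcell_norm hM j k hk y hy)) (cell_convex _ _) hcc hx
    have hdm := cell_diam (corner M j k) (sideL M j) x hx
    rw [Real.norm_eq_abs] at key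
    have e : -(η₀ * W x) - -(η₀ * W (WithLp.toLp 2 (corner M j k))) =
      -η₀ * (W x - W (WithLp.toLp 2 (corner M j k))) := by ring
    rw [e, abs_mul, abs_neg, abs_of_pos hη₀, sig_sq]
    have e2 : ((2:ℝ) ^ j) ^ (-ρ) = ((2:ℝ) ^ j) ^ (-ρ - 1) * 2 ^ j := by
      rw [← Real.rpow_add_one hp.ne']; congr 1; ring
    have hk2 : η₀ * C * √d / M ≤ ω := by
      rw [div_le_iff₀ hM']; rw [div_lt_iff₀ hω] at hMM; linarith
    calc _ ≤ η₀ * (C * ((2:ℝ) ^ j) ^ (-ρ - 1) * (√d * sideL M j)) := by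
          gcongr
          refine key.trans ?_
          gcongr
      _ = (η₀ * C * √d / M) * (((2:ℝ) ^ j) ^ (-ρ - 1) * 2 ^ j) := by
          unfold sideL; field_simp
      _ ≤ _ := by rw [e2]; gcongr
  · intro x; unfold Rem; positivity
  · intro x hx
    have hp : (0:ℝ) < ‖x‖ := lt_of_lt_of_le (by positivity) hx
    have hb := (hs0 ‖x‖ (by linarith)).1
    have w0 := hW0 _ hp x le_rfl
    have w1 := hW1 _ hp x le_rfl
    have hsq : W x ^ 2 ≤ (C * ‖x‖ ^ (-ρ)) ^ 2 := by
      rw [← sq_abs]; exact pow_le_pow_left₀ (abs_nonneg _) w0 2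
    have e2 : ‖x‖ ^ (-ρ - 1) = ‖x‖ ^ (-ρ) * ‖x‖ ^ (-1:ℝ) := by
      rw [← Real.rpow_add hp]; congr 1
    unfold Rem
    calc _ ≤ M1 * (C * ‖x‖ ^ (-ρ - 1)) + ω⁻¹ * M1 ^ 2 * (C * ‖x‖ ^ (-ρ)) ^ 2 := by gcongr
      _ = (M1 * C * ‖x‖ ^ (-1:ℝ) + ω⁻¹ * M1 ^ 2 * C ^ 2 * ‖x‖ ^ (-ρ)) * ‖x‖ ^ (-ρ) := by
          rw [e2]; ring
      _ ≤ _ := by gcongr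
  · intro x hx
    have hp : (0:ℝ) < ‖x‖ := lt_of_lt_of_le (by positivity) hx
    have w0 := neg_le_of_abs_le (hW0 _ hp x le_rfl)
    calc -(η₀ * W x) = η₀ * (- W x) := by ring
      _ ≤ η₀ * (C * ‖x‖ ^ (-ρ)) := by gcongr; linarith
      _ = _ := by ring
  · intro j hj
    have hp : (0:ℝ) < 2 ^ j := by positivity
    have h2 : ((2:ℝ)) ^ j0 ≤ 2 ^ j := pow_le_pow_right₀ (by norm_num) hj
    have hb := (hs0 (2 ^ j) (by linarith)).2
    have e : sideL M j * sig ρ j = ((2:ℝ) ^ j) ^ (1 - ρ / 2) / M := by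
      unfold sideL sig
      rw [show (1 - ρ / 2) = 1 + (-ρ / 2) by ring, Real.rpow_add hp, Real.rpow_one]; ring
    rw [e]
    have hpi := Real.pi_pos
    rw [div_le_iff₀ hω] at hb
    have : ω * (((2:ℝ) ^ j) ^ (1 - ρ / 2) / M / π) = (((2:ℝ) ^ j) ^ (1 - ρ / 2) * ω) / (M * π) := by
      field_simp
    rw [this, le_div_iff₀ (by positivity)]
    linarith

section forms
variable {d : ℕ} {W φ η : Ed d → ℝ} {η₀ M1 ω : ℝ}

lemma form_split (hW : ContDiff ℝ 2 W) (hφ : ContDiff ℝ 2 φ)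
    (hη : ∀ x, lap d φ x = η x - η₀) (lam : ℝ) {u : Ed d → ℝ}
    (hu : ContDiff ℝ (⊤ : ℕ∞) u) (hc : HasCompactSupport u) :
    (∫ x, (‖gradient u x‖ ^ 2 + η x * W x * u x ^ 2)) + lam * ∫ x, u x ^ 2 =
      (∫ x, ‖gradient u x‖ ^ 2) + (∫ x, lap d φ x * W x * u x ^ 2) +
        ∫ x, (lam + η₀ * W x) * u x ^ 2 := by
  have hcW : Continuous W := hW.continuous
  have hcl := lap_cont hφ
  have i1 := cs_grad_int hu hc
  have i2 := cs_int hu hc (v := fun x => lap d φ x * W x) (by fun_prop)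
  have i3 := cs_int hu hc (v := fun x => lam + η₀ * W x) (by fun_prop)
  have i4 := cs_int hu hc (v := fun x => η₀ * W x) (by fun_prop)
  have i5 := cs_int hu hc (v := fun _ => lam) (by fun_prop)
  have e : (fun x => ‖gradient u x‖ ^ 2 + η x * W x * u x ^ 2) = fun x =>
      ‖gradient u x‖ ^ 2 + (lap d φ x * W x * u x ^ 2 + η₀ * W x * u x ^ 2) := by
    funext x
    have : η x = lap d φ x + η₀ := by rw [hη x]; ring
    rw [this]; ring
  have e3 : (∫ x, (lam + η₀ * W x) * u x ^ 2) =
      lam * (∫ x, u x ^ 2) + ∫ x, η₀ * W x * u x ^ 2 := by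
    rw [← integral_const_mul, ← integral_add i5 i4]
    congr 1; funext x; ring
  have i24 : Integrable (fun x => lap d φ x * W x * u x ^ 2 + η₀ * W x * u x ^ 2) := i2.add i4
  rw [e, integral_add i1 i24, integral_add i2 i4, e3]
  ring

lemma form_up (hW : ContDiff ℝ 2 W) (hφ : ContDiff ℝ 2 φ)
    (hη : ∀ x, lap d φ x = η x - η₀) (hM : ∀ x, ‖fderiv ℝ φ x‖ ≤ M1) (hω : 0 < ω) (lam : ℝ)
    {u : Ed d → ℝ} (hu : ContDiff ℝ (⊤ : ℕ∞) u) (hc : HasCompactSupport u)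
    (h : (∫ x, (‖gradient u x‖ ^ 2 + η x * W x * u x ^ 2)) < -lam * ∫ x, u x ^ 2) :
    (1 - ω) * (∫ x, ‖gradient u x‖ ^ 2) +
      ∫ x, (lam - (-(η₀ * W x)) - Rem W M1 ω x) * u x ^ 2 < 0 := by
  have hcW : Continuous W := hW.continuous
  have h1 := form_split hW hφ hη lam hu hc
  have h2 := abs_le.mp (form_compare hW hφ M1 ω hω hM hu hc)
  have hRc := Rem_cont hW M1 ω
  have i3 := cs_int hu hc (v := fun x => lam + η₀ * W x) (by fun_prop)
  have i4 := cs_int hu hc (v := Rem W M1 ω) hRc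
  have e : (∫ x, (lam - (-(η₀ * W x)) - Rem W M1 ω x) * u x ^ 2) =
      (∫ x, (lam + η₀ * W x) * u x ^ 2) - ∫ x, Rem W M1 ω x * u x ^ 2 := by
    rw [← integral_sub i3 i4]; congr 1; funext x; ring
  rw [e]
  linarith

lemma form_lo (hW : ContDiff ℝ 2 W) (hφ : ContDiff ℝ 2 φ)
    (hη : ∀ x, lap d φ x = η x - η₀) (hM : ∀ x, ‖fderiv ℝ φ x‖ ≤ M1) (hω : 0 < ω) (lam : ℝ)
    {u : Ed d → ℝ} (hu : ContDiff ℝ (⊤ : ℕ∞) u) (hc : HasCompactSupport u)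
    (h : (1 + ω) * (∫ x, ‖gradient u x‖ ^ 2) +
      ∫ x, (lam - (-(η₀ * W x)) + Rem W M1 ω x) * u x ^ 2 < 0) :
    (∫ x, (‖gradient u x‖ ^ 2 + η x * W x * u x ^ 2)) < -lam * ∫ x, u x ^ 2 := by
  have hcW : Continuous W := hW.continuous
  have h1 := form_split hW hφ hη lam hu hc
  have h2 := abs_le.mp (form_compare hW hφ M1 ω hω hM hu hc)
  have hRc := Rem_cont hW M1 ω
  have i3 := cs_int hu hc (v := fun x => lam + η₀ * W x) (by fun_prop)
  have i4 := cs_int hu hc (v := Rem W M1 ω) hRc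
  have e : (∫ x, (lam - (-(η₀ * W x)) + Rem W M1 ω x) * u x ^ 2) =
      (∫ x, (lam + η₀ * W x) * u x ^ 2) + ∫ x, Rem W M1 ω x * u x ^ 2 := by
    rw [← integral_add i3 i4]; congr 1; funext x; ring
  rw [e] at h
  linarith

end forms

lemma Ncl_eq (d : ℕ) (W : Ed d → ℝ) (η₀ lam : ℝ) :
    Ncl d (fun x => η₀ * W x) (-lam) = cd d * ∫ x, √(max (-(η₀ * W x) - lam) 0) ^ d := by
  unfold Ncl cd
  congr 2
  funext x
  rw [rpow_half d (le_max_right _ _)]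
  congr 3; ring

/-! ### Part 12: the asymptotics -/

lemma int_up {d M j0 J : ℕ} (hd : 1 ≤ d) {ρ ω A lam B0 : ℝ} {a Rm : Ed d → ℝ} (hM : 0 < M)
    (hρ : 0 < ρ) (hρ2 : ρ < 2) (hA : 0 ≤ A) (hlam : 0 ≤ lam) (hB00 : 0 ≤ B0)
    (G : Good d M j0 ρ ω A a Rm)
    (hB0 : ∀ x, a x + Rm x ≤ B0)
    (hout : ∀ x, 2 ^ J ≤ ‖x‖ → a x + Rm x ≤ lam) :
    (∫ x, √(max (a x - lam) 0) ^ d) ≤ (2 * 2 ^ j0) ^ d * √B0 ^ d +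
      √A ^ d * (4 ^ d / ((2:ℝ) ^ ((d:ℝ) * (1 - ρ / 2)) - 1) *
        ((2:ℝ) ^ J) ^ ((d:ℝ) * (1 - ρ / 2))) := by
  have hIntg := G.int hd hout
  have hp : ∀ p : ↥(Finset.Ico j0 J ×ˢ KM d M), j0 ≤ p.1.1 ∧ p.1.2 ∈ KM d M := fun p =>
    ⟨(Finset.mem_Ico.mp (Finset.mem_product.mp p.2).1).1, (Finset.mem_product.mp p.2).2⟩
  have hU : (∫ x, √(max (a x - lam) 0) ^ d) = ∑ i : Idx d M j0 J,
      (∫ x in cell (aI i) (lI i), √(max (a x - lam) 0) ^ d) := by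
    rw [← integral_iUnion_fintype (fun p => cell_meas _ _) (cellI_disj hM)
      (fun p => hIntg.integrableOn)]
    symm
    refine setIntegral_eq_integral_of_forall_compl_eq_zero ?_
    intro x hx
    rw [mem_iUnion, not_exists] at hx
    have := hout x (cellI_out hM x hx)
    have := G.R0 x
    rw [max_eq_right (by linarith), Real.sqrt_zero, zero_pow (by omega)]
  rw [Fintype.sum_option] at hU
  have hgen : ∀ (c : Fin d → ℝ) (l b : ℝ), 0 < l → 0 ≤ b → (∀ x ∈ cell c l, a x ≤ b) →
      (∫ x in cell c l, √(max (a x - lam) 0) ^ d) ≤ l ^ d * √b ^ d := by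
    intro c l b hl hb hbx
    have e : l ^ d * √b ^ d = ∫ x in cell c l, √b ^ d := by
      rw [setIntegral_const, cell_meas_real _ _ hl, smul_eq_mul]
    rw [e]
    refine setIntegral_mono_on hIntg.integrableOn ?_ (cell_meas _ _) ?_
    · exact integrableOn_const (by rw [cell_vol _ _ hl]; exact ENNReal.ofReal_ne_top)
    · intro x hx
      gcongr ?_ ^ d
      refine Real.sqrt_le_sqrt (max_le ?_ hb)
      have := hbx x hx; linarith
  have hnone : (∫ x in cell (aI (none : Idx d M j0 J)) (lI (none : Idx d M j0 J)),
      √(max (a x - lam) 0) ^ d) ≤ (2 * 2 ^ j0) ^ d * √B0 ^ d :=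
    hgen _ _ B0 (lI_pos hM _) hB00 (fun x _ => by have := hB0 x; have := G.R0 x; linarith)
  have hsome : ∀ p : ↥(Finset.Ico j0 J ×ˢ KM d M),
      (∫ x in cell (aI (some p : Idx d M j0 J)) (lI (some p : Idx d M j0 J)),
      √(max (a x - lam) 0) ^ d) ≤ √A ^ d * (sideL M p.1.1 ^ d * sig ρ p.1.1 ^ d) := by
    intro p
    have hσ := sig_pos ρ p.1.1
    have h2 : ((2:ℝ)) ^ j0 ≤ 2 ^ p.1.1 := pow_le_pow_right₀ (by norm_num) (hp p).1
    refine (hgen _ _ (A * sig ρ p.1.1 ^ 2) (lI_pos hM _) (by positivity) ?_).trans (le_of_eq ?_)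
    · intro x hx
      have hn := lcell_norm hM _ _ (hp p).2 x hx
      refine (G.hA _ (h2.trans hn)).trans ?_
      have := rpow_anti (by positivity) hn hρ
      rw [sig_sq]
      gcongr
    · rw [Real.sqrt_mul hA, Real.sqrt_sq hσ.le, mul_pow]
      simp only [lI]; ring
  have hs := Finset.sum_le_sum (s := Finset.univ) fun p _ => hsome p
  rw [← Finset.mul_sum] at hs
  have hE := mul_le_mul_of_nonneg_left (esum hd hM j0 J hρ2) (by positivity : 0 ≤ √A ^ d)
  rw [hU]
  linarith

section main
variable {d : ℕ} {ρ : ℝ} {W φ η : Ed d → ℝ} {C η₀ M1 : ℝ}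

/-- Everything up to a fixed constant and `ε` times the expected order. -/
lemma core (hd : 1 ≤ d) (hρ : 0 < ρ) (hρ2 : ρ < 2)
    (hC : 0 < C) (hW : ContDiff ℝ 2 W)
    (h : ∀ k : ℕ, k ≤ 2 → ∀ x : Ed d,
      ‖iteratedFDeriv ℝ k W x‖ ≤ C * (1 + ‖x‖) ^ (-ρ - (k : ℝ)))
    (hη₀ : 0 < η₀) (hφ : ContDiff ℝ 2 φ)
    (hη : ∀ x, lap d φ x = η x - η₀) (hM1 : ∀ x, ‖fderiv ℝ φ x‖ ≤ M1) :
    ∃ Cst : ℝ, 0 < Cst ∧ ∀ ε : ℝ, 0 < ε → ∃ K : ℝ, ∀ᶠ lam in 𝓝[>] (0:ℝ),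
      schN d (fun x => η x * W x) (-lam) ≠ ⊤ ∧
      |((schN d (fun x => η x * W x) (-lam)).toNat : ℝ) - Ncl d (fun x => η₀ * W x) (-lam)| ≤
        K + ε * (Cst * lam ^ ((d : ℝ) * (1 / 2 - 1 / ρ))) ∧
      Ncl d (fun x => η₀ * W x) (-lam) ≤ K + Cst * lam ^ ((d : ℝ) * (1 / 2 - 1 / ρ)) := by
  have hM10 : 0 ≤ M1 := (norm_nonneg _).trans (hM1 0)
  obtain ⟨hb0, hb1, -, -⟩ := SC_bounds hρ hC h
  set A : ℝ := η₀ * C with hAdef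
  have hA : 0 < A := by positivity
  set β : ℝ := (d:ℝ) * (1 - ρ / 2) with hβ
  have hd' : (1:ℝ) ≤ d := by exact_mod_cast hd
  have hβ0 : 0 < β := mul_pos (by linarith) (by linarith)
  have hq : 0 < (2:ℝ) ^ β - 1 := by
    have := Real.one_lt_rpow (by norm_num : (1:ℝ) < 2) hβ0; linarith
  set D : ℝ := 4 ^ d / ((2:ℝ) ^ β - 1) * (2 ^ β * (A + 1) ^ (β / ρ)) with hD
  have hD0 : 0 < D := by positivity
  have hcd := cd_nonneg d
  refine ⟨cd d * D * (1 + √A ^ d) + 1, by positivity, ?_⟩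
  intro ε hε
  have hev : ∀ᶠ ω in 𝓝[>] (0:ℝ), 0 < ω ∧ ω < 1 ∧
      (∀ t ∈ Icc 0 A, (√((t + 3 * ω) / (1 - ω)) + ω) ^ d ≤ √t ^ d + ε) ∧
      (∀ t ∈ Icc 0 (A + 1), √t ^ d - ε ≤ (max (√(max (t - 3 * ω) 0 / (1 + ω)) - ω) 0) ^ d) := by
    have h1 := (ana_up d A ε hε).filter_mono (nhdsWithin_le_nhds (s := Ioi 0))
    have h2 := (ana_lo d (A + 1) ε hε).filter_mono (nhdsWithin_le_nhds (s := Ioi 0))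
    have h3 : ∀ᶠ ω in 𝓝[>] (0:ℝ), ω ∈ Ioo (0:ℝ) 1 := Ioo_mem_nhdsGT (by norm_num)
    filter_upwards [h1, h2, h3] with ω a1 a2 a3
    exact ⟨a3.1, a3.2, a1, a2⟩
  obtain ⟨ω, hω, hω1, hup, hlo⟩ := hev.exists
  obtain ⟨M, j0, hM, G⟩ := good_exists hρ hρ2 hC hW h hη₀ hM10 hω
  set a : Ed d → ℝ := fun x => -(η₀ * W x) with ha
  set Rm := Rem W M1 ω with hRm
  set B0 : ℝ := η₀ * C + (M1 * C + ω⁻¹ * M1 ^ 2 * C ^ 2) with hB0def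
  have hB00 : 0 ≤ B0 := by positivity
  have hB0 : ∀ x, a x + Rm x ≤ B0 := by
    intro x
    have h1 := neg_le_of_abs_le (hb0 x)
    have h2 : a x ≤ η₀ * C := by
      calc a x = η₀ * (-W x) := by simp only [ha]; ring
        _ ≤ _ := by gcongr; linarith
    have h3 : W x ^ 2 ≤ C ^ 2 := by
      rw [← sq_abs]; exact pow_le_pow_left₀ (abs_nonneg _) (hb0 x) 2
    have h4 : Rm x ≤ M1 * C + ω⁻¹ * M1 ^ 2 * C ^ 2 := by
      simp only [hRm, Rem]
      have := hb1 x
      gcongr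
    linarith
  set K1 : ℝ := ((SN d (TT (2 * 2 ^ j0) (1 - ω) B0)).card : ℝ) with hK1
  have hK10 : 0 ≤ K1 := by positivity
  set K2 : ℝ := cd d * ((2 * 2 ^ j0) ^ d * √B0 ^ d) with hK2
  have hK20 : 0 ≤ K2 := by positivity
  refine ⟨K1 + K2, ?_⟩
  have hX : Tendsto (fun lam : ℝ => ((A + 1) / lam) ^ (1 / ρ)) (𝓝[>] 0) atTop := by
    refine (tendsto_rpow_atTop (by positivity : 0 < 1 / ρ)).comp ?_
    exact tendsto_inv_nhdsGT_zero.const_mul_atTop (by positivity : 0 < A + 1)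
  filter_upwards [hX.eventually_ge_atTop (max 1 (2 ^ j0)), self_mem_nhdsWithin] with lam hlX hlam
  have hlam0 : 0 < lam := hlam
  set X : ℝ := ((A + 1) / lam) ^ (1 / ρ) with hXdef
  have hX1 : 1 ≤ X := (le_max_left _ _).trans hlX
  have hXj : 2 ^ j0 ≤ X := (le_max_right _ _).trans hlX
  have hX0 : 0 < X := by linarith
  obtain ⟨n, hn1, hn2⟩ := exists_nat_pow_near hX1 (by norm_num : (1:ℝ) < 2)
  set J := n + 1 with hJ
  have hJX : (2:ℝ) ^ J ≤ 2 * X := by rw [hJ, pow_succ]; linarith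
  have hXρ : X ^ (-ρ) = lam / (A + 1) := by
    rw [hXdef, ← Real.rpow_mul (by positivity), show 1 / ρ * -ρ = -1 by field_simp,
      Real.rpow_neg_one, inv_div]
  have hout : ∀ x, 2 ^ J ≤ ‖x‖ → a x + Rm x ≤ lam := by
    intro x hx
    have hxX : X ≤ ‖x‖ := hn2.le.trans hx
    have h1 := G.hA x (hXj.trans hxX)
    have h2 := G.hR x (hXj.trans hxX)
    have h3 := rpow_anti hX0 hxX hρ
    rw [hXρ] at h3
    have hp : 0 ≤ ‖x‖ ^ (-ρ) := by positivity
    calc a x + Rm x ≤ A * ‖x‖ ^ (-ρ) + ω * ‖x‖ ^ (-ρ) := add_le_add h1 h2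
      _ = (A + ω) * ‖x‖ ^ (-ρ) := by ring
      _ ≤ (A + 1) * (lam / (A + 1)) := by gcongr
      _ = lam := by field_simp
  set r : ℝ := lam ^ ((d : ℝ) * (1 / 2 - 1 / ρ)) with hr
  have hr0 : 0 < r := by positivity
  have hE : 4 ^ d / ((2:ℝ) ^ β - 1) * ((2:ℝ) ^ J) ^ β ≤ D * r := by
    have h1 : ((2:ℝ) ^ J) ^ β ≤ (2 * X) ^ β :=
      Real.rpow_le_rpow (by positivity) hJX hβ0.le
    have h2 : (2 * X) ^ β = 2 ^ β * (A + 1) ^ (β / ρ) * r := by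
      rw [Real.mul_rpow (by norm_num) hX0.le, hXdef, ← Real.rpow_mul (by positivity),
        Real.div_rpow (by positivity) hlam0.le, hr,
        show (d : ℝ) * (1 / 2 - 1 / ρ) = -(1 / ρ * β) by rw [hβ]; field_simp; ring,
        Real.rpow_neg hlam0.le, show 1 / ρ * β = β / ρ by ring]
      ring
    rw [h2] at h1
    calc _ ≤ 4 ^ d / ((2:ℝ) ^ β - 1) * (2 ^ β * (A + 1) ^ (β / ρ) * r) := by gcongr
      _ = D * r := by rw [hD]; ring
  have hNcl := Ncl_eq d W η₀ lam
  set I : ℝ := ∫ x, √(max (a x - lam) 0) ^ d with hI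
  have hI' : Ncl d (fun x => η₀ * W x) (-lam) = cd d * I := hNcl
  rw [hI']
  have hE2 := mul_le_mul_of_nonneg_left hE (by positivity : 0 ≤ cd d * ε)
  have hU : ∀ F : {F : Submodule ℝ (Ed d → ℝ) //
      (∀ u ∈ F, ContDiff ℝ (⊤ : ℕ∞) u ∧ HasCompactSupport u) ∧
      (∀ u ∈ F, u ≠ 0 →
        (∫ x, (‖gradient u x‖ ^ 2 + (fun x => η x * W x) x * u x ^ 2)) < -lam * ∫ x, u x ^ 2)},
      (Module.finrank ℝ F.1 : ℝ) ≤ K1 + cd d * I + cd d * ε * (D * r) := by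
    intro F
    have := upper_sum (J := J) hd hM hρ hρ2 hA.le hω hω1 hε.le hlam0.le hup G hB0 hout F.1 F.2.1
      (fun u hu hu0 => form_up hW hφ hη hM1 hω lam (F.2.1 u hu).1 (F.2.1 u hu).2 (F.2.2 u hu hu0))
    linarith
  set N := schN d (fun x => η x * W x) (-lam) with hN
  have hNle : N ≤ ((⌊K1 + cd d * I + cd d * ε * (D * r)⌋₊ : ℕ) : ℕ∞) := by
    rw [hN]; unfold schN
    refine iSup_le fun F => ?_
    exact_mod_cast Nat.le_floor (hU F)
  have hNtop : N ≠ ⊤ := ne_top_of_le_ne_top (ENat.coe_ne_top _) hNle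
  have hI0 : 0 ≤ I := integral_nonneg fun x => by positivity
  have hN1 : (N.toNat : ℝ) ≤ K1 + cd d * I + cd d * ε * (D * r) := by
    have h1 : N.toNat ≤ ⌊K1 + cd d * I + cd d * ε * (D * r)⌋₊ := by
      have := ENat.toNat_le_toNat hNle (ENat.coe_ne_top _)
      simpa using this
    exact (Nat.cast_le.mpr h1).trans (Nat.floor_le (by positivity))
  obtain ⟨F, hF1, hF2, hF3⟩ := lower_sum (J := J) hd hM hρ hρ2 hA.le hω hω1 hε.le hlam0.le hB00 hlo
    G hB0 hout
  have hFN : (Module.finrank ℝ F : ℕ∞) ≤ N := by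
    rw [hN]; unfold schN
    exact le_iSup (fun F : {F : Submodule ℝ (Ed d → ℝ) //
      (∀ u ∈ F, ContDiff ℝ (⊤ : ℕ∞) u ∧ HasCompactSupport u) ∧
      (∀ u ∈ F, u ≠ 0 →
        (∫ x, (‖gradient u x‖ ^ 2 + (fun x => η x * W x) x * u x ^ 2)) < -lam * ∫ x, u x ^ 2)} =>
        (Module.finrank ℝ F.1 : ℕ∞))
      ⟨F, hF1, fun u hu hu0 => form_lo hW hφ hη hM1 hω lam (hF1 u hu).1 (hF1 u hu).2
        (hF2 u hu hu0)⟩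
  have hFN' : (Module.finrank ℝ F : ℝ) ≤ (N.toNat : ℝ) := by
    have := ENat.toNat_le_toNat hFN hNtop
    rw [ENat.toNat_coe] at this
    exact_mod_cast this
  have hIup := int_up (J := J) hd hM hρ hρ2 hA.le hlam0.le hB00 G hB0 hout
  have hIup2 : cd d * I ≤ K2 + cd d * (√A ^ d * (D * r)) := by
    have h1 := mul_le_mul_of_nonneg_left hE (by positivity : 0 ≤ √A ^ d)
    have h2 := mul_le_mul_of_nonneg_left (hIup.trans (add_le_add le_rfl h1)) hcd
    rw [hK2]; linarith
  have hp1 : 0 ≤ cd d * D * r := by positivity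
  have hp2 : 0 ≤ cd d * D * √A ^ d * r := by positivity
  have hp3 : 0 ≤ ε * (cd d * D * √A ^ d * r) := by positivity
  have hp4 : 0 ≤ ε * r := by positivity
  refine ⟨hNtop, abs_le.mpr ⟨?_, ?_⟩, ?_⟩
  · have : cd d * I ≤ (N.toNat : ℝ) + K2 + cd d * ε * (D * r) := by
      refine hF3.trans ?_
      linarith
    linarith
  · linarith
  · linarith

lemma tau_pos (d : ℕ) : 0 < tau d := by
  unfold tau
  exact ENNReal.toReal_pos (Metric.measure_ball_pos _ _ one_pos).ne' measure_ball_lt_top.ne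

lemma Ncl_lower (hd : 1 ≤ d) (hρ : 0 < ρ) {C' R : ℝ} (hC' : 0 < C') (hR : 0 < R)
    (hW : Continuous W)
    (hWneg : ∀ x : Ed d, R ≤ ‖x‖ → W x ≤ -C' * ‖x‖ ^ (-ρ)) (hη₀ : 0 < η₀)
    (hIntg : ∀ lam, 0 < lam → Integrable (fun x => √(max (-(η₀ * W x) - lam) 0) ^ d)) :
    ∃ c : ℝ, 0 < c ∧ ∀ᶠ lam in 𝓝[>] (0:ℝ),
      c * lam ^ ((d : ℝ) * (1 / 2 - 1 / ρ)) ≤ Ncl d (fun x => η₀ * W x) (-lam) := by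
  have hcd : 0 < cd d := div_pos (tau_pos d) (by positivity)
  have htau := tau_pos d
  have hd' : (1:ℝ) ≤ d := by exact_mod_cast hd
  set A : ℝ := η₀ * C' / 2 with hA
  have hA0 : 0 < A := by positivity
  refine ⟨cd d * (tau d / 2) * A ^ ((d:ℝ) / ρ), by positivity, ?_⟩
  have hX : Tendsto (fun lam : ℝ => (A / lam) ^ (1 / ρ)) (𝓝[>] 0) atTop := by
    refine (tendsto_rpow_atTop (by positivity : 0 < 1 / ρ)).comp ?_
    exact tendsto_inv_nhdsGT_zero.const_mul_atTop hA0
  filter_upwards [hX.eventually_ge_atTop (2 * R), self_mem_nhdsWithin] with lam hlX hlam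
  have hlam0 : 0 < lam := hlam
  set T : ℝ := (A / lam) ^ (1 / ρ) with hT
  have hT0 : 0 < T := by linarith
  have hRT : R ^ d ≤ T ^ d / 2 := by
    have h1 : R ≤ T / 2 := by linarith
    calc R ^ d ≤ (T / 2) ^ d := pow_le_pow_left₀ hR.le h1 d
      _ = T ^ d / 2 ^ d := div_pow _ _ _
      _ ≤ _ := by
        have : (2:ℝ) ≤ 2 ^ d := by
          calc (2:ℝ) = 2 ^ 1 := by norm_num
            _ ≤ 2 ^ d := pow_le_pow_right₀ (by norm_num) hd
        gcongr
  have hTρ : T ^ (-ρ) = lam / A := by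
    rw [hT, ← Real.rpow_mul (by positivity), show 1 / ρ * -ρ = -1 by field_simp,
      Real.rpow_neg_one, inv_div]
  rw [Ncl_eq]
  set s : Set (Ed d) := Metric.ball 0 T \ Metric.ball 0 R with hs
  have hsm : MeasurableSet s := measurableSet_ball.diff measurableSet_ball
  have hvol : T ^ d / 2 * tau d ≤ (volume : Measure (Ed d)).real s := by
    have h1 : (volume : Measure (Ed d)).real (Metric.ball 0 T) = T ^ d * tau d := by
      rw [Measure.real, ball_vol T hT0.le hd, ENNReal.toReal_ofReal (by positivity)]
    have h2 : (volume : Measure (Ed d)).real (Metric.ball 0 R) = R ^ d * tau d := by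
      rw [Measure.real, ball_vol R hR.le hd, ENNReal.toReal_ofReal (by positivity)]
    rw [hs, measureReal_diff (Metric.ball_subset_ball (by linarith)) measurableSet_ball
      measure_ball_lt_top.ne, h1, h2]
    nlinarith
  have hI : √lam ^ d * (T ^ d / 2 * tau d) ≤ ∫ x, √(max (-(η₀ * W x) - lam) 0) ^ d := by
    calc _ ≤ √lam ^ d * (volume : Measure (Ed d)).real s := by gcongr
      _ = ∫ x in s, √lam ^ d := by rw [setIntegral_const, smul_eq_mul, mul_comm]
      _ ≤ ∫ x in s, √(max (-(η₀ * W x) - lam) 0) ^ d := by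
          refine setIntegral_mono_on ?_ (hIntg lam hlam0).integrableOn hsm ?_
          · exact integrableOn_const
              ((measure_mono sdiff_subset).trans_lt measure_ball_lt_top).ne
          · intro x hx
            rw [hs, mem_diff, mem_ball_zero_iff, mem_ball_zero_iff, not_lt] at hx
            have h1 := hWneg x hx.2
            have h2 := rpow_anti (by linarith [hx.2]) hx.1.le hρ
            rw [hTρ] at h2
            have h3 : 2 * lam ≤ -(η₀ * W x) := by
              calc 2 * lam = η₀ * C' * (lam / A) := by rw [hA]; field_simp
                _ ≤ η₀ * C' * ‖x‖ ^ (-ρ) := by gcongr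
                _ = η₀ * (C' * ‖x‖ ^ (-ρ)) := by ring
                _ ≤ η₀ * (- W x) := by gcongr; linarith
                _ = _ := by ring
            gcongr ?_ ^ d
            refine Real.sqrt_le_sqrt (le_trans ?_ (le_max_left _ _))
            linarith
      _ ≤ _ := setIntegral_le_integral (hIntg lam hlam0)
          (Filter.Eventually.of_forall fun x => by positivity)
  have e : √lam ^ d * T ^ d = A ^ ((d:ℝ) / ρ) * lam ^ ((d : ℝ) * (1 / 2 - 1 / ρ)) := by
    rw [← rpow_half d hlam0.le, hT, ← Real.rpow_natCast ((A / lam) ^ (1 / ρ)) d,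
      ← Real.rpow_mul (by positivity), Real.div_rpow hA0.le hlam0.le,
      show (d : ℝ) * (1 / 2 - 1 / ρ) = (d:ℝ) / 2 - 1 / ρ * d by ring, Real.rpow_sub hlam0,
      show 1 / ρ * (d:ℝ) = d / ρ by ring]
    ring
  calc _ = cd d * ((A ^ ((d:ℝ) / ρ) * lam ^ ((d : ℝ) * (1 / 2 - 1 / ρ))) / 2 * tau d) := by ring
    _ = cd d * (√lam ^ d * (T ^ d / 2 * tau d)) := by rw [← e]; ring
    _ ≤ _ := by gcongr

end main

/-! ### Part 13: conclusion -/

lemma int_W {d : ℕ} (hd : 1 ≤ d) {ρ : ℝ} {W : Ed d → ℝ} {C η₀ : ℝ} (hρ : 0 < ρ) (hC : 0 < C)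
    (hW : Continuous W)
    (h : ∀ k : ℕ, k ≤ 2 → ∀ x : Ed d,
      ‖iteratedFDeriv ℝ k W x‖ ≤ C * (1 + ‖x‖) ^ (-ρ - (k : ℝ)))
    (hη₀ : 0 < η₀) (lam : ℝ) (hlam : 0 < lam) :
    Integrable (fun x => √(max (-(η₀ * W x) - lam) 0) ^ d) := by
  obtain ⟨-, -, hW0, -⟩ := SC_bounds hρ hC h
  have hc : Continuous (fun x => √(max (-(η₀ * W x) - lam) 0) ^ d) := by fun_prop
  refine hc.integrable_of_hasCompactSupport ?_
  have hX0 : 0 < (η₀ * C / lam) ^ (1 / ρ) := by positivity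
  refine HasCompactSupport.intro (isCompact_closedBall (0 : Ed d) ((η₀ * C / lam) ^ (1 / ρ))) ?_
  intro x hx
  rw [mem_closedBall_zero_iff, not_le] at hx
  have h1 := neg_le_of_abs_le (hW0 _ hX0 x hx.le)
  rw [← Real.rpow_mul (by positivity), show 1 / ρ * -ρ = -1 by field_simp,
      Real.rpow_neg_one, inv_div] at h1
  have h2 : -(η₀ * W x) ≤ lam := by
    calc -(η₀ * W x) = η₀ * (-W x) := by ring
      _ ≤ η₀ * (C * (lam / (η₀ * C))) := by gcongr; linarith
      _ = lam := by field_simp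
  rw [max_eq_right (by linarith), Real.sqrt_zero, zero_pow (by omega)]

/-- Theorem 3.1 (i), case `η₀ > 0`: eigenvalue asymptotics for `-Δ + ηW`. -/
theorem discrete_spectrum_asymptotics_positive_mean
    (d : ℕ) (hd : 1 ≤ d) (ρ : ℝ) (hρ : ρ ∈ Set.Ioo (0 : ℝ) 2)
    (W : Ed d → ℝ) (hW : SClass d 2 ρ W)
    (C R : ℝ) (hC : 0 < C) (hR : 0 < R)
    (hWneg : ∀ x : Ed d, R ≤ ‖x‖ → W x ≤ -C * ‖x‖ ^ (-ρ))
    (η φ : Ed d → ℝ) (η₀ : ℝ) (hη : IsAdmissible d η η₀ φ) (hη₀ : 0 < η₀) :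
    Tendsto (fun E : ℝ =>
        ((schN d (fun x => η x * W x) E).toNat : ℝ) / Ncl d (fun x => η₀ * W x) E)
      (𝓝[<] 0) (𝓝 1) ∧
    ∃ c₁ c₂ : ℝ, 0 < c₁ ∧ 0 < c₂ ∧ ∃ E₀ : ℝ, E₀ < 0 ∧ ∀ E ∈ Set.Ioo E₀ (0 : ℝ),
      schN d (fun x => η x * W x) E ≠ ⊤ ∧
      c₁ * |E| ^ ((d : ℝ) * (1 / 2 - 1 / ρ)) ≤ ((schN d (fun x => η x * W x) E).toNat : ℝ) ∧
      ((schN d (fun x => η x * W x) E).toNat : ℝ) ≤ c₂ * |E| ^ ((d : ℝ) * (1 / 2 - 1 / ρ)) := by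
  obtain ⟨hW2, C1, hC1, hb⟩ := hW
  have hW2' : ContDiff ℝ 2 W := by exact_mod_cast hW2
  obtain ⟨M1, hM1⟩ := hη.bounded 1 (by norm_num)
  have hM1' : ∀ x, ‖fderiv ℝ φ x‖ ≤ M1 := fun x => by
    rw [← norm_iteratedFDeriv_one]; exact hM1 x
  obtain ⟨Cst, hCst, hcore⟩ := core hd hρ.1 hρ.2 hC1 hW2' hb hη₀ hη.smooth hη.poisson hM1'
  obtain ⟨c, hc, hlow⟩ := Ncl_lower hd hρ.1 hC hR hW2'.continuous hWneg hη₀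
    (int_W hd hρ.1 hC1 hW2'.continuous hb hη₀)
  have hd' : (1:ℝ) ≤ d := by exact_mod_cast hd
  have hκ : (d : ℝ) * (1 / 2 - 1 / ρ) < 0 := by
    refine mul_neg_of_pos_of_neg (by linarith) ?_
    have : 1 / 2 < 1 / ρ := one_div_lt_one_div_of_lt hρ.1 hρ.2
    linarith
  set κ : ℝ := (d : ℝ) * (1 / 2 - 1 / ρ) with hκdef
  have hr : Tendsto (fun lam : ℝ => lam ^ κ) (𝓝[>] 0) atTop := tendsto_rpow_neg_nhdsGT_zero hκ
  have hmain : ∀ ε : ℝ, 0 < ε → ∀ᶠ lam in 𝓝[>] (0:ℝ),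
      schN d (fun x => η x * W x) (-lam) ≠ ⊤ ∧
      |((schN d (fun x => η x * W x) (-lam)).toNat : ℝ) - Ncl d (fun x => η₀ * W x) (-lam)| ≤
        ε * lam ^ κ := by
    intro ε hε
    obtain ⟨K, hK⟩ := hcore (ε / 2 / Cst) (by positivity)
    filter_upwards [hK, hr.eventually_ge_atTop (K / (ε / 2))] with lam h1 h2
    refine ⟨h1.1, h1.2.1.trans ?_⟩
    rw [div_le_iff₀ (by positivity)] at h2
    have : ε / 2 / Cst * (Cst * lam ^ κ) = ε / 2 * lam ^ κ := by field_simp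
    rw [this]; linarith
  have hupp : ∀ᶠ lam in 𝓝[>] (0:ℝ),
      Ncl d (fun x => η₀ * W x) (-lam) ≤ (Cst + 1) * lam ^ κ := by
    obtain ⟨K, hK⟩ := hcore 1 one_pos
    filter_upwards [hK, hr.eventually_ge_atTop K] with lam h1 h2
    linarith [h1.2.2]
  have hneg : Tendsto (fun E : ℝ => -E) (𝓝[<] 0) (𝓝[>] 0) := by
    have := tendsto_neg_nhdsLT (a := (0:ℝ))
    rwa [neg_zero] at this
  constructor
  · rw [Metric.tendsto_nhds]
    intro ε hε
    have h := ((hmain (ε * c / 2) (by positivity)).and hlow).and self_mem_nhdsWithin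
    filter_upwards [hneg.eventually h] with E hE
    obtain ⟨⟨⟨-, h1⟩, h2⟩, h3⟩ := hE
    simp only [neg_neg] at h1 h2
    have h3' : 0 < -E := h3
    have hp : 0 < (-E) ^ κ := by positivity
    have hN : 0 < Ncl d (fun x => η₀ * W x) E := lt_of_lt_of_le (by positivity) h2
    rw [Real.dist_eq, div_sub_one hN.ne', abs_div, abs_of_pos hN, div_lt_iff₀ hN]
    calc _ ≤ ε * c / 2 * (-E) ^ κ := h1
      _ < ε * (c * (-E) ^ κ) := by
        have : 0 < ε * (c * (-E) ^ κ) := by positivity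
        linarith
      _ ≤ _ := by gcongr
  · refine ⟨c / 2, Cst + 1 + c / 2, by positivity, by positivity, ?_⟩
    have h := (((hmain (c / 2) (by positivity)).and hlow).and hupp)
    have h' := hneg.eventually h
    obtain ⟨E₀, hE₀, hsub⟩ := mem_nhdsLT_iff_exists_Ioo_subset.mp h'
    refine ⟨E₀, hE₀, fun E hE => ?_⟩
    obtain ⟨⟨⟨h0, h1⟩, h2⟩, h3⟩ := hsub hE
    simp only [neg_neg] at h0 h1 h2 h3
    rw [abs_of_neg hE.2]
    have h1' := abs_le.mp h1
    exact ⟨h0, by linarith, by linarith⟩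

end
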